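/- arXiv:2204.01036 — 3 statements merged into one kernel-verified Lean document; each statement's English description precedes it below -/
import Mathlib

section
/- If the Riemann Hypothesis is true, then Keiper's constants satisfy λ_n^K = (1/2)[log n + (γ − log 2π − 1)] + o(1) as n → ∞; that is, the sequence n ↦ λ_n^K − (1/2)log n converges to (1/2)(γ − log 2π − 1), where γ is the Euler–Mascheroni constant. -/
open scoped Nat BigOperators

/-- The completed Riemann zeta function `2ξ(s) = s(s-1)π^{-s/2}Γ(s/2)ζ(s)`,
extended by its (entire) values `1` at `s = 0, 1`. -/
noncomputable def xi2 (s : ℂ) : ℂ :=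
  if s = 0 ∨ s = 1 then 1
  else s * (s - 1) * (Real.pi : ℂ) ^ (-s / 2) * Complex.Gamma (s / 2) * riemannZeta s

/-- The coefficients `A_{nm} = 2^{m-n} (2(n+m)-1)!! / ((2m-1)(n-m)!(2m)!)`. -/
noncomputable def A (n m : ℕ) : ℝ :=
  (2 : ℝ) ^ ((m : ℤ) - (n : ℤ)) * (Nat.doubleFactorial (2 * (n + m) - 1) : ℝ) /
    ((2 * (m : ℝ) - 1) * (Nat.factorial (n - m) : ℝ) * (Nat.factorial (2 * m) : ℝ))

/-- `Φ_m = log 2ξ(2m)`, a real number (the value `2ξ(2m)` is a positive real). -/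
noncomputable def PhiVal (m : ℕ) : ℝ := (Complex.log (xi2 (2 * m))).re

/-- The closed-form variant `Λ_n` of the Keiper sequence. -/
noncomputable def Lambda (n : ℕ) : ℝ := ∑ m ∈ Finset.Icc 1 n, (-1 : ℝ) ^ m * A n m * PhiVal m

/-- `Φ(z) = log 2ξ(1/(1-z))` (principal branch), analytic near `z = 0`. -/
noncomputable def PhiKL (z : ℂ) : ℂ := Complex.log (xi2 (1 / (1 - z)))

/-- Keiper's constants `λ_n^K`: the `n`-th Taylor coefficient of `Φ` at `0`
(a real number; we take the real part). -/
noncomputable def lambdaK (n : ℕ) : ℝ := (iteratedDeriv n PhiKL 0 / (Nat.factorial n : ℂ)).re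

/-- Li's constants `λ_n^L = n·λ_n^K`. -/
noncomputable def lambdaL (n : ℕ) : ℝ := n * lambdaK n

section

open Complex MeasureTheory Filter Topology Metric Set

theorem integral_re_circleMap_mul_exp {F : ℂ → ℂ} {r : ℝ} (hr : 0 < r)
    (hF : DifferentiableOn ℂ F (closedBall 0 r)) {n : ℕ} (hn : n ≠ 0) :
    ∫ θ in (0 : ℝ)..2 * Real.pi, ((F (circleMap 0 r θ)).re : ℂ) * cexp (-(n * θ * I)) =
      Real.pi * r ^ n * (iteratedDeriv n F 0 / n.factorial) := by
  have hr' : (r : ℂ) ≠ 0 := by exact_mod_cast hr.ne'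
  have hcont : Continuous fun θ : ℝ => F (circleMap 0 r θ) :=
    hF.continuousOn.comp_continuous (continuous_circleMap 0 r)
      fun θ => circleMap_mem_closedBall 0 hr.le θ
  have h1 : ∫ θ in (0 : ℝ)..2 * Real.pi, F (circleMap 0 r θ) * cexp (-(n * θ * I)) =
      2 * Real.pi * r ^ n * (iteratedDeriv n F 0 / n.factorial) := by
    have h := hF.circleIntegral_one_div_sub_center_pow_smul hr n
    rw [circleIntegral] at h
    have : ∀ θ : ℝ, deriv (circleMap 0 r) θ • ((1 / (circleMap 0 r θ - 0) ^ (n + 1)) •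
        F (circleMap 0 r θ)) = (I / r ^ n) * (F (circleMap 0 r θ) * cexp (-(n * θ * I))) := by
      intro θ
      have e : cexp (-(n * θ * I)) = (cexp (θ * I) ^ n)⁻¹ := by
        rw [← Complex.exp_nat_mul, ← Complex.exp_neg]; ring_nf
      have := Complex.exp_ne_zero (θ * I)
      rw [deriv_circleMap, e]
      simp only [circleMap, smul_eq_mul, zero_add, sub_zero]
      field_simp
      ring
    simp only [this] at h
    rw [intervalIntegral.integral_const_mul] at h
    have hI := Complex.I_ne_zero
    have hrn : (r : ℂ) ^ n ≠ 0 := pow_ne_zero _ hr'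
    have hf : (n.factorial : ℂ) ≠ 0 := by exact_mod_cast n.factorial_ne_zero
    rw [smul_eq_mul] at h
    field_simp at h ⊢
    linear_combination h
  have h2 : ∫ θ in (0 : ℝ)..2 * Real.pi, F (circleMap 0 r θ) * cexp (n * θ * I) = 0 := by
    have hd : DiffContOnCl ℂ (fun z => z ^ (n - 1) * F z) (ball 0 r) := by
      have : DifferentiableOn ℂ (fun z => z ^ (n - 1) * F z) (closedBall 0 r) := by fun_prop
      exact (this.mono closure_ball_subset_closedBall).diffContOnCl
    have h := hd.circleIntegral_eq_zero hr.le
    rw [circleIntegral] at h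
    have : ∀ θ : ℝ, deriv (circleMap 0 r) θ • ((circleMap 0 r θ) ^ (n - 1) *
        F (circleMap 0 r θ)) = (I * r ^ n) * (F (circleMap 0 r θ) * cexp (n * θ * I)) := by
      intro θ
      have e : cexp (n * θ * I) = (cexp (θ * I) ^ n) := by
        rw [← Complex.exp_nat_mul]; ring_nf
      obtain ⟨m, rfl⟩ := Nat.exists_eq_succ_of_ne_zero hn
      rw [deriv_circleMap, e]
      simp only [circleMap, smul_eq_mul, zero_add]
      simp
      ring
    simp only [this] at h
    rw [intervalIntegral.integral_const_mul] at h
    simpa [hr'] using h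
  have h3 : ∫ θ in (0 : ℝ)..2 * Real.pi,
      (starRingEnd ℂ) (F (circleMap 0 r θ)) * cexp (-(n * θ * I)) = 0 := by
    have := congrArg (starRingEnd ℂ) h2
    rw [← intervalIntegral.intervalIntegral_conj] at this
    rw [map_zero] at this
    refine Eq.trans ?_ this
    refine intervalIntegral.integral_congr fun θ _ => ?_
    simp [← Complex.exp_conj]
  have h4 : ∀ θ : ℝ, ((F (circleMap 0 r θ)).re : ℂ) * cexp (-(n * θ * I)) =
      (1 / 2) * (F (circleMap 0 r θ) * cexp (-(n * θ * I)) +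
        (starRingEnd ℂ) (F (circleMap 0 r θ)) * cexp (-(n * θ * I))) := by
    intro θ
    rw [Complex.re_eq_add_conj]; ring
  simp only [h4]
  rw [intervalIntegral.integral_const_mul, intervalIntegral.integral_add, h1, h3]
  · ring
  · exact (hcont.mul (by fun_prop)).intervalIntegrable _ _
  · refine Continuous.intervalIntegrable ?_ _ _
    exact (continuous_conj.comp hcont).mul (by fun_prop)

theorem norm_exp_sub_one_le_dist (θ : ℝ) (k : ℤ) :
    ‖cexp (θ * I) - 1‖ ≤ |θ - k * (2 * Real.pi)| := by
  have : cexp (θ * I) = cexp (I * ((θ - k * (2 * Real.pi) : ℝ) : ℂ)) := by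
    rw [Complex.exp_eq_exp_iff_exists_int]
    refine ⟨k, ?_⟩
    push_cast
    ring
  rw [this]
  exact Real.norm_exp_I_mul_ofReal_sub_one_le

/-- Near the boundary point `1`, the Poisson kernel of the point `r (1 - δ)` is at least
`1 / (4 δ)`. -/
theorem one_le_poissonKernel {r δ θ : ℝ} (hr : 0 < r) (hδ : 0 < δ) (hδ' : δ < 1)
    (h : ‖cexp (θ * I) - 1‖ ≤ δ) :
    1 ≤ 4 * δ * poissonKernel 0 ((r * (1 - δ) : ℝ) : ℂ) (circleMap 0 r θ) := by
  have e1 : ‖circleMap 0 r θ - 0‖ = r := by simp [abs_of_pos hr]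
  have e2 : ‖((r * (1 - δ) : ℝ) : ℂ) - 0‖ = r * (1 - δ) := by
    rw [sub_zero, Complex.norm_real, Real.norm_of_nonneg (by nlinarith)]
  have e3 : ‖(circleMap 0 r θ - 0) - (((r * (1 - δ) : ℝ) : ℂ) - 0)‖ =
      r * ‖cexp (θ * I) - (1 - δ)‖ := by
    have : (circleMap 0 r θ - 0) - (((r * (1 - δ) : ℝ) : ℂ) - 0) =
      r * (cexp (θ * I) - (1 - δ)) := by
      simp [circleMap]; ring
    rw [this, norm_mul, Complex.norm_real, Real.norm_of_nonneg hr.le]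
  rw [poissonKernel_def, e1, e2, e3]
  set N := ‖cexp (θ * I) - (1 - δ)‖
  have hN1 : N ≤ 2 * δ := by
    calc N = ‖(cexp (θ * I) - 1) + δ‖ := by simp only [N]; congr 1; ring
      _ ≤ ‖cexp (θ * I) - 1‖ + ‖(δ : ℂ)‖ := norm_add_le _ _
      _ ≤ 2 * δ := by rw [Complex.norm_real, Real.norm_of_nonneg hδ.le]; linarith
  have hN0 : 0 < N := by
    have := norm_sub_norm_le (cexp (θ * I)) (1 - δ : ℂ)
    have h2 : ‖(1 - δ : ℂ)‖ = 1 - δ := by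
      rw [← Complex.ofReal_one, ← Complex.ofReal_sub, Complex.norm_real,
        Real.norm_of_nonneg (by linarith)]
    rw [Complex.norm_exp_ofReal_mul_I, h2] at this
    have : δ ≤ N := by linarith
    linarith
  rw [mul_div_assoc', le_div_iff₀ (by positivity)]
  have : N ^ 2 ≤ 4 * δ ^ 2 := by nlinarith
  have h5 : r ^ 2 - (r * (1 - δ)) ^ 2 = r ^ 2 * (δ * (2 - δ)) := by ring
  rw [h5, mul_pow, one_mul]
  have : N ^ 2 ≤ 4 * δ * (δ * (2 - δ)) := by nlinarith [mul_pos hδ hδ]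
  nlinarith [mul_le_mul_of_nonneg_left this (sq_nonneg r)]
/-- Moving radially towards the unit circle at most shrinks the distance to a boundary point by a
factor of two. -/
theorem dist_circleMap_one_le {r θ : ℝ} (hr : r ∈ Icc (0 : ℝ) 1) {z₀ : ℂ} (hz₀ : ‖z₀‖ = 1) :
    ‖circleMap 0 1 θ - z₀‖ ≤ 2 * ‖circleMap 0 r θ - z₀‖ := by
  have h1 : ‖circleMap 0 1 θ - circleMap 0 r θ‖ = 1 - r := by
    have : circleMap 0 1 θ - circleMap 0 r θ = ((1 - r : ℝ) : ℂ) * cexp (θ * I) := by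
      simp [circleMap]; ring
    rw [this, norm_mul, Complex.norm_exp_ofReal_mul_I, mul_one, Complex.norm_real,
      Real.norm_of_nonneg (by linarith [hr.2])]
  have h2 : 1 - r ≤ ‖circleMap 0 r θ - z₀‖ := by
    have := norm_sub_norm_le z₀ (circleMap 0 r θ)
    rw [hz₀, norm_sub_rev] at this
    simpa [abs_of_nonneg hr.1] using this
  calc ‖circleMap 0 1 θ - z₀‖ =
        ‖(circleMap 0 1 θ - circleMap 0 r θ) + (circleMap 0 r θ - z₀)‖ := by congr 1; ring
    _ ≤ ‖circleMap 0 1 θ - circleMap 0 r θ‖ + ‖circleMap 0 r θ - z₀‖ := norm_add_le _ _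
    _ ≤ _ := by linarith

theorem tendsto_circleMap_prod (θ₀ : ℝ) :
    Tendsto (fun p : ℝ × ℝ => circleMap 0 p.1 p.2) (𝓝 1 ×ˢ 𝓝 θ₀) (𝓝 (circleMap 0 1 θ₀)) := by
  rw [← nhds_prod_eq]
  have : Continuous (fun p : ℝ × ℝ => circleMap 0 p.1 p.2) := by
    unfold circleMap; fun_prop
  exact this.tendsto (1, θ₀)

/-- An analytic function is, up to a constant, at least as large just inside the unit circle as on
the circle itself. -/
theorem AnalyticAt.exists_le_norm_circleMap {f : ℂ → ℂ} {θ₀ : ℝ}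
    (hf : AnalyticAt ℂ f (circleMap 0 1 θ₀)) (hne : ¬ ∀ᶠ z in 𝓝 (circleMap 0 1 θ₀), f z = 0) :
    ∃ c > 0, ∃ t ∈ 𝓝 θ₀, ∀ᶠ r in 𝓝[<] (1 : ℝ), ∀ θ ∈ t,
      c * ‖f (circleMap 0 1 θ)‖ ≤ ‖f (circleMap 0 r θ)‖ := by
  obtain ⟨m, g, hg, hg0, hfg⟩ := hf.exists_eventuallyEq_pow_smul_nonzero_iff.mpr hne
  set z₀ := circleMap 0 1 θ₀ with hz₀
  set G := ‖g z₀‖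
  have hG : 0 < G := norm_pos_iff.mpr hg0
  have hz₀n : ‖z₀‖ = 1 := by simp [hz₀]
  have hev : ∀ᶠ z in 𝓝 z₀, f z = (z - z₀) ^ m • g z ∧ G / 2 < ‖g z‖ ∧ ‖g z‖ < 2 * G := by
    have h1 := hg.continuousAt.norm.tendsto.eventually (lt_mem_nhds (half_lt_self hG))
    have h2 := hg.continuousAt.norm.tendsto.eventually
      (gt_mem_nhds (show G < 2 * G by linarith))
    filter_upwards [hfg, h1, h2] with z a b c using ⟨a, b, c⟩
  obtain ⟨p, hp, q, hq, hpq⟩ := eventually_prod_iff.mp ((tendsto_circleMap_prod θ₀).eventually hev)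
  refine ⟨(1 / 2) ^ m / 4, by positivity, {θ | q θ}, hq, ?_⟩
  have hp1 : p 1 := hp.self_of_nhds
  have h01 : ∀ᶠ r in 𝓝[<] (1 : ℝ), (0 : ℝ) < r :=
    nhdsWithin_le_nhds (lt_mem_nhds one_pos)
  filter_upwards [nhdsWithin_le_nhds hp, self_mem_nhdsWithin, h01] with r hr hr1 hr0 θ hθ
  obtain ⟨a1, b1, c1⟩ := hpq hp1 hθ
  obtain ⟨a2, b2, c2⟩ := hpq hr hθ
  simp only at a1 b1 c1 a2 b2 c2
  rw [a1, a2, norm_smul, norm_smul, norm_pow, norm_pow]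
  have hd := dist_circleMap_one_le (θ := θ) ⟨hr0.le, (le_of_lt hr1)⟩ hz₀n
  have hd' : (‖circleMap 0 1 θ - z₀‖ / 2) ^ m ≤ ‖circleMap 0 r θ - z₀‖ ^ m :=
    pow_le_pow_left₀ (by positivity) (by linarith) m
  calc (1 / 2) ^ m / 4 * (‖circleMap 0 1 θ - z₀‖ ^ m * ‖g (circleMap 0 1 θ)‖)
      = (‖circleMap 0 1 θ - z₀‖ / 2) ^ m * (‖g (circleMap 0 1 θ)‖ / 4) := by
        rw [div_pow, div_pow]; ring
    _ ≤ (‖circleMap 0 1 θ - z₀‖ / 2) ^ m * ‖g (circleMap 0 r θ)‖ := by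
        gcongr; linarith
    _ ≤ _ := by gcongr

theorem exists_le_norm_circleMap_of_isCompact {f : ℂ → ℂ} {K : Set ℝ} (hK : IsCompact K)
    (hf : ∀ θ ∈ K, AnalyticAt ℂ f (circleMap 0 1 θ))
    (hne : ∀ θ ∈ K, ¬ ∀ᶠ z in 𝓝 (circleMap 0 1 θ), f z = 0) :
    ∃ c > 0, ∀ᶠ r in 𝓝[<] (1 : ℝ), ∀ θ ∈ K,
      c * ‖f (circleMap 0 1 θ)‖ ≤ ‖f (circleMap 0 r θ)‖ := by
  refine hK.induction_on (p := fun S => ∃ c > 0, ∀ᶠ r in 𝓝[<] (1 : ℝ), ∀ θ ∈ S,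
      c * ‖f (circleMap 0 1 θ)‖ ≤ ‖f (circleMap 0 r θ)‖) ⟨1, one_pos, by simp⟩ ?_ ?_ ?_
  · rintro s t hst ⟨c, hc, h⟩
    exact ⟨c, hc, h.mono fun r hr θ hθ => hr θ (hst hθ)⟩
  · rintro s t ⟨c, hc, h⟩ ⟨c', hc', h'⟩
    refine ⟨min c c', lt_min hc hc', ?_⟩
    filter_upwards [h, h'] with r hr hr' θ hθ
    rcases hθ with hθ | hθ
    · exact le_trans (by gcongr; exact min_le_left _ _) (hr θ hθ)
    · exact le_trans (by gcongr; exact min_le_right _ _) (hr' θ hθ)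
  · intro θ hθ
    obtain ⟨c, hc, t, ht, h⟩ := (hf θ hθ).exists_le_norm_circleMap (hne θ hθ)
    exact ⟨t, mem_nhdsWithin_of_mem_nhds ht, c, hc, h⟩

theorem analyticOnNhd_comp_circleMap {f : ℂ → ℂ} {K : Set ℝ}
    (hf : ∀ θ ∈ K, AnalyticAt ℂ f (circleMap 0 1 θ)) :
    AnalyticOnNhd ℝ (fun θ => f (circleMap 0 1 θ)) K := by
  intro θ hθ
  exact (hf θ hθ).restrictScalars.comp (analyticOnNhd_circleMap 0 1 θ (mem_univ _))

/-- If `f` is bounded by one in the unit disc, zero-free there, and analytic across a compact arc,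
then integrals of `log ‖f‖` over that arc are limits of integrals over concentric arcs. -/
theorem tendsto_integral_log_norm_circleMap {f : ℂ → ℂ} {a b : ℝ} (hab : a < b)
    (hf : ∀ θ ∈ Icc a b, AnalyticAt ℂ f (circleMap 0 1 θ))
    (hball : ContinuousOn f (ball 0 1))
    (hf0 : ∀ z ∈ ball (0 : ℂ) 1, f z ≠ 0) (hf1 : ∀ z ∈ ball (0 : ℂ) 1, ‖f z‖ ≤ 1)
    {e : ℝ → ℂ} (he : Continuous e) (he1 : ∀ θ, ‖e θ‖ = 1) :
    Tendsto (fun r : ℝ => ∫ θ in a..b, (Real.log ‖f (circleMap 0 r θ)‖ : ℂ) * e θ) (𝓝[<] 1)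
      (𝓝 (∫ θ in a..b, (Real.log ‖f (circleMap 0 1 θ)‖ : ℂ) * e θ)) := by
  have hmem : ∀ {r θ : ℝ}, 0 < r → r < 1 → circleMap 0 r θ ∈ ball (0 : ℂ) 1 := by
    intro r θ h0 h1; simp [abs_of_pos h0, h1]
  have h01 : ∀ᶠ r in 𝓝[<] (1 : ℝ), (0 : ℝ) < r := nhdsWithin_le_nhds (lt_mem_nhds one_pos)
  have hlt1 : ∀ᶠ r in 𝓝[<] (1 : ℝ), r < 1 := self_mem_nhdsWithin
  have hrad : ∀ θ : ℝ, Tendsto (fun r : ℝ => circleMap 0 r θ) (𝓝[<] 1) (𝓝 (circleMap 0 1 θ)) := by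
    intro θ
    have : Continuous fun r : ℝ => circleMap 0 r θ := by unfold circleMap; fun_prop
    exact (this.tendsto 1).mono_left nhdsWithin_le_nhds
  have hne : ∀ θ ∈ Icc a b, ¬ ∀ᶠ z in 𝓝 (circleMap 0 1 θ), f z = 0 := by
    intro θ hθ h
    obtain ⟨r, hr, hr1, hr0⟩ :=
      (((hrad θ).eventually h).and (hlt1.and h01)).exists
    exact hf0 _ (hmem hr0 hr1) hr
  obtain ⟨c, hc, hcf⟩ := exists_le_norm_circleMap_of_isCompact isCompact_Icc hf hne
  have han := analyticOnNhd_comp_circleMap hf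
  have hmero : MeromorphicOn (fun θ => f (circleMap 0 1 θ)) (uIcc a b) := by
    rw [uIcc_of_le hab.le]; exact han.meromorphicOn
  have hint := hmero.intervalIntegrable_log_norm
  have hae : ∀ᵐ θ ∂(volume.restrict (uIoc a b)), f (circleMap 0 1 θ) ≠ 0 := by
    have hnz : ∃ x ∈ Icc a b, f (circleMap 0 1 x) ≠ 0 := by
      by_contra! hcon
      have hz : (circleMap 0 1 '' Ioo a b) ⊆ {z | f z = 0} := by
        rintro _ ⟨θ, hθ, rfl⟩; exact hcon θ (Ioo_subset_Icc_self hθ)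
      have hm : (a + b) / 2 ∈ Ioo a b := ⟨by linarith, by linarith⟩
      refine hne _ (Ioo_subset_Icc_self hm) ?_
      refine ((hf _ (Ioo_subset_Icc_self hm)).eventually_eq_zero_or_eventually_ne_zero).resolve_right
        fun hn => ?_
      have hcm : Tendsto (circleMap 0 1) (𝓝[≠] ((a + b) / 2)) (𝓝[≠] (circleMap 0 1 ((a + b) / 2))) := by
        refine (hasDerivAt_circleMap 0 1 _).tendsto_nhdsNE ?_
        simp
      have h1 := hcm.eventually hn
      have h2 : ∀ᶠ θ in 𝓝[≠] ((a + b) / 2), θ ∈ Ioo a b :=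
        nhdsWithin_le_nhds (isOpen_Ioo.mem_nhds hm)
      obtain ⟨θ, h3, h4⟩ := (h1.and h2).exists
      exact h3 (hcon θ (Ioo_subset_Icc_self h4))
    obtain ⟨x, hx, hx0⟩ := hnz
    have hcod := han.preimage_zero_mem_codiscreteWithin hx0 hx (isConnected_Icc hab.le)
    have := ae_restrict_le_codiscreteWithin (μ := volume) measurableSet_Icc hcod
    rw [uIoc_of_le hab.le]
    refine ae_mono (Measure.restrict_mono Ioc_subset_Icc_self le_rfl) ?_
    filter_upwards [this] with θ hθ using by simpa using hθ
  refine intervalIntegral.tendsto_integral_filter_of_dominated_convergence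
    (fun θ => |Real.log ‖f (circleMap 0 1 θ)‖| + |Real.log c|) ?_ ?_ ?_ ?_
  · filter_upwards [self_mem_nhdsWithin, h01] with r hr1 hr0
    refine Continuous.aestronglyMeasurable ?_
    have hc1 : Continuous fun θ => f (circleMap 0 r θ) :=
      hball.comp_continuous (continuous_circleMap 0 r) fun θ => hmem hr0 hr1
    have hc2 : Continuous fun θ => Real.log ‖f (circleMap 0 r θ)‖ :=
      hc1.norm.log fun θ => norm_ne_zero_iff.mpr (hf0 _ (hmem hr0 hr1))
    exact (continuous_ofReal.comp hc2).mul he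
  · filter_upwards [hcf, self_mem_nhdsWithin, h01] with r hcr hr1 hr0
    rw [ae_restrict_iff' measurableSet_uIoc] at hae
    filter_upwards [hae] with θ hθ hmemθ
    have h0 := hθ hmemθ
    rw [uIoc_of_le hab.le] at hmemθ
    have hle := hcr θ (Ioc_subset_Icc_self hmemθ)
    have h1 := Real.log_le_log (mul_pos hc (norm_pos_iff.mpr h0)) hle
    rw [Real.log_mul hc.ne' (norm_ne_zero_iff.mpr h0)] at h1
    have h2 : Real.log ‖f (circleMap 0 r θ)‖ ≤ 0 :=
      Real.log_nonpos (norm_nonneg _) (hf1 _ (hmem hr0 hr1))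
    rw [norm_mul, he1, mul_one, Complex.norm_real, Real.norm_of_nonpos h2]
    have h3 := neg_abs_le (Real.log c)
    have h4 := neg_abs_le (Real.log ‖f (circleMap 0 1 θ)‖)
    linarith
  · exact hint.abs.add (by simp)
  · rw [ae_restrict_iff' measurableSet_uIoc] at hae
    filter_upwards [hae] with θ hθ hmemθ
    have h0 := hθ hmemθ
    rw [uIoc_of_le hab.le] at hmemθ
    have hcf := (hf θ (Ioc_subset_Icc_self hmemθ)).continuousAt.tendsto.comp (hrad θ)
    have := ((Real.continuousAt_log (norm_ne_zero_iff.mpr h0)).tendsto.comp hcf.norm)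
    exact (((continuous_ofReal.tendsto _).comp this).mul_const _)

theorem tendsto_intervalIntegral_mul_exp {g : ℝ → ℝ} {a b : ℝ} (hab : a ≤ b) :
    Tendsto (fun n : ℕ => ∫ θ in a..b, (g θ : ℂ) * cexp (-(n * θ * I))) atTop (𝓝 0) := by
  have h := Real.tendsto_integral_exp_smul_cocompact ((Ioc a b).indicator fun θ => (g θ : ℂ))
  have h2 : Tendsto (fun n : ℕ => (n : ℝ) / (2 * Real.pi)) atTop (cocompact ℝ) :=
    (tendsto_natCast_atTop_atTop.atTop_div_const (by positivity)).mono_right atTop_le_cocompact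
  refine (h.comp h2).congr fun n => ?_
  rw [intervalIntegral.integral_of_le hab, ← integral_indicator measurableSet_Ioc]
  refine integral_congr_ae (Eventually.of_forall fun θ => ?_)
  by_cases hθ : θ ∈ Ioc a b
  · simp only [hθ, indicator_of_mem, Circle.smul_def, Real.fourierChar_apply, smul_eq_mul]
    rw [mul_comm]
    congr 2
    have := Real.pi_ne_zero
    push_cast
    field_simp
  · simp [hθ]
/-- For a function `F` with nonpositive real part on a disc, the mass of `Re F` on an arc of
angular radius `δ` around `1` is controlled by the value of `F` at distance `δ` from `1`. -/
theorem integral_neg_re_near_one_le {F : ℂ → ℂ} {r δ : ℝ} (hr : 0 < r) (hδ : 0 < δ) (hδ1 : δ < 1)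
    (hF : DifferentiableOn ℂ F (closedBall 0 r)) (hneg : ∀ z ∈ closedBall (0 : ℂ) r, (F z).re ≤ 0) :
    (∫ θ in (0 : ℝ)..δ, -(F (circleMap 0 r θ)).re) +
      (∫ θ in (2 * Real.pi - δ)..(2 * Real.pi), -(F (circleMap 0 r θ)).re) ≤
      4 * δ * (2 * Real.pi * -(F ((r * (1 - δ) : ℝ) : ℂ)).re) := by
  set w : ℂ := ((r * (1 - δ) : ℝ) : ℂ) with hw
  have hwb : w ∈ ball (0 : ℂ) r := by
    rw [mem_ball_zero_iff, hw, Complex.norm_real, Real.norm_of_nonneg (by nlinarith)]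
    nlinarith
  have hmem : ∀ θ : ℝ, circleMap 0 r θ ∈ closedBall (0 : ℂ) r :=
    fun θ => circleMap_mem_closedBall 0 hr.le θ
  have hcont : Continuous fun θ : ℝ => F (circleMap 0 r θ) :=
    hF.continuousOn.comp_continuous (continuous_circleMap 0 r) hmem
  have hcont' : Continuous fun θ : ℝ => -(F (circleMap 0 r θ)).re :=
    (continuous_re.comp hcont).neg
  have hPcont : Continuous fun θ : ℝ => poissonKernel 0 w (circleMap 0 r θ) := by
    unfold poissonKernel
    refine Continuous.div (by fun_prop) (by fun_prop) fun θ => ?_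
    rw [pow_ne_zero_iff two_ne_zero, norm_ne_zero_iff, sub_zero, sub_zero, sub_ne_zero]
    intro h
    rw [← h, mem_ball_zero_iff] at hwb
    simp [abs_of_pos hr] at hwb
  have hP0 : ∀ θ : ℝ, 0 ≤ poissonKernel 0 w (circleMap 0 r θ) := by
    intro θ
    rw [poissonKernel_def]
    refine div_nonneg ?_ (by positivity)
    have := mem_ball_zero_iff.mp hwb
    simp only [sub_zero, norm_circleMap_zero, abs_of_pos hr, sub_nonneg]
    gcongr
  set q : ℝ → ℝ := fun θ => poissonKernel 0 w (circleMap 0 r θ) * -(F (circleMap 0 r θ)).re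
    with hq
  have hqc : Continuous q := hPcont.mul hcont'
  have hq0 : ∀ θ, 0 ≤ q θ := fun θ => mul_nonneg (hP0 θ) (neg_nonneg.mpr (hneg _ (hmem θ)))
  have hpois : ∫ θ in (0 : ℝ)..2 * Real.pi, q θ = 2 * Real.pi * -(F w).re := by
    have hd : DiffContOnCl ℂ F (ball 0 r) :=
      (hF.mono closure_ball_subset_closedBall).diffContOnCl
    have h := congrArg (fun x => -(Complex.re x)) (hd.circleAverage_poissonKernel_smul hwb)
    simp only [Real.circleAverage, Pi.smul_apply', Complex.real_smul,
      Complex.re_ofReal_mul] at h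
    rw [← h]
    have e : ∀ θ, q θ = -Complex.reCLM ((poissonKernel 0 w (circleMap 0 r θ) : ℂ) *
        F (circleMap 0 r θ)) := by intro θ; simp [hq]
    simp only [e]
    rw [intervalIntegral.integral_neg, ContinuousLinearMap.intervalIntegral_comp_comm]
    · have := Real.pi_ne_zero
      simp only [Complex.reCLM_apply]
      field_simp
    · exact ((continuous_ofReal.comp hPcont).mul hcont).intervalIntegrable _ _
  have hpt : ∀ (θ : ℝ) (k : ℤ), |θ - k * (2 * Real.pi)| ≤ δ →
      -(F (circleMap 0 r θ)).re ≤ 4 * δ * q θ := by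
    intro θ k hθ
    have h1 := one_le_poissonKernel hr hδ hδ1 ((norm_exp_sub_one_le_dist θ k).trans hθ)
    have h2 : 0 ≤ -(F (circleMap 0 r θ)).re := neg_nonneg.mpr (hneg _ (hmem θ))
    calc -(F (circleMap 0 r θ)).re = 1 * -(F (circleMap 0 r θ)).re := (one_mul _).symm
      _ ≤ (4 * δ * poissonKernel 0 w (circleMap 0 r θ)) * -(F (circleMap 0 r θ)).re := by gcongr
      _ = _ := by simp only [hq]; ring
  have hi : ∀ a b, IntervalIntegrable q volume a b := fun a b => hqc.intervalIntegrable a b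
  have hpi : δ ≤ 2 * Real.pi - δ := by linarith [Real.pi_gt_three]
  have i1 : ∫ θ in (0 : ℝ)..δ, -(F (circleMap 0 r θ)).re ≤ 4 * δ * ∫ θ in (0 : ℝ)..δ, q θ := by
    rw [← intervalIntegral.integral_const_mul]
    refine intervalIntegral.integral_mono_on hδ.le (hcont'.intervalIntegrable _ _)
      ((hqc.const_mul _).intervalIntegrable _ _) fun θ hθ => hpt θ 0 ?_
    rw [abs_le]; push_cast; constructor <;> linarith [hθ.1, hθ.2]
  have i2 : ∫ θ in (2 * Real.pi - δ)..(2 * Real.pi), -(F (circleMap 0 r θ)).re ≤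
      4 * δ * ∫ θ in (2 * Real.pi - δ)..(2 * Real.pi), q θ := by
    rw [← intervalIntegral.integral_const_mul]
    refine intervalIntegral.integral_mono_on (by linarith) (hcont'.intervalIntegrable _ _)
      ((hqc.const_mul _).intervalIntegrable _ _) fun θ hθ => hpt θ 1 ?_
    rw [abs_le]; push_cast; constructor <;> linarith [hθ.1, hθ.2]
  have i3 : 0 ≤ ∫ θ in δ..(2 * Real.pi - δ), q θ :=
    intervalIntegral.integral_nonneg hpi fun θ _ => hq0 θ
  rw [← hpois, ← intervalIntegral.integral_add_adjacent_intervals (hi 0 (2 * Real.pi - δ))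
    (hi _ (2 * Real.pi)), ← intervalIntegral.integral_add_adjacent_intervals (hi 0 δ) (hi _ _)]
  nlinarith

/-- Let `f = exp F` be bounded by one in the unit disc and analytic across the unit circle away
from `1`. If `(1 - x) Re F(x) → 0` as `x → 1⁻`, the Taylor coefficients of `F` tend to zero. -/
theorem tendsto_taylorCoeff_of_norm_le_one {f F : ℂ → ℂ}
    (hf : ∀ z : ℂ, ‖z‖ = 1 → z ≠ 1 → AnalyticAt ℂ f z)
    (hF : DifferentiableOn ℂ F (ball 0 1)) (hfF : ∀ z ∈ ball (0 : ℂ) 1, f z = cexp (F z))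
    (hneg : ∀ z ∈ ball (0 : ℂ) 1, (F z).re ≤ 0)
    (hlim : Tendsto (fun x : ℝ => (1 - x) * (F x).re) (𝓝[<] 1) (𝓝 0)) :
    Tendsto (fun n : ℕ => iteratedDeriv n F 0 / n.factorial) atTop (𝓝 0) := by
  have h01 : ∀ᶠ r in 𝓝[<] (1 : ℝ), (0 : ℝ) < r := nhdsWithin_le_nhds (lt_mem_nhds one_pos)
  have hlt1 : ∀ᶠ r in 𝓝[<] (1 : ℝ), r < 1 := self_mem_nhdsWithin
  have hlog : ∀ z ∈ ball (0 : ℂ) 1, Real.log ‖f z‖ = (F z).re := by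
    intro z hz; rw [hfF z hz, Complex.norm_exp, Real.log_exp]
  have hmem : ∀ {r θ : ℝ}, 0 < r → r < 1 → circleMap 0 r θ ∈ ball (0 : ℂ) 1 := by
    intro r θ h0 h1; simp [abs_of_pos h0, h1]
  have hfc : ContinuousOn f (ball 0 1) := by
    refine ContinuousOn.congr (f := fun z => cexp (F z)) ?_ hfF
    exact hF.continuousOn.cexp
  have key : ∀ δ : ℝ, 0 < δ → δ < 1 → ∀ n : ℕ, n ≠ 0 →
      Real.pi * ‖iteratedDeriv n F 0 / n.factorial‖ ≤
        8 * Real.pi * (δ * -(F ((1 - δ : ℝ) : ℂ)).re) +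
        ‖∫ θ in δ..(2 * Real.pi - δ),
          (Real.log ‖f (circleMap 0 1 θ)‖ : ℂ) * cexp (-(n * θ * I))‖ := by
    intro δ hδ hδ1 n hn
    have hpi : δ < 2 * Real.pi - δ := by linarith [Real.pi_gt_three]
    have hana : ∀ θ ∈ Icc δ (2 * Real.pi - δ), AnalyticAt ℂ f (circleMap 0 1 θ) := by
      intro θ hθ
      refine hf _ (by simp) fun h => ?_
      obtain ⟨k, hk⟩ := Complex.exp_eq_one_iff.mp (by simpa [circleMap] using h)
      have hk' : θ = k * (2 * Real.pi) := by
        have h2 : (θ : ℂ) = k * (2 * Real.pi) :=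
          mul_right_cancel₀ Complex.I_ne_zero (hk.trans (by ring))
        exact_mod_cast h2
      have hpos := Real.two_pi_pos
      have hk0 : 0 < k := by
        by_contra! hcon
        have : (k : ℝ) ≤ 0 := by exact_mod_cast hcon
        nlinarith [hθ.1]
      have hk1 : k < 1 := by
        by_contra! hcon
        have : (1 : ℝ) ≤ k := by exact_mod_cast hcon
        nlinarith [hθ.2]
      omega
    have he1 : ∀ θ : ℝ, ‖cexp (-(n * θ * I))‖ = 1 := by
      intro θ
      have : -(n * θ * I) = ((-(n * θ) : ℝ) : ℂ) * I := by push_cast; ring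
      rw [this, Complex.norm_exp_ofReal_mul_I]
    have hmid := tendsto_integral_log_norm_circleMap hpi hana hfc
      (fun z hz => by rw [hfF z hz]; exact Complex.exp_ne_zero _)
      (fun z hz => by
        rw [hfF z hz, Complex.norm_exp]; exact Real.exp_le_one_iff.mpr (hneg z hz))
      (e := fun θ => cexp (-(n * θ * I))) (by fun_prop) he1
    have hFc : Tendsto (fun r : ℝ => -(F ((r * (1 - δ) : ℝ) : ℂ)).re) (𝓝[<] 1)
        (𝓝 (-(F ((1 - δ : ℝ) : ℂ)).re)) := by
      have hb : ((1 - δ : ℝ) : ℂ) ∈ ball (0 : ℂ) 1 := by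
        rw [mem_ball_zero_iff, Complex.norm_real, Real.norm_of_nonneg (by linarith)]
        linarith
      have hc := ((hF.differentiableAt (isOpen_ball.mem_nhds hb)).continuousAt).tendsto
      have hr : Tendsto (fun r : ℝ => ((r * (1 - δ) : ℝ) : ℂ)) (𝓝[<] 1) (𝓝 ((1 - δ : ℝ) : ℂ)) := by
        have : Continuous fun r : ℝ => ((r * (1 - δ) : ℝ) : ℂ) := by fun_prop
        simpa using (this.tendsto 1).mono_left nhdsWithin_le_nhds
      exact ((continuous_re.tendsto _).comp (hc.comp hr)).neg
    have hpow : Tendsto (fun r : ℝ => Real.pi * r ^ n * ‖iteratedDeriv n F 0 / n.factorial‖)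
        (𝓝[<] 1) (𝓝 (Real.pi * ‖iteratedDeriv n F 0 / n.factorial‖)) := by
      have : Continuous fun r : ℝ => Real.pi * r ^ n * ‖iteratedDeriv n F 0 / n.factorial‖ := by
        fun_prop
      simpa using (this.tendsto 1).mono_left nhdsWithin_le_nhds
    have hrhs := ((hFc.const_mul (2 * Real.pi)).const_mul (4 * δ)).add hmid.norm
    have hev : ∀ᶠ r in 𝓝[<] (1 : ℝ),
        Real.pi * r ^ n * ‖iteratedDeriv n F 0 / n.factorial‖ ≤
          4 * δ * (2 * Real.pi * -(F ((r * (1 - δ) : ℝ) : ℂ)).re) +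
          ‖∫ θ in δ..(2 * Real.pi - δ),
            (Real.log ‖f (circleMap 0 r θ)‖ : ℂ) * cexp (-(n * θ * I))‖ := by
      filter_upwards [h01, hlt1] with r hr0 hr1
      have hsub : closedBall (0 : ℂ) r ⊆ ball 0 1 := closedBall_subset_ball hr1
      have hFr := hF.mono hsub
      have hcoef := integral_re_circleMap_mul_exp hr0 hFr hn
      have hnear := integral_neg_re_near_one_le hr0 hδ hδ1 hFr fun z hz => hneg z (hsub hz)
      have hcont : Continuous fun θ : ℝ => F (circleMap 0 r θ) :=
        hFr.continuousOn.comp_continuous (continuous_circleMap 0 r)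
          fun θ => circleMap_mem_closedBall 0 hr0.le θ
      have hcont' : Continuous fun θ : ℝ => ((F (circleMap 0 r θ)).re : ℂ) * cexp (-(n * θ * I)) :=
        (continuous_ofReal.comp (continuous_re.comp hcont)).mul (by fun_prop)
      have hi : ∀ a b, IntervalIntegrable (fun θ : ℝ => ((F (circleMap 0 r θ)).re : ℂ) *
        cexp (-(n * θ * I))) volume a b := fun a b => hcont'.intervalIntegrable a b
      have hbd : ∀ a b : ℝ, a ≤ b →
          ‖∫ θ in a..b, ((F (circleMap 0 r θ)).re : ℂ) * cexp (-(n * θ * I))‖ ≤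
            ∫ θ in a..b, -(F (circleMap 0 r θ)).re := by
        intro a b hab
        refine (intervalIntegral.norm_integral_le_integral_norm hab).trans_eq ?_
        refine intervalIntegral.integral_congr fun θ _ => ?_
        rw [norm_mul, he1, mul_one, Complex.norm_real,
          Real.norm_of_nonpos (hneg _ (hmem hr0 hr1))]
      have hn1 := congrArg norm hcoef
      rw [norm_mul, norm_mul, norm_pow, Complex.norm_real, Complex.norm_real,
        Real.norm_of_nonneg Real.pi_pos.le, Real.norm_of_nonneg hr0.le] at hn1
      rw [← hn1, ← intervalIntegral.integral_add_adjacent_intervals (hi 0 (2 * Real.pi - δ))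
        (hi _ (2 * Real.pi)), ← intervalIntegral.integral_add_adjacent_intervals (hi 0 δ) (hi _ _)]
      have hm : ∫ θ in δ..(2 * Real.pi - δ), (Real.log ‖f (circleMap 0 r θ)‖ : ℂ) *
          cexp (-(n * θ * I)) = ∫ θ in δ..(2 * Real.pi - δ), ((F (circleMap 0 r θ)).re : ℂ) *
          cexp (-(n * θ * I)) := by
        refine intervalIntegral.integral_congr fun θ _ => ?_
        rw [hlog _ (hmem hr0 hr1)]
      rw [hm]
      refine (norm_add₃_le).trans ?_
      have := hbd 0 δ hδ.le
      have := hbd (2 * Real.pi - δ) (2 * Real.pi) (by linarith)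
      linarith
    have := le_of_tendsto_of_tendsto hpow hrhs hev
    linarith
  have hlim' : Tendsto (fun δ : ℝ => 8 * Real.pi * (δ * -(F ((1 - δ : ℝ) : ℂ)).re)) (𝓝[>] 0)
      (𝓝 0) := by
    have h1 : Tendsto (fun δ : ℝ => 1 - δ) (𝓝[>] 0) (𝓝[<] 1) := by
      refine tendsto_nhdsWithin_iff.mpr ⟨?_, ?_⟩
      · have : Continuous fun δ : ℝ => 1 - δ := by fun_prop
        simpa using (this.tendsto 0).mono_left nhdsWithin_le_nhds
      · filter_upwards [self_mem_nhdsWithin] with δ hδ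
        simpa using hδ
    have := (hlim.comp h1).const_mul (-(8 * Real.pi))
    simp only [mul_zero] at this
    refine this.congr fun δ => ?_
    simp only [Function.comp]
    ring
  rw [tendsto_zero_iff_norm_tendsto_zero]
  refine Metric.tendsto_atTop.mpr fun ε hε => ?_
  have hd1 : ∀ᶠ δ in 𝓝[>] (0 : ℝ), δ < 1 := nhdsWithin_le_nhds (gt_mem_nhds one_pos)
  have hd0 : ∀ᶠ δ in 𝓝[>] (0 : ℝ), 0 < δ := self_mem_nhdsWithin
  obtain ⟨δ, hδε, hδ1, hδ0⟩ :=
    ((hlim'.eventually (gt_mem_nhds (show 0 < ε by exact hε))).and (hd1.and hd0)).exists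
  have hRL := (tendsto_intervalIntegral_mul_exp (g := fun θ => Real.log ‖f (circleMap 0 1 θ)‖)
    (show δ ≤ 2 * Real.pi - δ by linarith [Real.pi_gt_three])).norm
  rw [norm_zero] at hRL
  obtain ⟨N, hN⟩ := eventually_atTop.mp (hRL.eventually (gt_mem_nhds hε))
  refine ⟨max N 1, fun n hn => ?_⟩
  have h1 := key δ hδ0 hδ1 n (by have := le_of_max_le_right hn; omega)
  have h2 := hN n (le_of_max_le_left hn)
  rw [dist_zero_right, norm_norm]
  have := Real.pi_gt_three
  nlinarith [norm_nonneg (iteratedDeriv n F 0 / (n.factorial : ℂ))]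

end

section

open Complex Filter Topology Set

theorem hasDerivAt_ofReal_cpow' (s : ℂ) {t : ℝ} (ht : 0 < t) :
    HasDerivAt (fun x : ℝ => (x : ℂ) ^ s) (s * (t : ℂ) ^ (s - 1)) t := by
  have h := (hasDerivAt_id (t : ℂ)).cpow_const (c := s) (Or.inl (by simpa using ht))
  simpa using h.comp_ofReal

theorem norm_cpow_neg_sub_cpow_neg_le {s : ℂ} (hs : 0 ≤ s.re) {a t : ℝ} (ha : 0 < a)
    (hat : a ≤ t) :
    ‖(t : ℂ) ^ (-s) - (a : ℂ) ^ (-s)‖ ≤ ‖s‖ * a ^ (-s.re - 1) * (t - a) := by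
  have h := (convex_Icc a t).norm_image_sub_le_of_norm_hasDerivWithin_le
    (f := fun x : ℝ => (x : ℂ) ^ (-s)) (f' := fun x : ℝ => -s * (x : ℂ) ^ (-s - 1))
    (C := ‖s‖ * a ^ (-s.re - 1))
    (fun x hx => (hasDerivAt_ofReal_cpow' (-s) (ha.trans_le hx.1)).hasDerivWithinAt)
    (fun x hx => ?_) (left_mem_Icc.mpr hat) (right_mem_Icc.mpr hat)
  · rwa [Real.norm_of_nonneg (by linarith)] at h
  · rw [norm_mul, norm_neg, Complex.norm_cpow_eq_rpow_re_of_pos (ha.trans_le hx.1)]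
    refine mul_le_mul_of_nonneg_left ?_ (norm_nonneg s)
    simp only [sub_re, neg_re, one_re]
    exact Real.rpow_le_rpow_of_nonpos ha hx.1 (by linarith)

/-- The difference of `(s - 1) a ^ (-s)` and `(s - 1) ∫ t in a..a + 1, t ^ (-s)`. -/
noncomputable def zetaTerm (a : ℝ) (s : ℂ) : ℂ :=
  (s - 1) * (a : ℂ) ^ (-s) + ((a + 1 : ℝ) : ℂ) ^ (1 - s) - (a : ℂ) ^ (1 - s)

theorem norm_zetaTerm_le {s : ℂ} (hs : 0 ≤ s.re) {a : ℝ} (ha : 0 < a) :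
    ‖zetaTerm a s‖ ≤ ‖s - 1‖ * ‖s‖ * a ^ (-s.re - 1) := by
  have hpos : 0 ≤ ‖s‖ * a ^ (-s.re - 1) := by positivity
  have h := (convex_Icc a (a + 1)).norm_image_sub_le_of_norm_hasDerivWithin_le
    (f := fun x : ℝ => (x : ℂ) * ((s - 1) * (a : ℂ) ^ (-s)) + (x : ℂ) ^ (1 - s))
    (f' := fun x : ℝ => (s - 1) * (a : ℂ) ^ (-s) + (1 - s) * (x : ℂ) ^ (1 - s - 1))
    (C := ‖s - 1‖ * ‖s‖ * a ^ (-s.re - 1))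
    (fun x hx => ?_) (fun x hx => ?_) (left_mem_Icc.mpr (by linarith : a ≤ a + 1))
      (right_mem_Icc.mpr (by linarith))
  · have e : (a + 1 - a : ℝ) = 1 := by ring
    rw [e, norm_one, mul_one] at h
    refine le_trans (le_of_eq ?_) h
    congr 1
    simp only [zetaTerm]
    push_cast
    ring
  · have h1 := hasDerivAt_ofReal_cpow' (1 - s) (ha.trans_le hx.1)
    have h2 := ((hasDerivAt_id (x : ℂ)).comp_ofReal).mul_const ((s - 1) * (a : ℂ) ^ (-s))
    simp only [id, one_mul] at h2
    exact (h2.add h1).hasDerivWithinAt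
  · have e : (s - 1) * (a : ℂ) ^ (-s) + (1 - s) * (x : ℂ) ^ (1 - s - 1) =
        -((s - 1) * ((x : ℂ) ^ (-s) - (a : ℂ) ^ (-s))) := by
      rw [show 1 - s - 1 = -s by ring]; ring
    rw [e, norm_neg, norm_mul, mul_assoc]
    refine mul_le_mul_of_nonneg_left ?_ (norm_nonneg _)
    refine (norm_cpow_neg_sub_cpow_neg_le hs ha hx.1).trans ?_
    have : x - a ≤ 1 := by linarith [hx.2]
    nlinarith

theorem hasSum_zetaTerm {s : ℂ} (hs : 1 < s.re) :
    HasSum (fun n : ℕ => zetaTerm (n + 1) s) ((s - 1) * riemannZeta s - 1) := by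
  have h1 : HasSum (fun n : ℕ => (s - 1) * ((n : ℂ) + 1) ^ (-s)) ((s - 1) * riemannZeta s) := by
    refine HasSum.mul_left _ ?_
    rw [zeta_eq_tsum_one_div_nat_add_one_cpow hs]
    have hsum := (summable_nat_add_iff 1).mpr (Complex.summable_one_div_nat_cpow.mpr hs)
    have := hsum.hasSum
    simp only [Nat.cast_add, Nat.cast_one] at this
    simpa [Complex.cpow_neg] using this
  have hlim : Tendsto (fun n : ℕ => ((n : ℂ) + 1) ^ (1 - s)) atTop (𝓝 0) := by
    rw [tendsto_zero_iff_norm_tendsto_zero]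
    have h := (tendsto_rpow_neg_atTop (show 0 < s.re - 1 by linarith)).comp
      (tendsto_atTop_add_const_right _ (1 : ℝ) tendsto_natCast_atTop_atTop)
    refine h.congr fun n => ?_
    have : ((n : ℂ) + 1) = ((n + 1 : ℝ) : ℂ) := by push_cast; ring
    rw [this, Complex.norm_cpow_eq_rpow_re_of_pos (by positivity)]
    simp
  have hsummable : Summable fun n : ℕ => zetaTerm (n + 1) s := by
    refine Summable.of_norm_bounded (g := fun n : ℕ => ‖s - 1‖ * ‖s‖ * ((n : ℝ) + 1) ^ (-s.re - 1))
      (Summable.mul_left _ ?_) fun n => norm_zetaTerm_le (by linarith) (by positivity)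
    have := (summable_nat_add_iff 1).mpr (Real.summable_nat_rpow.mpr
      (show -s.re - 1 < -1 by linarith))
    simpa using this
  have hpart := h1.tendsto_sum_nat.add (hlim.sub_const 1)
  rw [zero_sub, ← sub_eq_add_neg] at hpart
  refine (hsummable.hasSum_iff_tendsto_nat).mpr (hpart.congr fun N => ?_)
  have htel := Finset.sum_range_sub (fun n : ℕ => ((n : ℂ) + 1) ^ (1 - s)) N
  simp only [Nat.cast_zero, zero_add, Complex.one_cpow] at htel
  rw [← htel, ← Finset.sum_add_distrib]
  refine Finset.sum_congr rfl fun n _ => ?_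
  simp only [zetaTerm]
  push_cast
  ring

theorem summable_nat_add_one_rpow_neg_three_halves :
    Summable fun n : ℕ => ((n : ℝ) + 1) ^ (-(3 / 2) : ℝ) := by
  have := (summable_nat_add_iff 1).mpr (Real.summable_nat_rpow.mpr
      (show (-(3 / 2) : ℝ) < -1 by norm_num))
  simpa using this

theorem norm_zetaTerm_nat_le {s : ℂ} (hs : 1 / 2 < s.re) (n : ℕ) :
    ‖zetaTerm (n + 1) s‖ ≤ ‖s - 1‖ * ‖s‖ * ((n : ℝ) + 1) ^ (-(3 / 2) : ℝ) := by
  refine (norm_zetaTerm_le (by linarith) (by positivity)).trans ?_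
  refine mul_le_mul_of_nonneg_left ?_ (by positivity)
  exact Real.rpow_le_rpow_of_exponent_le (by linarith [(Nat.cast_nonneg n : (0 : ℝ) ≤ n)])
    (by linarith)

theorem riemannZeta₁_eq_one_add_tsum {s : ℂ} (hs : 1 / 2 < s.re) :
    riemannZeta₁ s = 1 + ∑' n : ℕ, zetaTerm (n + 1) s := by
  set U : Set ℂ := {s | 1 / 2 < s.re} with hU
  have hUo : IsOpen U := isOpen_lt continuous_const continuous_re
  have hUc : Convex ℝ U := convex_halfSpace_re_gt _
  have hd : DifferentiableOn ℂ (fun s => 1 + ∑' n : ℕ, zetaTerm (n + 1) s) U := by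
    intro z hz
    set R := ‖z‖ + 1
    have hV : IsOpen (U ∩ Metric.ball 0 R) := hUo.inter Metric.isOpen_ball
    have h := differentiableOn_tsum_of_summable_norm
      (F := fun (n : ℕ) (s : ℂ) => zetaTerm (n + 1) s)
      (u := fun n : ℕ => (R + 1) * R * ((n : ℝ) + 1) ^ (-(3 / 2) : ℝ))
      (summable_nat_add_one_rpow_neg_three_halves.mul_left _)
      (fun n => ?_) hV (fun n w hw => ?_)
    · have hzV : z ∈ U ∩ Metric.ball 0 R := ⟨hz, by simp [R]⟩
      exact ((h.differentiableAt (hV.mem_nhds hzV)).const_add 1).differentiableWithinAt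
    · have hn : ((n + 1 : ℝ) : ℂ) ≠ 0 := by exact_mod_cast n.succ_ne_zero
      have hn2 : (((n : ℝ) + 1 + 1 : ℝ) : ℂ) ≠ 0 := by exact_mod_cast (n + 1).succ_ne_zero
      unfold zetaTerm
      intro w _
      refine DifferentiableAt.differentiableWithinAt ?_
      have hw1 : DifferentiableAt ℂ (fun s : ℂ => -s) w := by fun_prop
      have hw2 : DifferentiableAt ℂ (fun s : ℂ => 1 - s) w := by fun_prop
      exact (((differentiableAt_id.sub_const 1).mul (hw1.const_cpow (Or.inl hn))).add
        (hw2.const_cpow (Or.inl hn2))).sub (hw2.const_cpow (Or.inl hn))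
    · have hw2 : ‖w‖ < R := by simpa using hw.2
      refine (norm_zetaTerm_nat_le hw.1 n).trans ?_
      have : ‖w - 1‖ ≤ R + 1 := (norm_sub_le _ _).trans (by rw [norm_one]; linarith)
      gcongr
  have h2 : (2 : ℂ) ∈ U := by simp [hU]; norm_num
  refine (differentiable_riemannZeta₁.differentiableOn.analyticOnNhd hUo).eqOn_of_preconnected_of_eventuallyEq
    (hd.analyticOnNhd hUo) hUc.isPreconnected h2 ?_ hs
  have hev : ∀ᶠ z : ℂ in 𝓝 2, 1 < z.re :=
    (isOpen_lt continuous_const continuous_re).mem_nhds (by simp)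
  filter_upwards [hev] with z hz
  have hz1 : z ≠ 1 := by rintro rfl; simp at hz
  rw [(hasSum_zetaTerm hz).tsum_eq, riemannZeta_eq_inv_sub_mul hz1]
  have := sub_ne_zero.mpr hz1
  field_simp
  ring

/-- `(s - 1) ζ(s)` grows at most quadratically in the half-plane `1 / 2 < re s`. -/
theorem exists_norm_riemannZeta₁_le :
    ∃ C : ℝ, 0 < C ∧ ∀ s : ℂ, 1 / 2 < s.re → ‖riemannZeta₁ s‖ ≤ C * ‖s‖ ^ 2 := by
  set S := ∑' n : ℕ, ((n : ℝ) + 1) ^ (-(3 / 2) : ℝ) with hS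
  have hS0 : 0 ≤ S := tsum_nonneg fun n => by positivity
  refine ⟨4 + 3 * S, by positivity, fun s hs => ?_⟩
  have hs' : 1 / 2 < ‖s‖ := hs.trans_le (re_le_norm s)
  have h1 : ‖∑' n : ℕ, zetaTerm (n + 1) s‖ ≤ ‖s - 1‖ * ‖s‖ * S :=
    tsum_of_norm_bounded (summable_nat_add_one_rpow_neg_three_halves.hasSum.mul_left _)
      fun n => norm_zetaTerm_nat_le hs n
  have h2 : ‖s - 1‖ ≤ 3 * ‖s‖ := (norm_sub_le _ _).trans (by rw [norm_one]; linarith)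
  rw [riemannZeta₁_eq_one_add_tsum hs]
  calc _ ≤ ‖(1 : ℂ)‖ + ‖s - 1‖ * ‖s‖ * S := (norm_add_le _ _).trans (by gcongr)
    _ ≤ 1 + 3 * ‖s‖ * ‖s‖ * S := by rw [norm_one]; gcongr
    _ ≤ _ := by nlinarith

theorem one_le_norm_riemannZeta_ofReal {x : ℝ} (hx : 1 < x) : 1 ≤ ‖riemannZeta x‖ := by
  have hsum : Summable fun n : ℕ => 1 / ((n : ℝ) + 1) ^ x := by
    have := (summable_nat_add_iff 1).mpr (Real.summable_one_div_nat_rpow.mpr hx)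
    simpa using this
  have h : riemannZeta x = ((∑' n : ℕ, 1 / ((n : ℝ) + 1) ^ x : ℝ) : ℂ) := by
    rw [zeta_eq_tsum_one_div_nat_add_one_cpow (by simpa using hx), Complex.ofReal_tsum]
    refine tsum_congr fun n => ?_
    have : ((n : ℂ) + 1) = ((n + 1 : ℝ) : ℂ) := by push_cast; ring
    rw [this, ← Complex.ofReal_cpow (by positivity)]
    push_cast
    ring
  have h0 := hsum.le_tsum 0 fun n _ => by positivity
  simp only [Nat.cast_zero, zero_add, Real.one_rpow, div_one] at h0
  rw [h, Complex.norm_real]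
  exact h0.trans (Real.le_norm_self _)

end

/-- The main term `(w - 1/2) log w - w` of Stirling's series for `log Γ(w)`. -/
noncomputable def stirlingMain (w : ℂ) : ℂ := (w - 1 / 2) * Complex.log w - w

/-- The defect of `stirlingMain` in the functional equation of `log Γ`. -/
noncomputable def stirlingDefect (w : ℂ) : ℂ := (w + 1 / 2) * Complex.log (1 + w⁻¹) - 1

theorem log_add_one_of_re_pos {w : ℂ} (hw : 0 < w.re) :
    Complex.log (w + 1) = Complex.log w + Complex.log (1 + w⁻¹) := by
  have hw0 : w ≠ 0 := by rintro rfl; simp at hw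
  have hinv : 0 < (1 + w⁻¹).re := by
    have : 0 < w⁻¹.re := by
      rw [Complex.inv_re]; exact div_pos hw (Complex.normSq_pos.2 hw0)
    simp only [Complex.add_re, Complex.one_re]; linarith
  have h1 := abs_lt.1 (Complex.abs_arg_lt_pi_div_two_iff.2 (Or.inl hw))
  have h2 := abs_lt.1 (Complex.abs_arg_lt_pi_div_two_iff.2 (Or.inl hinv))
  rw [← Complex.log_mul hw0 (by intro h; rw [h] at hinv; simp at hinv)
    ⟨by linarith, by linarith⟩]
  congr 1
  field_simp

theorem stirlingMain_add_one {w : ℂ} (hw : 0 < w.re) :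
    stirlingMain (w + 1) = stirlingMain w + Complex.log w + stirlingDefect w := by
  rw [stirlingMain, stirlingMain, stirlingDefect, log_add_one_of_re_pos hw]
  ring

theorem norm_stirlingDefect_le_of_norm_inv_le {w : ℂ} (hw0 : w ≠ 0) (hw : ‖w⁻¹‖ ≤ 4 / 5) :
    ‖stirlingDefect w‖ ≤ 3 * ‖w⁻¹‖ ^ 2 := by
  have hlog := Complex.norm_log_sub_logTaylor_le 2 (z := w⁻¹) (by linarith)
  set r := Complex.log (1 + w⁻¹) - Complex.logTaylor (2 + 1) w⁻¹ with hr
  have hd : stirlingDefect w = -(w⁻¹ ^ 2) / 4 + (w + 1 / 2) * r := by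
    rw [stirlingDefect, hr, Complex.logTaylor]
    simp only [Finset.sum_range_succ, Finset.sum_range_zero]
    push_cast
    field_simp
    ring
  have hx : 0 < ‖w⁻¹‖ := by simpa using hw0
  have hr' : ‖r‖ ≤ ‖w⁻¹‖ ^ 3 * (5 / 3) := by
    refine hlog.trans ?_
    have : (1 - ‖w⁻¹‖)⁻¹ ≤ 5 := by
      rw [inv_le_comm₀ (by linarith) (by norm_num)]; linarith
    calc _ ≤ ‖w⁻¹‖ ^ (2 + 1) * 5 / 3 := by
          rw [show ((2 : ℕ) : ℝ) + 1 = 3 by norm_num]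
          gcongr
      _ = _ := by ring
  have hwn : ‖w + 1 / 2‖ ≤ ‖w⁻¹‖⁻¹ + 1 / 2 := by
    refine (norm_add_le _ _).trans ?_
    simp
  rw [hd]
  calc _ ≤ ‖-(w⁻¹ ^ 2) / 4‖ + ‖(w + 1 / 2) * r‖ := norm_add_le _ _
    _ ≤ ‖w⁻¹‖ ^ 2 / 4 + (‖w⁻¹‖⁻¹ + 1 / 2) * (‖w⁻¹‖ ^ 3 * (5 / 3)) := by
        rw [norm_mul]
        refine add_le_add (by simp) (by gcongr)
    _ = ‖w⁻¹‖ ^ 2 * (1 / 4 + 5 / 3 + ‖w⁻¹‖ * (5 / 6)) := by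
        have hxn := hx.ne'
        generalize ‖w⁻¹‖ = x at hxn ⊢
        field_simp
        ring
    _ ≤ ‖w⁻¹‖ ^ 2 * 3 := by gcongr; linarith
    _ = _ := by ring

theorem norm_stirlingDefect_le {w : ℂ} (hw : 1 / 4 < w.re) : ‖stirlingDefect w‖ ≤ 12 := by
  have hw0 : w ≠ 0 := by rintro rfl; norm_num at hw
  by_cases h : ‖w⁻¹‖ ≤ 4 / 5
  · refine (norm_stirlingDefect_le_of_norm_inv_le hw0 h).trans ?_
    nlinarith [norm_nonneg w⁻¹]
  have hwn : ‖w‖ ≤ 5 / 4 := by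
    rw [norm_inv, not_le] at h
    have := (lt_inv_comm₀ (by norm_num) (norm_pos_iff.2 hw0)).1 h
    norm_num at this; linarith
  have hre : 0 < w⁻¹.re := by
    rw [Complex.inv_re]; exact div_pos (by linarith) (Complex.normSq_pos.2 hw0)
  have hinv : ‖w⁻¹‖ ≤ 4 := by
    rw [norm_inv, inv_le_comm₀ (norm_pos_iff.2 hw0) (by norm_num)]
    have := Complex.re_le_norm w; norm_num; linarith
  have h1 : 1 ≤ ‖1 + w⁻¹‖ := by
    refine le_trans ?_ (Complex.re_le_norm _)
    simp only [Complex.add_re, Complex.one_re]; linarith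
  have h5 : ‖1 + w⁻¹‖ ≤ 5 := by
    refine (norm_add_le _ _).trans ?_
    rw [norm_one]; linarith
  have hlog : ‖Complex.log (1 + w⁻¹)‖ ≤ 6 := by
    refine (Complex.norm_le_abs_re_add_abs_im _).trans ?_
    rw [Complex.log_re, Complex.log_im, abs_of_nonneg (Real.log_nonneg h1)]
    have ha := (Complex.abs_arg_le_pi_div_two_iff (z := 1 + w⁻¹)).2
      (by simp only [Complex.add_re, Complex.one_re]; linarith)
    have hl := Real.log_le_sub_one_of_pos (x := ‖1 + w⁻¹‖) (by linarith)
    have := Real.pi_lt_four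
    linarith
  have hw2 : ‖w + 1 / 2‖ ≤ 7 / 4 := by
    refine (norm_add_le _ _).trans ?_
    norm_num
    linarith
  calc ‖stirlingDefect w‖ ≤ ‖(w + 1 / 2) * Complex.log (1 + w⁻¹)‖ + ‖(1 : ℂ)‖ := norm_sub_le _ _
    _ ≤ 7 / 4 * 6 + 1 := by rw [norm_mul, norm_one]; gcongr
    _ ≤ 12 := by norm_num

theorem norm_stirlingDefect_add_nat_le {w : ℂ} (hw : 1 / 4 < w.re) (k : ℕ) :
    ‖stirlingDefect (w + k)‖ ≤ 12 * (1 / ((k : ℝ) + 1) ^ 2) := by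
  rcases Nat.eq_zero_or_pos k with rfl | hk
  · simpa using norm_stirlingDefect_le hw
  have hk1 : (1 : ℝ) ≤ k := by exact_mod_cast hk
  have hn : (k : ℝ) + 1 / 4 ≤ ‖w + k‖ := by
    refine le_trans ?_ (Complex.re_le_norm _)
    simp only [Complex.add_re, Complex.natCast_re]; linarith
  have h0 : w + k ≠ 0 := norm_pos_iff.1 (by linarith)
  have hinv : ‖(w + k)⁻¹‖ ≤ 8 / 5 / ((k : ℝ) + 1) := by
    rw [norm_inv, inv_le_comm₀ (by linarith) (by positivity), inv_div]
    refine le_trans ?_ hn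
    rw [div_le_iff₀ (by norm_num)]; linarith
  have h45 : ‖(w + k)⁻¹‖ ≤ 4 / 5 := by
    refine hinv.trans ?_
    rw [div_le_iff₀ (by positivity)]; linarith
  calc _ ≤ 3 * ‖(w + k)⁻¹‖ ^ 2 := norm_stirlingDefect_le_of_norm_inv_le h0 h45
    _ ≤ 3 * (8 / 5 / ((k : ℝ) + 1)) ^ 2 := by gcongr
    _ = 192 / 25 * (1 / ((k : ℝ) + 1) ^ 2) := by rw [div_pow]; ring
    _ ≤ _ := by gcongr; norm_num

theorem exists_norm_sum_stirlingDefect_le :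
    ∃ M : ℝ, ∀ w : ℂ, 1 / 4 < w.re → ∀ n : ℕ,
      ‖∑ k ∈ Finset.range n, stirlingDefect (w + k)‖ ≤ M := by
  have hs : Summable fun k : ℕ => 12 * (1 / ((k : ℝ) + 1) ^ 2) := by
    have := (summable_nat_add_iff 1).2 (Real.summable_one_div_nat_pow.2 one_lt_two)
    simpa using this.mul_left 12
  refine ⟨∑' k : ℕ, 12 * (1 / ((k : ℝ) + 1) ^ 2), fun w hw n => ?_⟩
  refine (norm_sum_le _ _).trans ?_
  refine (Finset.sum_le_sum fun k _ => norm_stirlingDefect_add_nat_le hw k).trans ?_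
  exact hs.sum_le_tsum _ fun k _ => by positivity

theorem prod_add_nat_mul_exp_stirlingMain {w : ℂ} (hw : 0 < w.re) (n : ℕ) :
    (∏ k ∈ Finset.range n, (w + k)) * Complex.exp (stirlingMain w)
      * Complex.exp (∑ k ∈ Finset.range n, stirlingDefect (w + k))
      = Complex.exp (stirlingMain (w + n)) := by
  induction n with
  | zero => simp
  | succ n ih =>
    have hre : 0 < (w + n).re := by
      simp only [Complex.add_re, Complex.natCast_re]; positivity
    have h0 : w + n ≠ 0 := by intro h; rw [h] at hre; simp at hre
    rw [Finset.prod_range_succ, Finset.sum_range_succ, Complex.exp_add, Nat.cast_add,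
      Nat.cast_one, ← add_assoc, stirlingMain_add_one hre, Complex.exp_add, Complex.exp_add,
      Complex.exp_log h0, ← ih]
    ring

theorem tendsto_cpow_mul_factorial_mul_exp_neg_stirlingMain {w : ℂ} (hw : 0 < w.re) :
    Filter.Tendsto (fun n : ℕ => (n : ℂ) ^ w * n.factorial
      * Complex.exp (-stirlingMain (w + (n + 1 : ℕ)))) Filter.atTop
      (nhds ((√2 * √Real.pi : ℝ) : ℂ)) := by
  have hlog : Filter.Tendsto (fun n : ℕ => (n : ℂ) * Complex.log (1 + (w + 1) / n))
      Filter.atTop (nhds (w + 1)) := by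
    apply Complex.tendsto_nat_mul_log_one_add_of_tendsto
    refine tendsto_const_nhds.congr' ?_
    filter_upwards [Filter.eventually_ne_atTop 0] with n hn
    have : (n : ℂ) ≠ 0 := by exact_mod_cast hn
    field_simp
  have hlog' : Filter.Tendsto (fun n : ℕ => Complex.log (1 + (w + 1) / n))
      Filter.atTop (nhds 0) := by
    have := hlog.mul (tendsto_inv_atTop_nhds_zero_nat (𝕜 := ℂ))
    rw [mul_zero] at this
    refine this.congr' ?_
    filter_upwards [Filter.eventually_ne_atTop 0] with n hn
    have : (n : ℂ) ≠ 0 := by exact_mod_cast hn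
    field_simp
  have hrest : Filter.Tendsto (fun n : ℕ => (w + 1)
      - ((n : ℂ) * Complex.log (1 + (w + 1) / n)
        + (w + 1 / 2) * Complex.log (1 + (w + 1) / n))) Filter.atTop (nhds 0) := by
    have := (tendsto_const_nhds (x := w + 1)).sub (hlog.add (hlog'.const_mul (w + 1 / 2)))
    simpa using this
  have hst := (Complex.continuous_ofReal.tendsto _).comp
    (Stirling.tendsto_stirlingSeq_sqrt_pi.const_mul √2)
  have := hst.mul hrest.cexp
  rw [Complex.exp_zero, mul_one] at this
  refine this.congr' ?_
  filter_upwards [Filter.eventually_ne_atTop 0] with n hn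
  have hn0 : (n : ℂ) ≠ 0 := by exact_mod_cast hn
  have hnpos : (0 : ℝ) < n := by exact_mod_cast Nat.pos_of_ne_zero hn
  have h1 : (1 + (w + 1) / n : ℂ) ≠ 0 := by
    intro h
    have hre : 0 < (1 + (w + 1) / n : ℂ).re := by
      rw [Complex.add_re, Complex.div_natCast_re]
      simp only [Complex.one_re, Complex.add_re]
      positivity
    rw [h] at hre; simp at hre
  have hl : Complex.log (w + (n + 1 : ℕ)) = Complex.log n + Complex.log (1 + (w + 1) / n) := by
    have : w + (n + 1 : ℕ) = ((n : ℝ) : ℂ) * (1 + (w + 1) / n) := by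
      push_cast; field_simp; ring
    rw [this, Complex.log_ofReal_mul hnpos h1, Complex.natCast_log]
  have hstir : ((√2 * Stirling.stirlingSeq n : ℝ) : ℂ)
      = n.factorial * Complex.exp (n - (n + 1 / 2) * Complex.log n) := by
    have : √2 * Stirling.stirlingSeq n
        = n.factorial * Real.exp (n - (n + 1 / 2) * Real.log n) := by
      have e : Real.exp (n - (n + 1 / 2) * Real.log n) = (√n * (n / Real.exp 1) ^ n)⁻¹ := by
        rw [div_pow, ← Real.exp_nat_mul, mul_one, Real.exp_sub, add_mul, Real.exp_add,
          Real.exp_nat_mul, Real.exp_log hnpos, mul_comm (1 / 2 : ℝ), ← Real.rpow_def_of_pos hnpos,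
          ← Real.sqrt_eq_rpow]
        field_simp
      rw [e, Stirling.stirlingSeq, Real.sqrt_mul (by norm_num)]
      have : √2 ≠ 0 := by positivity
      field_simp
    rw [this]
    push_cast
    rfl
  rw [Function.comp_apply, hstir, Complex.cpow_def_of_ne_zero hn0, stirlingMain, hl,
    mul_assoc, ← Complex.exp_add, mul_comm (Complex.exp _) (n.factorial : ℂ), mul_assoc,
    ← Complex.exp_add]
  congr 2
  push_cast
  ring

theorem exists_norm_Gamma_bounds :
    ∃ M : ℝ, ∀ w : ℂ, 1 / 4 < w.re →
      Real.exp (-M) * ‖Complex.exp (stirlingMain w)‖ ≤ ‖Complex.Gamma w‖ ∧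
      ‖Complex.Gamma w‖ ≤ Real.exp M * ‖Complex.exp (stirlingMain w)‖ := by
  obtain ⟨M, hM⟩ := exists_norm_sum_stirlingDefect_le
  set c : ℝ := √2 * √Real.pi with hc
  have hc1 : 1 ≤ c := by
    rw [hc, ← Real.sqrt_mul (by norm_num), Real.one_le_sqrt]
    linarith [Real.pi_gt_three]
  have hcpos : 0 < c := by linarith
  refine ⟨M + Real.log c, fun w hw => ?_⟩
  have hw0 : 0 < w.re := by linarith
  have hlim := (tendsto_cpow_mul_factorial_mul_exp_neg_stirlingMain hw0).norm
  have hG := (Complex.GammaSeq_tendsto_Gamma w).norm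
  have hnc : ‖((c : ℝ) : ℂ)‖ = c := by
    rw [Complex.norm_real, Real.norm_of_nonneg hcpos.le]
  rw [hnc] at hlim
  have key : ∀ n : ℕ, ‖Complex.GammaSeq w n‖ =
      ‖(n : ℂ) ^ w * n.factorial * Complex.exp (-stirlingMain (w + (n + 1 : ℕ)))‖
        * ‖Complex.exp (stirlingMain w)‖
        * Real.exp (∑ k ∈ Finset.range (n + 1), stirlingDefect (w + k)).re := by
    intro n
    have h := prod_add_nat_mul_exp_stirlingMain hw0 (n + 1)
    rw [← Complex.norm_exp, ← norm_mul, ← norm_mul, Complex.GammaSeq, Complex.exp_neg, ← h]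
    congr 1
    have hp : ∏ k ∈ Finset.range (n + 1), (w + k) ≠ 0 := by
      intro h0
      rw [h0, zero_mul, zero_mul] at h
      exact Complex.exp_ne_zero _ h.symm
    have := Complex.exp_ne_zero (stirlingMain w)
    have := Complex.exp_ne_zero (∑ k ∈ Finset.range (n + 1), stirlingDefect (w + k))
    field_simp
  have hre : ∀ n : ℕ, |(∑ k ∈ Finset.range (n + 1), stirlingDefect (w + k)).re| ≤ M :=
    fun n => (Complex.abs_re_le_norm _).trans (hM w hw _)
  constructor
  · have hl : Real.exp (-(M + Real.log c)) ≤ c * Real.exp (-M) := by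
      rw [neg_add, Real.exp_add, mul_comm]
      gcongr
      rw [Real.exp_neg, Real.exp_log hcpos]
      exact (inv_le_one_of_one_le₀ hc1).trans hc1
    refine (mul_le_mul_of_nonneg_right hl (norm_nonneg _)).trans ?_
    have h1 := (hlim.mul_const ‖Complex.exp (stirlingMain w)‖).mul_const (Real.exp (-M))
    rw [mul_right_comm]
    refine le_of_tendsto_of_tendsto' h1 hG fun n => ?_
    rw [key]
    gcongr
    exact (abs_le.1 (hre n)).1
  · have h1 := (hlim.mul_const ‖Complex.exp (stirlingMain w)‖).mul_const (Real.exp M)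
    rw [Real.exp_add, Real.exp_log hcpos, mul_comm (Real.exp M), mul_right_comm]
    refine le_of_tendsto_of_tendsto' hG h1 fun n => ?_
    rw [key]
    gcongr
    exact (abs_le.1 (hre n)).2

open Filter Topology Metric in
theorem iteratedDeriv_div_factorial_eq_of_hasSum {f : ℂ → ℂ} {a : ℕ → ℂ}
    (h : ∀ z ∈ ball (0 : ℂ) 1, HasSum (fun n => a n * z ^ n) (f z)) (n : ℕ) :
    iteratedDeriv n f 0 / n.factorial = a n := by
  have hp : HasFPowerSeriesAt f (FormalMultilinearSeries.ofScalars ℂ a) 0 := by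
    rw [hasFPowerSeriesAt_iff]
    filter_upwards [ball_mem_nhds (0 : ℂ) one_pos] with z hz
    simpa [FormalMultilinearSeries.coeff_ofScalars, mul_comm] using h z hz
  have := congrArg (fun p => p.coeff n)
    (hp.analyticAt.hasFPowerSeriesAt.eq_formalMultilinearSeries hp)
  simpa [FormalMultilinearSeries.coeff_ofScalars] using this

theorem hasSum_harmonic_mul_pow {z : ℂ} (hz : ‖z‖ < 1) :
    HasSum (fun n : ℕ => ((harmonic n : ℚ) : ℂ) * z ^ n) (-Complex.log (1 - z) * (1 - z)⁻¹) := by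
  have hl := Complex.hasSum_taylorSeries_neg_log hz
  have hg := hasSum_geometric_of_norm_lt_one hz
  have hgn := summable_norm_geometric_of_norm_lt_one hz
  have hln : Summable fun n : ℕ => ‖z ^ n / n‖ := by
    refine Summable.of_nonneg_of_le (fun _ => norm_nonneg _) (fun n => ?_) hgn
    rw [norm_div, Complex.norm_natCast]
    rcases Nat.eq_zero_or_pos n with rfl | hn
    · simp
    · exact div_le_self (norm_nonneg _) (by exact_mod_cast hn)
  have hsum := (summable_norm_sum_mul_range_of_summable_norm hln hgn).of_norm.hasSum
  rw [← tsum_mul_tsum_eq_tsum_sum_range_of_summable_norm hln hgn, hl.tsum_eq, hg.tsum_eq] at hsum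
  convert! hsum using 2 with n
  have : ∀ k ∈ Finset.range (n + 1), z ^ k / (k : ℂ) * z ^ (n - k) = (k : ℂ)⁻¹ * z ^ n := by
    intro k hk
    have hkn : k + (n - k) = n := by have := Finset.mem_range.1 hk; omega
    conv_rhs => rw [← hkn, pow_add]
    ring
  rw [Finset.sum_congr rfl this, ← Finset.sum_mul, Finset.sum_range_succ', harmonic]
  push_cast
  simp

/-- The explicit main term of `log 2ξ(1/(1-z))`, up to a function whose Taylor coefficients
tend to zero. -/
noncomputable def mainTerm (c : ℝ) (z : ℂ) : ℂ :=
  stirlingMain ((1 - z)⁻¹ / 2) - (1 - z)⁻¹ / 2 * Real.log Real.pi - 3 * Complex.log (1 - z) - c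

theorem re_one_sub_pos {z : ℂ} (hz : ‖z‖ ≤ 1) (hz1 : z ≠ 1) : 0 < (1 - z).re := by
  by_contra! h
  have h1 : 1 ≤ z.re := by simpa using h
  have h2 := Complex.re_le_norm z
  have h3 : z.re = 1 := by linarith
  have h4 : z.im = 0 := by
    have := Complex.sq_norm z
    rw [Complex.normSq_apply, h3] at this
    nlinarith
  exact hz1 (Complex.ext (by simpa using h3) (by simpa using h4))

theorem ne_one_of_mem_ball {z : ℂ} (hz : z ∈ Metric.ball (0 : ℂ) 1) : z ≠ 1 := by
  rintro rfl; simp at hz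

theorem log_half_inv_one_sub {z : ℂ} (hz : ‖z‖ ≤ 1) (hz1 : z ≠ 1) :
    Complex.log ((1 - z)⁻¹ / 2) = -Complex.log (1 - z) - Real.log 2 := by
  have hre := re_one_sub_pos hz hz1
  have h0 : 1 - z ≠ 0 := sub_ne_zero.2 hz1.symm
  have harg : (1 - z).arg ≠ Real.pi :=
    Complex.slitPlane_arg_ne_pi (Complex.mem_slitPlane_iff.2 (Or.inl hre))
  have : (1 - z)⁻¹ / 2 = ((2⁻¹ : ℝ) : ℂ) * (1 - z)⁻¹ := by push_cast; ring
  rw [this, Complex.log_ofReal_mul (by norm_num) (inv_ne_zero h0), Complex.log_inv _ harg,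
    Real.log_inv]
  push_cast
  ring

theorem iteratedDeriv_mainTerm_div_factorial (c : ℝ) {n : ℕ} (hn : n ≠ 0) :
    iteratedDeriv n (mainTerm c) 0 / n.factorial =
      (((harmonic n : ℝ) / 2 + 5 / 2 / n - (1 + Real.log (2 * Real.pi)) / 2 : ℝ) : ℂ) := by
  have h : ∀ z ∈ Metric.ball (0 : ℂ) 1, HasSum (fun n : ℕ => ((harmonic n : ℚ) / 2 + 5 / 2 / n
      - (1 + Real.log (2 * Real.pi)) / 2
      + if n = 0 then (Real.log 2 / 2 - c : ℂ) else 0) * z ^ n) (mainTerm c z) := by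
    intro z hz
    have hz1 : ‖z‖ < 1 := by simpa using hz
    have h1 := (hasSum_harmonic_mul_pow hz1).mul_left (1 / 2)
    have h2 := (Complex.hasSum_taylorSeries_neg_log hz1).mul_left (5 / 2)
    have h3 := (hasSum_geometric_of_norm_lt_one hz1).mul_left
      ((1 + Real.log (2 * Real.pi)) / 2 : ℂ)
    have h4 := hasSum_ite_eq (0 : ℕ) (Real.log 2 / 2 - c : ℂ)
    convert! ((h1.add h2).sub h3).add h4 using 1
    · funext n
      split_ifs with h0
      · subst h0; simp
      · ring
    · rw [mainTerm, stirlingMain, log_half_inv_one_sub hz1.le (ne_one_of_mem_ball hz),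
        Real.log_mul (by norm_num) Real.pi_ne_zero]
      push_cast
      ring
  rw [iteratedDeriv_div_factorial_eq_of_hasSum h n, if_neg hn]
  push_cast
  ring

theorem exists_differentiableOn_exp_eq {g : ℂ → ℂ}
    (hg : DifferentiableOn ℂ g (Metric.ball 0 1)) (h0 : ∀ z ∈ Metric.ball (0 : ℂ) 1, g z ≠ 0)
    (h1 : g 0 = 1) :
    ∃ L : ℂ → ℂ, DifferentiableOn ℂ L (Metric.ball 0 1) ∧ L 0 = 0 ∧
      ∀ z ∈ Metric.ball (0 : ℂ) 1, Complex.exp (L z) = g z := by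
  have hb := Metric.isOpen_ball (x := (0 : ℂ)) (ε := 1)
  have hld : DifferentiableOn ℂ (fun z => deriv g z / g z) (Metric.ball 0 1) :=
    (hg.deriv hb).div hg h0
  obtain ⟨L, hL0, hL⟩ := hld.isExactOn_ball.with_val_at 0 0
  refine ⟨L, fun z hz => (hL z hz).differentiableAt.differentiableWithinAt, hL0, ?_⟩
  have hd : ∀ z ∈ Metric.ball (0 : ℂ) 1,
      HasDerivAt (fun z => g z * Complex.exp (-L z)) 0 z := by
    intro z hz
    have hgz := (hg.differentiableAt (hb.mem_nhds hz)).hasDerivAt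
    convert! hgz.mul (hL z hz).neg.cexp using 1
    have := h0 z hz
    field_simp
    ring
  intro z hz
  have hconst : g z * Complex.exp (-L z) = g 0 * Complex.exp (-L 0) :=
    hb.is_const_of_deriv_eq_zero (convex_ball (0 : ℂ) 1).isPreconnected
      (fun w hw => (hd w hw).differentiableAt.differentiableWithinAt)
      (fun w hw => (hd w hw).deriv) hz (Metric.mem_ball_self one_pos)
  rw [hL0, h1, neg_zero, Complex.exp_zero, mul_one, Complex.exp_neg] at hconst
  have := Complex.exp_ne_zero (L z)
  field_simp at hconst
  exact hconst.symm

theorem xi2_eq_of_re_pos {s : ℂ} (hs : 0 < s.re) :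
    xi2 s = s * riemannZeta₁ s * (Real.pi : ℂ) ^ (-s / 2) * Complex.Gamma (s / 2) := by
  have hs0 : s ≠ 0 := by rintro rfl; simp at hs
  have hpi : (Real.pi : ℂ) ≠ 0 := by exact_mod_cast Real.pi_ne_zero
  by_cases h1 : s = 1
  · subst h1
    have : riemannZeta₁ 1 = 1 := by simp [riemannZeta₁]
    rw [xi2, if_pos (Or.inr rfl), this, Complex.Gamma_one_half_eq, one_mul, one_mul,
      ← Complex.cpow_add _ _ hpi]
    norm_num
  · have : s - 1 ≠ 0 := sub_ne_zero.2 h1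
    rw [xi2, if_neg (by simp [hs0, h1]), riemannZeta_eq_inv_sub_mul h1]
    field_simp

theorem differentiableAt_xi2 {s : ℂ} (hs : 0 < s.re) : DifferentiableAt ℂ xi2 s := by
  have h : xi2 =ᶠ[nhds s] fun s =>
      s * riemannZeta₁ s * (Real.pi : ℂ) ^ (-s / 2) * Complex.Gamma (s / 2) := by
    filter_upwards [(isOpen_lt continuous_const Complex.continuous_re).mem_nhds hs] with w hw
    exact xi2_eq_of_re_pos hw
  refine DifferentiableAt.congr_of_eventuallyEq ?_ h
  have hpi : (Real.pi : ℂ) ≠ 0 := by exact_mod_cast Real.pi_ne_zero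
  have hG : DifferentiableAt ℂ (fun s : ℂ => Complex.Gamma (s / 2)) s := by
    have := Complex.differentiableAt_Gamma (s / 2) fun m hm => by
      have : 0 < (s / 2).re := by rw [Complex.div_ofNat_re]; linarith
      rw [hm, Complex.neg_re, Complex.natCast_re] at this
      have : (0 : ℝ) ≤ m := m.cast_nonneg
      linarith
    exact this.comp s (differentiableAt_id.div_const 2)
  have hp : DifferentiableAt ℂ (fun s : ℂ => (Real.pi : ℂ) ^ (-s / 2)) s :=
    (differentiableAt_id.neg.div_const 2).const_cpow (Or.inl hpi)
  exact ((differentiableAt_id.mul (differentiable_riemannZeta₁ s)).mul hp).mul hG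

theorem xi2_ne_zero_of_RH (hRH : RiemannHypothesis) {s : ℂ} (hs : 1 / 2 < s.re) : xi2 s ≠ 0 := by
  have hs0 : s ≠ 0 := by rintro rfl; norm_num at hs
  by_cases h1 : s = 1
  · simp [xi2, h1]
  have hpi : (Real.pi : ℂ) ≠ 0 := by exact_mod_cast Real.pi_ne_zero
  have hG : Complex.Gamma (s / 2) ≠ 0 :=
    Complex.Gamma_ne_zero_of_re_pos (by rw [Complex.div_ofNat_re]; linarith)
  have hz : riemannZeta s ≠ 0 := by
    intro hz
    have := hRH s hz ?_ h1
    · linarith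
    · rintro ⟨n, rfl⟩
      simp at hs
      have : (0 : ℝ) ≤ n := n.cast_nonneg
      linarith
  rw [xi2, if_neg (by simp [hs0, h1])]
  have := sub_ne_zero.2 h1
  have := (Complex.cpow_ne_zero_iff_of_exponent_ne_zero (x := (Real.pi : ℂ)) (y := -s / 2)
    (by simpa using hs0)).2 hpi
  positivity

theorem half_lt_re_inv_one_sub {z : ℂ} (hz : ‖z‖ < 1) : 1 / 2 < ((1 - z)⁻¹).re := by
  have hz1 : z ≠ 1 := by rintro rfl; simp at hz
  have hpos : 0 < Complex.normSq (1 - z) := Complex.normSq_pos.2 (sub_ne_zero.2 hz1.symm)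
  rw [Complex.inv_re, lt_div_iff₀ hpos, Complex.normSq_apply]
  have h : Complex.normSq z < 1 := by
    rw [← Complex.sq_norm]; nlinarith [norm_nonneg z]
  rw [Complex.normSq_apply] at h
  simp only [Complex.sub_re, Complex.one_re, Complex.sub_im, Complex.one_im]
  nlinarith

theorem re_inv_one_sub_pos {z : ℂ} (hz : ‖z‖ ≤ 1) (hz1 : z ≠ 1) : 0 < ((1 - z)⁻¹).re := by
  rw [Complex.inv_re]
  exact div_pos (re_one_sub_pos hz hz1) (Complex.normSq_pos.2 (sub_ne_zero.2 hz1.symm))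

theorem eventually_re_inv_one_sub_pos {z : ℂ} (hz : ‖z‖ ≤ 1) (hz1 : z ≠ 1) :
    ∀ᶠ w in nhds z, 0 < ((1 - w)⁻¹).re ∧ 0 < (1 - w).re := by
  have hc : ContinuousAt (fun w : ℂ => (1 - w)⁻¹) z :=
    (continuousAt_const.sub continuousAt_id).inv₀ (sub_ne_zero.2 hz1.symm)
  have hc1 : ContinuousAt (fun w : ℂ => ((1 - w)⁻¹).re) z :=
    Complex.continuous_re.continuousAt.comp hc
  have hc2 : ContinuousAt (fun w : ℂ => (1 - w).re) z := by fun_prop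
  exact (hc1.eventually_const_lt (re_inv_one_sub_pos hz hz1)).and
    (hc2.eventually_const_lt (re_one_sub_pos hz hz1))

theorem analyticAt_xi2_inv_one_sub {z : ℂ} (hz : ‖z‖ ≤ 1) (hz1 : z ≠ 1) :
    AnalyticAt ℂ (fun z => xi2 (1 - z)⁻¹) z := by
  rw [Complex.analyticAt_iff_eventually_differentiableAt]
  filter_upwards [eventually_re_inv_one_sub_pos hz hz1] with w hw
  have h0 : 1 - w ≠ 0 := by intro h; rw [h] at hw; simp at hw
  exact (differentiableAt_xi2 hw.1).comp w
    ((differentiableAt_const (1 : ℂ)).sub differentiableAt_id |>.inv h0)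

theorem analyticAt_mainTerm (c : ℝ) {z : ℂ} (hz : ‖z‖ ≤ 1) (hz1 : z ≠ 1) :
    AnalyticAt ℂ (mainTerm c) z := by
  rw [Complex.analyticAt_iff_eventually_differentiableAt]
  filter_upwards [eventually_re_inv_one_sub_pos hz hz1] with w hw
  have h0 : 1 - w ≠ 0 := by intro h; rw [h] at hw; simp at hw
  have hs : DifferentiableAt ℂ (fun w : ℂ => (1 - w)⁻¹ / 2) w :=
    ((differentiableAt_const (1 : ℂ)).sub differentiableAt_id |>.inv h0).div_const 2
  have hl : DifferentiableAt ℂ (fun w : ℂ => Complex.log ((1 - w)⁻¹ / 2)) w :=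
    hs.clog (Complex.mem_slitPlane_iff.2 (Or.inl (by rw [Complex.div_ofNat_re]; linarith [hw.1])))
  have hl' : DifferentiableAt ℂ (fun w : ℂ => Complex.log (1 - w)) w :=
    ((differentiableAt_const (1 : ℂ)).sub differentiableAt_id).clog
      (Complex.mem_slitPlane_iff.2 (Or.inl hw.2))
  exact (((((hs.sub_const _).mul hl).sub hs).sub (hs.mul_const _)).sub
    (hl'.const_mul 3)).sub_const _

/-- The modulus of `2ξ(1/(1-z))` relative to the main term. -/
theorem norm_xi2_mul_exp_neg_mainTerm (c : ℝ) {z : ℂ} (hz : ‖z‖ < 1) :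
    ‖xi2 (1 - z)⁻¹ * Complex.exp (-mainTerm c z)‖ =
      Real.exp c * (‖(1 - z)⁻¹‖ * ‖riemannZeta₁ (1 - z)⁻¹‖ * ‖1 - z‖ ^ 3) *
        (‖Complex.Gamma ((1 - z)⁻¹ / 2)‖ / ‖Complex.exp (stirlingMain ((1 - z)⁻¹ / 2))‖) := by
  have hz1 : z ≠ 1 := by rintro rfl; simp at hz
  have h0 : 1 - z ≠ 0 := sub_ne_zero.2 hz1.symm
  have hpi : (Real.pi : ℂ) ≠ 0 := by exact_mod_cast Real.pi_ne_zero
  have hE : Complex.exp (-mainTerm c z) = (Complex.exp (stirlingMain ((1 - z)⁻¹ / 2)))⁻¹ *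
      (Real.pi : ℂ) ^ ((1 - z)⁻¹ / 2) * (1 - z) ^ 3 * Complex.exp c := by
    rw [Complex.cpow_def_of_ne_zero hpi, ← Complex.exp_neg, ← Complex.ofReal_log Real.pi_pos.le]
    have h3 : (1 - z) ^ 3 = Complex.exp ((3 : ℕ) * Complex.log (1 - z)) := by
      rw [Complex.exp_nat_mul, Complex.exp_log h0]
    rw [h3, ← Complex.exp_add, ← Complex.exp_add, ← Complex.exp_add, mainTerm]
    congr 1
    push_cast
    ring
  have hre : 0 < ((1 - z)⁻¹).re := by linarith [half_lt_re_inv_one_sub hz]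
  have hpp : (Real.pi : ℂ) ^ (-(1 - z)⁻¹ / 2) * (Real.pi : ℂ) ^ ((1 - z)⁻¹ / 2) = 1 := by
    rw [← Complex.cpow_add _ _ hpi, neg_div, neg_add_cancel, Complex.cpow_zero]
  have hexp : Real.exp c = ‖Complex.exp c‖ := by rw [Complex.norm_exp, Complex.ofReal_re]
  rw [hE, xi2_eq_of_re_pos hre, hexp, ← norm_div, ← norm_pow, ← norm_mul, ← norm_mul, ← norm_mul,
    ← norm_mul]
  congr 1
  calc _ = (1 - z)⁻¹ * riemannZeta₁ (1 - z)⁻¹ *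
        ((Real.pi : ℂ) ^ (-(1 - z)⁻¹ / 2) * (Real.pi : ℂ) ^ ((1 - z)⁻¹ / 2)) *
        Complex.Gamma ((1 - z)⁻¹ / 2) * (Complex.exp (stirlingMain ((1 - z)⁻¹ / 2)))⁻¹ *
        (1 - z) ^ 3 * Complex.exp c := by ring
    _ = _ := by rw [hpp]; ring

/-- For a suitable normalisation `c`, `2ξ(1/(1-z))` is bounded by the exponential of the main
term on the unit disc, and is not much smaller on the radius ending at `1`. -/
theorem exists_norm_xi2_mul_exp_neg_mainTerm_bounds :
    ∃ c K : ℝ, 0 < K ∧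
      (∀ z : ℂ, ‖z‖ < 1 → ‖xi2 (1 - z)⁻¹ * Complex.exp (-mainTerm c z)‖ ≤ 1) ∧
      ∀ x : ℝ, 1 / 2 < x → x < 1 →
        K * (1 - x) ≤ ‖xi2 (1 - (x : ℂ))⁻¹ * Complex.exp (-mainTerm c x)‖ := by
  obtain ⟨M, hM⟩ := exists_norm_Gamma_bounds
  obtain ⟨C, hC, hζ⟩ := exists_norm_riemannZeta₁_le
  have hΓ : ∀ z : ℂ, ‖z‖ < 1 →
      Real.exp (-M) ≤ ‖Complex.Gamma ((1 - z)⁻¹ / 2)‖ /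
        ‖Complex.exp (stirlingMain ((1 - z)⁻¹ / 2))‖ ∧
      ‖Complex.Gamma ((1 - z)⁻¹ / 2)‖ / ‖Complex.exp (stirlingMain ((1 - z)⁻¹ / 2))‖
        ≤ Real.exp M := by
    intro z hz
    have hpos : 0 < ‖Complex.exp (stirlingMain ((1 - z)⁻¹ / 2))‖ :=
      norm_pos_iff.2 (Complex.exp_ne_zero _)
    rw [le_div_iff₀ hpos, div_le_iff₀ hpos]
    refine hM _ ?_
    rw [Complex.div_ofNat_re]
    linarith [half_lt_re_inv_one_sub hz]
  set c : ℝ := -(Real.log C + M) with hc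
  refine ⟨c, Real.exp c * (1 / 2) * Real.exp (-M), by positivity, fun z hz => ?_,
    fun x hx hx1 => ?_⟩
  · have hz1 : z ≠ 1 := by rintro rfl; simp at hz
    have h0 : 0 < ‖1 - z‖ := norm_pos_iff.2 (sub_ne_zero.2 hz1.symm)
    rw [norm_xi2_mul_exp_neg_mainTerm c hz]
    calc _ ≤ Real.exp c * (‖(1 - z)⁻¹‖ * (C * ‖(1 - z)⁻¹‖ ^ 2) * ‖1 - z‖ ^ 3) * Real.exp M := by
          gcongr
          · exact hζ _ (half_lt_re_inv_one_sub hz)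
          · exact (hΓ z hz).2
      _ = Real.exp c * C * Real.exp M := by rw [norm_inv]; field_simp
      _ = 1 := by
          rw [hc, neg_add, Real.exp_add, Real.exp_neg, Real.exp_log hC, Real.exp_neg]
          field_simp
  · have hxn : ‖(x : ℂ)‖ < 1 := by
      rw [Complex.norm_real, Real.norm_of_nonneg (by linarith)]; exact hx1
    have hd : 0 < 1 - x := by linarith
    have hs1 : 1 < (1 - x)⁻¹ := (one_lt_inv₀ hd).2 (by linarith)
    have hs : (1 - (x : ℂ))⁻¹ = (((1 - x)⁻¹ : ℝ) : ℂ) := by push_cast; rfl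
    have hn : ‖1 - (x : ℂ)‖ = 1 - x := by
      rw [← Complex.ofReal_one, ← Complex.ofReal_sub, Complex.norm_real, Real.norm_of_nonneg hd.le]
    have hζ1 : x * (1 - x)⁻¹ ≤ ‖riemannZeta₁ (1 - (x : ℂ))⁻¹‖ := by
      have hne : (((1 - x)⁻¹ : ℝ) : ℂ) ≠ 1 := by exact_mod_cast hs1.ne'
      have h := one_le_norm_riemannZeta_ofReal hs1
      rw [riemannZeta_eq_inv_sub_mul hne, norm_mul, norm_inv] at h
      have hsub : ‖(((1 - x)⁻¹ : ℝ) : ℂ) - 1‖ = x * (1 - x)⁻¹ := by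
        rw [← Complex.ofReal_one, ← Complex.ofReal_sub, Complex.norm_real,
          Real.norm_of_nonneg (by linarith)]
        field_simp
        ring
      rw [hsub, inv_mul_eq_div, le_div_iff₀ (by positivity)] at h
      rw [hs]; linarith
    rw [norm_xi2_mul_exp_neg_mainTerm c hxn]
    calc Real.exp c * (1 / 2) * Real.exp (-M) * (1 - x)
        ≤ Real.exp c * x * Real.exp (-M) * (1 - x) := by gcongr
      _ = Real.exp c * ((1 - x)⁻¹ * (x * (1 - x)⁻¹) * (1 - x) ^ 3) * Real.exp (-M) := by
          field_simp
      _ ≤ _ := by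
          rw [norm_inv, hn]
          gcongr
          exact (hΓ x hxn).1

theorem log_exp_eventuallyEq {L : ℂ → ℂ} (hL : ContinuousAt L 0) (h0 : L 0 = 0) :
    (fun z => Complex.log (Complex.exp (L z))) =ᶠ[nhds 0] L := by
  have him : ContinuousAt (fun z => |(L z).im|) 0 :=
    (Complex.continuous_im.continuousAt.comp hL).abs
  have h : |(L 0).im| < Real.pi := by rw [h0]; simpa using Real.pi_pos
  filter_upwards [him.eventually_lt_const h] with z hz
  rw [abs_lt] at hz
  exact Complex.log_exp hz.1 hz.2.le

open Filter Topology in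
theorem exists_tendsto_iteratedDeriv_PhiKL_sub_mainTerm (hRH : RiemannHypothesis) :
    ∃ c : ℝ, Tendsto (fun n : ℕ => iteratedDeriv n PhiKL 0 / (n.factorial : ℂ)
      - iteratedDeriv n (mainTerm c) 0 / (n.factorial : ℂ)) atTop (𝓝 0) := by
  obtain ⟨c, K, hK, hle, hge⟩ := exists_norm_xi2_mul_exp_neg_mainTerm_bounds
  have hb := Metric.isOpen_ball (x := (0 : ℂ)) (ε := 1)
  have hmem : ∀ {z : ℂ}, z ∈ Metric.ball (0 : ℂ) 1 → ‖z‖ < 1 := fun hz => by simpa using hz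
  obtain ⟨L, hL, hL0, hexp⟩ := exists_differentiableOn_exp_eq (g := fun z => xi2 (1 - z)⁻¹)
    (fun z hz => (analyticAt_xi2_inv_one_sub (hmem hz).le
      (ne_one_of_mem_ball hz)).differentiableAt.differentiableWithinAt)
    (fun z hz => xi2_ne_zero_of_RH hRH (half_lt_re_inv_one_sub (hmem hz)))
    (by simp [xi2])
  have hLan : AnalyticAt ℂ L 0 := hL.analyticAt (hb.mem_nhds (Metric.mem_ball_self one_pos))
  have hEan : AnalyticAt ℂ (mainTerm c) 0 := analyticAt_mainTerm c (by simp) zero_ne_one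
  have hPhi : PhiKL =ᶠ[𝓝 0] L := by
    refine EventuallyEq.trans ?_ (log_exp_eventuallyEq hLan.continuousAt hL0)
    filter_upwards [hb.mem_nhds (Metric.mem_ball_self one_pos)] with z hz
    rw [PhiKL, hexp z hz, one_div]
  have hfF : ∀ z ∈ Metric.ball (0 : ℂ) 1,
      xi2 (1 - z)⁻¹ * Complex.exp (-mainTerm c z) = Complex.exp (L z - mainTerm c z) := by
    intro z hz
    rw [sub_eq_add_neg (L z), Complex.exp_add, hexp z hz]
  have hneg : ∀ z ∈ Metric.ball (0 : ℂ) 1, (L z - mainTerm c z).re ≤ 0 := by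
    intro z hz
    have := hle z (hmem hz)
    rwa [hfF z hz, Complex.norm_exp, Real.exp_le_one_iff] at this
  have hlim : Tendsto (fun x : ℝ => (1 - x) * (L x - mainTerm c x).re) (𝓝[<] 1) (𝓝 0) := by
    have hlow : Tendsto (fun x : ℝ => (1 - x) * Real.log K + (1 - x) * Real.log (1 - x))
        (𝓝[<] 1) (𝓝 0) := by
      have : Continuous fun x : ℝ => (1 - x) * Real.log K + (1 - x) * Real.log (1 - x) :=
        (by fun_prop : Continuous fun x : ℝ => (1 - x) * Real.log K).add
          (Real.continuous_mul_log.comp (by fun_prop : Continuous fun x : ℝ => 1 - x))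
      exact (this.tendsto' 1 0 (by simp)).mono_left nhdsWithin_le_nhds
    have hx : ∀ᶠ x in 𝓝[<] (1 : ℝ), 1 / 2 < x ∧ x < 1 :=
      Ioo_mem_nhdsLT (by norm_num)
    have hxb : ∀ x : ℝ, 1 / 2 < x → x < 1 → (x : ℂ) ∈ Metric.ball (0 : ℂ) 1 := by
      intro x hx hx1
      rw [mem_ball_zero_iff, Complex.norm_real, Real.norm_of_nonneg (by linarith)]
      exact hx1
    refine tendsto_of_tendsto_of_tendsto_of_le_of_le' hlow tendsto_const_nhds ?_ ?_
    · filter_upwards [hx] with x ⟨hx, hx1⟩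
      have h := hge x hx hx1
      have hd : 0 < 1 - x := by linarith
      rw [hfF x (hxb x hx hx1), Complex.norm_exp, ← Real.log_le_iff_le_exp (by positivity),
        Real.log_mul hK.ne' hd.ne'] at h
      rw [← mul_add]
      gcongr
    · filter_upwards [hx] with x ⟨hx, hx1⟩
      exact mul_nonpos_of_nonneg_of_nonpos (by linarith) (hneg x (hxb x hx hx1))
  have key := tendsto_taylorCoeff_of_norm_le_one
    (f := fun z => xi2 (1 - z)⁻¹ * Complex.exp (-mainTerm c z))
    (F := fun z => L z - mainTerm c z)
    (fun z hz hz1 => (analyticAt_xi2_inv_one_sub hz.le hz1).mul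
      (analyticAt_mainTerm c hz.le hz1).neg.cexp)
    (fun z hz => ((hL.differentiableAt (hb.mem_nhds hz)).sub (analyticAt_mainTerm c (hmem hz).le
      (ne_one_of_mem_ball hz)).differentiableAt).differentiableWithinAt)
    hfF hneg hlim
  refine ⟨c, key.congr fun n => ?_⟩
  rw [iteratedDeriv_fun_sub hLan.contDiffAt hEan.contDiffAt, hPhi.iteratedDeriv_eq n, sub_div]

/-- If RH holds then `λ_n^K = (1/2)[log n + (γ - log 2π - 1)] + o(1)`. -/
theorem lambdaK_tendsto_of_RH (hRH : RiemannHypothesis) :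
    Filter.Tendsto (fun n : ℕ => lambdaK n - Real.log n / 2) Filter.atTop
      (nhds ((Real.eulerMascheroniConstant - Real.log (2 * Real.pi) - 1) / 2)) := by
  obtain ⟨c, hc⟩ := exists_tendsto_iteratedDeriv_PhiKL_sub_mainTerm hRH
  have hre := (Complex.continuous_re.tendsto _).comp hc
  have hinv : Filter.Tendsto (fun n : ℕ => 5 / 2 / (n : ℝ)) Filter.atTop (nhds 0) :=
    tendsto_const_div_atTop_nhds_zero_nat _
  have hsum := ((hre.add (Real.tendsto_harmonic_sub_log.div_const 2)).add hinv).sub_const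
    ((1 + Real.log (2 * Real.pi)) / 2)
  have hlim : (0 : ℂ).re + Real.eulerMascheroniConstant / 2 + 0 - (1 + Real.log (2 * Real.pi)) / 2
      = (Real.eulerMascheroniConstant - Real.log (2 * Real.pi) - 1) / 2 := by
    rw [Complex.zero_re]; ring
  rw [hlim] at hsum
  refine hsum.congr' ?_
  filter_upwards [Filter.eventually_ne_atTop 0] with n hn
  rw [Function.comp_apply, iteratedDeriv_mainTerm_div_factorial c hn, Complex.sub_re,
    Complex.ofReal_re, lambdaK]
  ring
end

section
/- If the Riemann Hypothesis is false, then λ_n^L < 0 occurs for infinitely many n: the set {n : ℕ | λ_n^L < 0} is infinite. -/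
open scoped Nat BigOperators

open Complex Metric Filter Topology ComplexConjugate

/-- If `f'` is dominated by `f` on the segment `[0, w)` and `f w = 0`, then `f 0 = 0`. -/
lemma eq_zero_of_norm_deriv_le_on_segment {f : ℂ → ℂ} (hf : DifferentiableOn ℂ f (ball 0 1))
    {w : ℂ} (hw : w ∈ ball (0 : ℂ) 1) (hfw : f w = 0) {M : ℝ}
    (hM : ∀ t : ℝ, 0 ≤ t → t < 1 → ‖deriv f (t * w)‖ ≤ M * ‖f (t * w)‖) : f 0 = 0 := by
  have hmem : ∀ t : ℝ, 0 ≤ t → t ≤ 1 → (t : ℂ) * w ∈ ball (0 : ℂ) 1 := by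
    intro t h0 h1
    rw [mem_ball_zero_iff] at hw ⊢
    rw [norm_mul, Complex.norm_real, Real.norm_of_nonneg h0]
    exact (mul_le_of_le_one_left (norm_nonneg _) h1).trans_lt hw
  have hd : DifferentiableOn ℂ (deriv f) (ball 0 1) := hf.deriv isOpen_ball
  have hcont : ∀ g : ℂ → ℂ, DifferentiableOn ℂ g (ball 0 1) →
      ContinuousOn (fun t : ℝ ↦ g (t * w)) (Set.Icc 0 1) := fun g hg ↦
    hg.continuousOn.comp (by fun_prop) fun t ht ↦ hmem t ht.1 ht.2
  have hM' : ∀ t ∈ Set.Icc (0 : ℝ) 1, ‖deriv f (t * w)‖ ≤ M * ‖f (t * w)‖ := by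
    intro t ht
    rw [← closure_Ico (zero_ne_one' ℝ)] at ht hcont
    exact le_on_closure (f := fun t : ℝ ↦ ‖deriv f (t * w)‖) (g := fun t : ℝ ↦ M * ‖f (t * w)‖)
      (fun t ht ↦ hM t ht.1 ht.2) (hcont _ hd).norm (continuousOn_const.mul (hcont _ hf).norm) ht
  have hder : ∀ t ∈ Set.Icc (0 : ℝ) 1,
      HasDerivAt (fun t : ℝ ↦ f ((1 - t : ℝ) * w)) (-w * deriv f ((1 - t : ℝ) * w)) t := by
    intro t ht
    have h1 : HasDerivAt f (deriv f ((1 - t : ℝ) * w)) ((1 - t : ℝ) * w) :=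
      (hf.differentiableAt (isOpen_ball.mem_nhds
        (hmem _ (by linarith [ht.2]) (by linarith [ht.1])))).hasDerivAt
    have h2 : HasDerivAt (fun t : ℝ ↦ ((1 - t : ℝ) : ℂ) * w) (-w) t := by
      have := (((hasDerivAt_id t).const_sub 1).ofReal_comp).mul_const w
      simpa using this
    rw [mul_comm]
    exact h1.comp t h2
  have := norm_le_gronwallBound_of_norm_deriv_right_le (f := fun t : ℝ ↦ f ((1 - t : ℝ) * w))
    (f' := fun t : ℝ ↦ -w * deriv f ((1 - t : ℝ) * w)) (δ := 0) (K := ‖w‖ * M) (ε := 0)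
    (a := 0) (b := 1) (fun t ht ↦ (hder t ht).continuousAt.continuousWithinAt)
    (fun t ht ↦ (hder t (Set.Ico_subset_Icc_self ht)).hasDerivWithinAt) (by simp [hfw])
    (fun t ht ↦ by
      rw [norm_mul, norm_neg, add_zero, mul_assoc]
      exact mul_le_mul_of_nonneg_left
        (hM' (1 - t) ⟨by linarith [ht.2], by linarith [ht.1]⟩) (norm_nonneg _)) 1 (by simp)
  simpa [gronwallBound_ε0] using this

/-- A power series with eventually nonnegative coefficients is dominated, up to a constant,
by its values on the positive axis. -/
lemma exists_norm_le_of_eventually_nonneg {L : ℂ → ℂ} {a : ℕ → ℂ} {r : ℝ}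
    (hL : ∀ z ∈ ball (0 : ℂ) r, HasSum (fun n ↦ a n * z ^ n) (L z)) {N : ℕ}
    (ha : ∀ n ≥ N, ∃ x : ℝ, 0 ≤ x ∧ a n = x) :
    ∃ C : ℝ, ∀ z ∈ ball (0 : ℂ) r, ‖L z‖ ≤ ‖L (‖z‖ : ℝ)‖ + C := by
  refine ⟨∑ n ∈ Finset.range N, 2 * (‖a n‖ * r ^ n), fun z hz ↦ ?_⟩
  have hz' : ((‖z‖ : ℝ) : ℂ) ∈ ball (0 : ℂ) r := by simpa using hz
  have hzr : ‖z‖ ≤ r := (mem_ball_zero_iff.mp hz).le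
  have hs := hL _ hz'
  have hsn : Summable fun n ↦ ‖a n‖ * ‖z‖ ^ n := by simpa using hs.summable.norm
  have hre : HasSum (fun n ↦ (a n).re * ‖z‖ ^ n) (L (‖z‖ : ℝ)).re := by
    convert Complex.hasSum_re hs using 2 with n
    rw [← Complex.ofReal_pow, Complex.re_mul_ofReal]
  have h1 : ‖L z‖ ≤ ∑' n, ‖a n‖ * ‖z‖ ^ n := by
    rw [← (hL z hz).tsum_eq]
    refine (norm_tsum_le_tsum_norm (by simpa using hsn)).trans (by simp)
  have hdiff : HasSum (fun n ↦ ‖a n‖ * ‖z‖ ^ n - (a n).re * ‖z‖ ^ n)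
      (∑' n, ‖a n‖ * ‖z‖ ^ n - (L (‖z‖ : ℝ)).re) := hsn.hasSum.sub hre
  have hfin : HasSum (fun n ↦ ‖a n‖ * ‖z‖ ^ n - (a n).re * ‖z‖ ^ n)
      (∑ n ∈ Finset.range N, (‖a n‖ * ‖z‖ ^ n - (a n).re * ‖z‖ ^ n)) := by
    refine hasSum_sum_of_ne_finset_zero fun n hn ↦ ?_
    obtain ⟨x, hx, hax⟩ := ha n (by simpa using hn)
    simp [hax, abs_of_nonneg hx]
  have h2 : ∑ n ∈ Finset.range N, (‖a n‖ * ‖z‖ ^ n - (a n).re * ‖z‖ ^ n) ≤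
      ∑ n ∈ Finset.range N, 2 * (‖a n‖ * r ^ n) := by
    refine Finset.sum_le_sum fun n _ ↦ ?_
    have h3 : -‖a n‖ ≤ (a n).re := (abs_le.mp (Complex.abs_re_le_norm _)).1
    have h4 : ‖z‖ ^ n ≤ r ^ n := by gcongr
    have h5 : 0 ≤ ‖z‖ ^ n := by positivity
    nlinarith [norm_nonneg (a n), mul_le_mul_of_nonneg_left h4 (norm_nonneg (a n)),
      mul_le_mul_of_nonneg_right h3 h5]
  have h3 := hdiff.unique hfin
  have h4 : (L (‖z‖ : ℝ)).re ≤ ‖L (‖z‖ : ℝ)‖ := Complex.re_le_norm _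
  linarith

/-- If the logarithmic derivative of a function without zeros on `[0, 1)` has eventually
nonnegative Taylor coefficients, then the function has no zeros in the unit disc. -/
lemma ne_zero_of_logDeriv_coeff_eventually_nonneg {f : ℂ → ℂ}
    (hf : DifferentiableOn ℂ f (ball 0 1)) (hpos : ∀ x : ℝ, 0 ≤ x → x < 1 → f x ≠ 0) {N : ℕ}
    (ha : ∀ n ≥ N, ∃ x : ℝ, 0 ≤ x ∧ (n ! : ℂ)⁻¹ * iteratedDeriv n (logDeriv f) 0 = x)
    {w : ℂ} (hw : w ∈ ball (0 : ℂ) 1) : f w ≠ 0 := by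
  intro hfw
  have hw1 : ‖w‖ < 1 := mem_ball_zero_iff.mp hw
  have hsub : closedBall (0 : ℂ) ‖w‖ ⊆ ball 0 1 := closedBall_subset_ball hw1
  have hK : IsCompact (closedBall (0 : ℂ) ‖w‖ ∩ f ⁻¹' {0}) :=
    (isCompact_closedBall _ _).of_isClosed_subset
      ((hf.continuousOn.mono hsub).preimage_isClosed_of_isClosed isClosed_closedBall
        isClosed_singleton) Set.inter_subset_left
  obtain ⟨p, ⟨hpw, hfp⟩, hmin⟩ := hK.exists_isMinOn ⟨w, by simp, hfw⟩ continuous_norm.continuousOn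
  replace hfp : f p = 0 := hfp
  have hp : p ∈ ball (0 : ℂ) 1 := hsub hpw
  have hp1 : ‖p‖ < 1 := mem_ball_zero_iff.mp hp
  have hpw' : ‖p‖ ≤ ‖w‖ := mem_closedBall_zero_iff.mp hpw
  have hballsub : ball (0 : ℂ) ‖p‖ ⊆ ball 0 1 := ball_subset_ball hp1.le
  have hne : ∀ z ∈ ball (0 : ℂ) ‖p‖, f z ≠ 0 := by
    intro z hz hfz
    have hz' : ‖z‖ < ‖p‖ := mem_ball_zero_iff.mp hz
    exact absurd (hmin ⟨mem_closedBall_zero_iff.mpr (hz'.le.trans hpw'), hfz⟩) (not_le.mpr hz')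
  have hd : DifferentiableOn ℂ (deriv f) (ball 0 1) := hf.deriv isOpen_ball
  have hL : DifferentiableOn ℂ (logDeriv f) (ball 0 ‖p‖) :=
    (hd.mono hballsub).div (hf.mono hballsub) hne
  obtain ⟨C, hC⟩ := exists_norm_le_of_eventually_nonneg (L := logDeriv f)
    (a := fun n ↦ (n ! : ℂ)⁻¹ * iteratedDeriv n (logDeriv f) 0) (r := ‖p‖)
    (fun z hz ↦ by
      have := Complex.hasSum_taylorSeries_on_ball hL hz
      simpa [smul_eq_mul, mul_assoc, mul_comm, mul_left_comm] using this) ha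
  have hcont : ContinuousOn (fun x : ℝ ↦ logDeriv f x) (Set.Icc 0 ‖p‖) := by
    have hmaps : Set.MapsTo (fun x : ℝ ↦ (x : ℂ)) (Set.Icc 0 ‖p‖) (ball 0 1) := by
      intro x hx
      rw [mem_ball_zero_iff, Complex.norm_real, Real.norm_of_nonneg hx.1]
      exact hx.2.trans_lt hp1
    exact (hd.continuousOn.comp (by fun_prop) hmaps).div (hf.continuousOn.comp (by fun_prop) hmaps)
      fun x hx ↦ hpos x hx.1 (hx.2.trans_lt hp1)
  obtain ⟨B, hB⟩ := isCompact_Icc.exists_bound_of_continuousOn hcont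
  refine hpos 0 le_rfl one_pos ?_
  rw [Complex.ofReal_zero]
  refine eq_zero_of_norm_deriv_le_on_segment hf hp hfp (M := B + C) fun t h0 h1 ↦ ?_
  have hp0 : p ≠ 0 := by
    rintro rfl
    exact hpos 0 le_rfl one_pos (by simpa using hfp)
  have hnorm : ‖(t : ℂ) * p‖ = t * ‖p‖ := by
    rw [norm_mul, Complex.norm_real, Real.norm_of_nonneg h0]
  have hlt : ‖(t : ℂ) * p‖ < ‖p‖ := by
    rw [hnorm]; exact mul_lt_of_lt_one_left (norm_pos_iff.mpr hp0) h1
  have hmem : (t : ℂ) * p ∈ ball (0 : ℂ) ‖p‖ := mem_ball_zero_iff.mpr hlt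
  have h2 := (hC _ hmem).trans (add_le_add_left (hB ‖(t : ℂ) * p‖ ⟨norm_nonneg _, hlt.le⟩) C)
  rwa [logDeriv_apply, norm_div, div_le_iff₀ (norm_pos_iff.mpr (hne _ hmem))] at h2

lemma iteratedDeriv_conj_conj (f : ℂ → ℂ) (n : ℕ) :
    iteratedDeriv n (conj ∘ f ∘ conj) = conj ∘ iteratedDeriv n f ∘ conj := by
  induction n with
  | zero => simp
  | succ n ih =>
    rw [iteratedDeriv_succ, ih, iteratedDeriv_succ]
    ext x
    simp [deriv_conj_conj]

/-- Version of `ne_zero_of_logDeriv_coeff_eventually_nonneg` where only the real parts of the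
coefficients are assumed nonnegative. -/
lemma ne_zero_of_logDeriv_coeff_re_eventually_nonneg {f : ℂ → ℂ}
    (hf : DifferentiableOn ℂ f (ball 0 1)) (hpos : ∀ x : ℝ, 0 ≤ x → x < 1 → f x ≠ 0) {N : ℕ}
    (ha : ∀ n ≥ N, 0 ≤ ((n ! : ℂ)⁻¹ * iteratedDeriv n (logDeriv f) 0).re)
    {w : ℂ} (hw : w ∈ ball (0 : ℂ) 1) : f w ≠ 0 := by
  have hfc : DifferentiableOn ℂ (conj ∘ f ∘ conj) (ball 0 1) := by
    intro z hz
    have hz' : conj z ∈ ball (0 : ℂ) 1 := by simpa using hz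
    have := (hf.differentiableAt (isOpen_ball.mem_nhds hz')).conj_conj
    simp only [Complex.conj_conj] at this
    exact this.differentiableWithinAt
  have hball : ball (0 : ℂ) 1 ∈ 𝓝 0 := ball_mem_nhds _ one_pos
  have hf0 : f 0 ≠ 0 := by simpa using hpos 0 le_rfl one_pos
  have han : AnalyticAt ℂ (logDeriv f) 0 := by
    have := hf.analyticAt hball
    exact this.deriv.div this hf0
  have hanc : AnalyticAt ℂ (conj ∘ f ∘ conj) 0 := hfc.analyticAt hball
  have hcl : logDeriv (conj ∘ f ∘ conj) = conj ∘ logDeriv f ∘ conj := by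
    ext x
    simp [logDeriv_apply, deriv_conj_conj]
  have hanl : AnalyticAt ℂ (conj ∘ logDeriv f ∘ conj) 0 := by
    rw [← hcl]
    exact hanc.deriv.div hanc (by simpa using hf0)
  have hev : logDeriv (fun z ↦ f z * (conj ∘ f ∘ conj) z) =ᶠ[𝓝 0]
      logDeriv f + conj ∘ logDeriv f ∘ conj := by
    have h1 : ∀ᶠ z in 𝓝 (0 : ℂ), f z ≠ 0 :=
      (hf.differentiableAt hball).continuousAt.eventually_ne hf0
    have h2 : ∀ᶠ z in 𝓝 (0 : ℂ), (conj ∘ f ∘ conj) z ≠ 0 :=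
      hanc.continuousAt.eventually_ne (by simpa using hf0)
    filter_upwards [h1, h2, isOpen_ball.mem_nhds (mem_ball_self one_pos)] with z h1 h2 hz
    rw [logDeriv_mul z h1 h2 (hf.differentiableAt (isOpen_ball.mem_nhds hz))
      (hfc.differentiableAt (isOpen_ball.mem_nhds hz)), hcl, Pi.add_apply]
  have key := ne_zero_of_logDeriv_coeff_eventually_nonneg (f := fun z ↦ f z * (conj ∘ f ∘ conj) z)
    (hf.mul hfc) (fun x h0 h1 ↦ mul_ne_zero (hpos x h0 h1) (by simpa using hpos x h0 h1)) (N := N)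
    (fun n hn ↦ ⟨2 * ((n ! : ℂ)⁻¹ * iteratedDeriv n (logDeriv f) 0).re,
      mul_nonneg zero_le_two (ha n hn), by
        rw [hev.iteratedDeriv_eq, iteratedDeriv_add han.contDiffAt hanl.contDiffAt,
          iteratedDeriv_conj_conj]
        have := Complex.add_conj ((n ! : ℂ)⁻¹ * iteratedDeriv n (logDeriv f) 0)
        push_cast at this ⊢
        rw [← this]
        simp [mul_add]⟩) hw
  exact left_ne_zero_of_mul key

/-- The entire function `2ξ`, written through the entire part of the completed zeta function. -/
noncomputable def entireXi (s : ℂ) : ℂ := s * (s - 1) * completedRiemannZeta₀ s + 1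

lemma differentiable_entireXi : Differentiable ℂ entireXi :=
  ((differentiable_id.mul (differentiable_id.sub_const 1)).mul
    differentiable_completedZeta₀).add_const 1

lemma entireXi_one_sub (s : ℂ) : entireXi (1 - s) = entireXi s := by
  rw [entireXi, entireXi, completedRiemannZeta₀_one_sub]
  ring

lemma entireXi_eq {s : ℂ} (h0 : s ≠ 0) (h1 : s ≠ 1) :
    entireXi s = s * (s - 1) * completedRiemannZeta s := by
  have h1' : 1 - s ≠ 0 := sub_ne_zero.mpr h1.symm
  rw [entireXi, completedRiemannZeta_eq]
  field_simp
  ring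

lemma completedRiemannZeta_eq_mul {s : ℂ} (hs : s ≠ 0) (hG : Gammaℝ s ≠ 0) :
    completedRiemannZeta s = Gammaℝ s * riemannZeta s := by
  rw [riemannZeta_def_of_ne_zero hs, mul_div_cancel₀ _ hG]

lemma xi2_eq_entireXi {s : ℂ} (hs : 0 < s.re) : xi2 s = entireXi s := by
  have h0 : s ≠ 0 := by rintro rfl; simp at hs
  by_cases h1 : s = 1
  · simp [xi2, entireXi, h1]
  · rw [xi2, if_neg (by tauto), entireXi_eq h0 h1,
      completedRiemannZeta_eq_mul h0 (Gammaℝ_ne_zero_of_re_pos hs), Gammaℝ_def]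
    ring

lemma entireXi_ne_zero_of_one_le_re {s : ℂ} (hs : 1 ≤ s.re) : entireXi s ≠ 0 := by
  by_cases h1 : s = 1
  · simp [entireXi, h1]
  · have h0 : s ≠ 0 := by rintro rfl; norm_num at hs
    have hG := Gammaℝ_ne_zero_of_re_pos (zero_lt_one.trans_le hs)
    rw [entireXi_eq h0 h1, completedRiemannZeta_eq_mul h0 hG]
    exact mul_ne_zero (mul_ne_zero h0 (sub_ne_zero.mpr h1))
      (mul_ne_zero hG (riemannZeta_ne_zero_of_one_le_re hs))

lemma exists_entireXi_eq_zero_of_not_RH (h : ¬ RiemannHypothesis) :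
    ∃ s : ℂ, 1 / 2 < s.re ∧ entireXi s = 0 := by
  simp only [RiemannHypothesis, not_forall] at h
  obtain ⟨s, hz, ht, h1, hre⟩ := h
  have h0 : s ≠ 0 := by
    rintro rfl
    norm_num [riemannZeta_zero] at hz
  have hG : Gammaℝ s ≠ 0 := by
    rw [Ne, Gammaℝ_eq_zero_iff]
    rintro ⟨n, hn⟩
    cases n with
    | zero => simp [hn] at h0
    | succ n => exact ht ⟨n, by rw [hn]; push_cast; ring⟩
  have hxi : entireXi s = 0 := by
    rw [entireXi_eq h0 h1, completedRiemannZeta_eq_mul h0 hG, hz]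
    simp
  rcases lt_or_gt_of_ne hre with hlt | hgt
  · refine ⟨1 - s, ?_, by rw [entireXi_one_sub, hxi]⟩
    rw [Complex.sub_re, Complex.one_re]
    linarith
  · exact ⟨s, hgt, hxi⟩

lemma one_sub_ne_zero_of_mem_ball {z : ℂ} (hz : z ∈ ball (0 : ℂ) 1) : 1 - z ≠ 0 := by
  intro h
  rw [sub_eq_zero] at h
  simp [← h] at hz

lemma differentiableOn_entireXi_comp :
    DifferentiableOn ℂ (fun z ↦ entireXi (1 / (1 - z))) (ball 0 1) := by
  intro z hz
  refine (differentiable_entireXi.differentiableAt.comp z ?_).differentiableWithinAt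
  exact (differentiableAt_const 1).div ((differentiableAt_const 1).sub differentiableAt_id)
    (one_sub_ne_zero_of_mem_ball hz)

lemma xi2_comp_eventuallyEq :
    (fun z ↦ xi2 (1 / (1 - z))) =ᶠ[𝓝 0] fun z ↦ entireXi (1 / (1 - z)) := by
  have hc : ContinuousAt (fun z : ℂ ↦ (1 / (1 - z)).re) 0 := by
    refine Complex.continuous_re.continuousAt.comp ?_
    exact continuousAt_const.div (by fun_prop) (by simp)
  filter_upwards [hc.eventually_const_lt (u := 0) (by simp)] with z hz
  exact xi2_eq_entireXi hz

lemma deriv_PhiKL_eventuallyEq :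
    deriv PhiKL =ᶠ[𝓝 0] logDeriv fun z ↦ entireXi (1 / (1 - z)) := by
  have hd := differentiableOn_entireXi_comp
  have hc : ContinuousAt (fun z ↦ entireXi (1 / (1 - z))) 0 :=
    (hd.differentiableAt (ball_mem_nhds _ one_pos)).continuousAt
  have hs : ∀ᶠ z in 𝓝 (0 : ℂ), entireXi (1 / (1 - z)) ∈ slitPlane :=
    hc.eventually_mem (isOpen_slitPlane.mem_nhds (by simp [entireXi]))
  have hP : PhiKL =ᶠ[𝓝 0] fun z ↦ Complex.log (entireXi (1 / (1 - z))) :=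
    xi2_comp_eventuallyEq.fun_comp Complex.log
  filter_upwards [hP.deriv, hs, ball_mem_nhds (0 : ℂ) one_pos] with z h1 h2 hz
  rw [h1]
  exact ((hd.differentiableAt (isOpen_ball.mem_nhds hz)).hasDerivAt.clog h2).deriv

lemma lambdaL_succ (n : ℕ) :
    lambdaL (n + 1) =
      ((n ! : ℂ)⁻¹ * iteratedDeriv n (logDeriv fun z ↦ entireXi (1 / (1 - z))) 0).re := by
  have hn : (n : ℂ) + 1 ≠ 0 := by exact_mod_cast n.succ_ne_zero
  have hf : (n ! : ℂ) ≠ 0 := by exact_mod_cast n.factorial_ne_zero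
  rw [lambdaL, lambdaK, iteratedDeriv_succ', deriv_PhiKL_eventuallyEq.iteratedDeriv_eq,
    ← Complex.re_ofReal_mul, Nat.factorial_succ]
  congr 1
  push_cast
  field_simp

/-- If RH is false then `λ_n^L < 0` for infinitely many `n`. -/
theorem lambdaL_neg_infinitely_often_of_not_RH (h : ¬ RiemannHypothesis) :
    {n : ℕ | lambdaL n < 0}.Infinite := by
  intro hfin
  obtain ⟨N, hN⟩ := hfin.bddAbove
  obtain ⟨s, hs, hxi⟩ := exists_entireXi_eq_zero_of_not_RH h
  have hs0 : s ≠ 0 := by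
    rintro rfl
    norm_num at hs
  have hw : 1 - 1 / s ∈ ball (0 : ℂ) 1 := by
    rw [mem_ball_zero_iff, one_sub_div hs0, norm_div, div_lt_one (norm_pos_iff.mpr hs0)]
    refine lt_of_pow_lt_pow_left₀ 2 (norm_nonneg _) ?_
    rw [Complex.sq_norm, Complex.sq_norm, Complex.normSq_apply, Complex.normSq_apply]
    simp only [Complex.sub_re, Complex.sub_im, Complex.one_re, Complex.one_im]
    nlinarith
  refine ne_zero_of_logDeriv_coeff_re_eventually_nonneg differentiableOn_entireXi_comp
    (fun x h0 h1 ↦ entireXi_ne_zero_of_one_le_re ?_) (N := N) (fun n hn ↦ ?_) hw ?_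
  · have : (1 / (1 - (x : ℂ))) = ((1 / (1 - x) : ℝ) : ℂ) := by push_cast; rfl
    rw [this, Complex.ofReal_re, le_div_iff₀ (by linarith)]
    linarith
  · rw [← lambdaL_succ]
    by_contra! hneg
    have : n + 1 ≤ N := hN hneg
    omega
  · simpa using hxi
end

section
/- Li's sum formula over the Riemann zeros: for every integer n ≥ 1, the symmetrically grouped sums over zeros converge to Li's constant: lim_{T→∞} Σ_{ρ : 2ξ(ρ)=0, |Im ρ| ≤ T} m_ρ·(1 − (1 − 1/ρ)^n) = λ_n^L, where each sum is over the (finitely many) zeros ρ of 2ξ with |Im ρ| ≤ T, counted with multiplicity m_ρ (the order of vanishing of 2ξ at ρ). -/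
open scoped Nat BigOperators

/-- The multiplicity `m_ρ` of a zero `ρ` of `2ξ`: the analytic order of
vanishing, i.e. the least `k` such that `2ξ(z) = (z - ρ)^k g(z)` near `ρ` with
`g` analytic and nonvanishing at `ρ`. -/
noncomputable def xiOrder (ρ : ℂ) : ℕ :=
  sInf {k : ℕ | ∃ g : ℂ → ℂ, AnalyticAt ℂ g ρ ∧ g ρ ≠ 0 ∧
    ∀ᶠ z in nhds ρ, xi2 z = (z - ρ) ^ k * g z}

section

open Complex Filter Topology Metric Set MeasureTheory

/-- The entire function `s (s - 1) Λ₀(s) + 1`, which agrees with `xi2` away from the poles of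
the archimedean factor. -/
noncomputable def xiE (s : ℂ) : ℂ := s * (s - 1) * completedRiemannZeta₀ s + 1

lemma differentiable_xiE : Differentiable ℂ xiE :=
  (((differentiable_id.mul (differentiable_id.sub_const 1)).mul
    differentiable_completedZeta₀).add_const 1)

lemma xiE_one_sub (s : ℂ) : xiE (1 - s) = xiE s := by
  rw [xiE, completedRiemannZeta₀_one_sub, xiE]; ring

lemma xiE_zero : xiE 0 = 1 := by simp [xiE]

lemma xiE_one : xiE 1 = 1 := by simp [xiE]

lemma xiE_eq_mul_completedRiemannZeta {s : ℂ} (h0 : s ≠ 0) (h1 : s ≠ 1) :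
    xiE s = s * (s - 1) * completedRiemannZeta s := by
  have h1' : 1 - s ≠ 0 := sub_ne_zero.mpr h1.symm
  rw [xiE, completedRiemannZeta_eq]
  field_simp
  ring

lemma xi2_eq_xiE {s : ℂ} (hs : Gammaℝ s ≠ 0) : xi2 s = xiE s := by
  rw [xi2]
  split_ifs with h
  · rcases h with rfl | rfl
    · exact xiE_zero.symm
    · exact xiE_one.symm
  · push Not at h
    rw [xiE_eq_mul_completedRiemannZeta h.1 h.2, riemannZeta_def_of_ne_zero h.1,
      mul_assoc (s * (s - 1)), ← Gammaℝ_def]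
    field_simp

lemma xi2_eq_xiE_zero : xi2 0 = xiE 0 := by simp [xi2, xiE_zero]

lemma xi2_eq_zero_of_Gammaℝ_eq_zero {s : ℂ} (hs : Gammaℝ s = 0) (h0 : s ≠ 0) : xi2 s = 0 := by
  have h1 : s ≠ 1 := by
    rintro rfl
    simp at hs
  rw [xi2, if_neg (by tauto), mul_assoc (s * (s - 1)), ← Gammaℝ_def, hs]
  simp

lemma xiE_ne_zero_of_one_le_re {s : ℂ} (hs : 1 ≤ s.re) : xiE s ≠ 0 := by
  rcases eq_or_ne s 1 with rfl | h1
  · simp [xiE_one]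
  have h0 : s ≠ 0 := by
    rintro rfl
    simp at hs
    linarith
  have hG : Gammaℝ s ≠ 0 := Gammaℝ_ne_zero_of_re_pos (by linarith)
  have hz := riemannZeta_ne_zero_of_one_le_re hs
  rw [riemannZeta_def_of_ne_zero h0] at hz
  rw [xiE_eq_mul_completedRiemannZeta h0 h1]
  exact mul_ne_zero (mul_ne_zero h0 (sub_ne_zero.mpr h1)) fun h => hz (by simp [h])

lemma re_lt_one_of_xiE_eq_zero {s : ℂ} (hs : xiE s = 0) : s.re < 1 :=
  lt_of_not_ge fun h => xiE_ne_zero_of_one_le_re h hs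

lemma re_pos_of_xiE_eq_zero {s : ℂ} (hs : xiE s = 0) : 0 < s.re := by
  have := re_lt_one_of_xiE_eq_zero ((xiE_one_sub s).trans hs)
  simp at this
  exact this

lemma xiE_ne_zero_of_Gammaℝ_eq_zero {s : ℂ} (hs : Gammaℝ s = 0) : xiE s ≠ 0 := fun h =>
  Gammaℝ_ne_zero_of_re_pos (re_pos_of_xiE_eq_zero h) hs

lemma eventually_xi2_eq_xiE (ρ : ℂ) : ∀ᶠ s in 𝓝[≠] ρ, xi2 s = xiE s := by
  have h : ∀ᶠ s in 𝓝[≠] ρ, Gammaℝ s ≠ 0 := by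
    rcases ((differentiable_Gammaℝ_inv.analyticAt ρ).eventually_eq_zero_or_eventually_ne_zero)
      with h | h
    · have : (fun s : ℂ => (Gammaℝ s)⁻¹) = fun _ => 0 :=
        AnalyticOnNhd.eq_of_eventuallyEq (fun z _ => differentiable_Gammaℝ_inv.analyticAt z)
          (fun _ _ => analyticAt_const) h
      simpa using congrFun this 1
    · filter_upwards [h] with s hs using fun h0 => hs (by simp [h0])
  filter_upwards [h] with s hs using xi2_eq_xiE hs

lemma eventually_nhds_xi2_eq_xiE {ρ : ℂ} (h : Gammaℝ ρ ≠ 0 ∨ ρ = 0) :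
    ∀ᶠ s in 𝓝 ρ, xi2 s = xiE s := by
  have h' : xi2 ρ = xiE ρ := by
    rcases h with h | rfl
    exacts [xi2_eq_xiE h, xi2_eq_xiE_zero]
  have := eventually_xi2_eq_xiE ρ
  rw [eventually_nhdsWithin_iff] at this
  filter_upwards [this] with s hs
  by_cases hsρ : s = ρ
  · rw [hsρ, h']
  · exact hs hsρ

lemma analyticOrderAt_xiE_ne_top (ρ : ℂ) : analyticOrderAt xiE ρ ≠ ⊤ := by
  rw [Ne, analyticOrderAt_eq_top]
  intro h
  have : xiE = fun _ => 0 :=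
    AnalyticOnNhd.eq_of_eventuallyEq (fun z _ => differentiable_xiE.analyticAt z)
      (fun _ _ => analyticAt_const) h
  simpa [xiE_zero] using congrFun this 0

/-- The multiplicity of the statement is the analytic order of the entire function `xiE`. -/
lemma xiOrder_eq (ρ : ℂ) : xiOrder ρ = analyticOrderNatAt xiE ρ := by
  have han := differentiable_xiE.analyticAt ρ
  by_cases h : Gammaℝ ρ ≠ 0 ∨ ρ = 0
  · have hset : {k : ℕ | ∃ g : ℂ → ℂ, AnalyticAt ℂ g ρ ∧ g ρ ≠ 0 ∧
        ∀ᶠ z in nhds ρ, xi2 z = (z - ρ) ^ k * g z} = {analyticOrderNatAt xiE ρ} := by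
      ext k
      simp only [mem_ofPred_eq, mem_singleton_iff]
      rw [eq_comm, han.analyticOrderNatAt_eq_iff (analyticOrderAt_xiE_ne_top ρ)]
      refine exists_congr fun g => and_congr_right fun _ => and_congr_right fun _ => ?_
      refine eventually_congr ?_
      filter_upwards [eventually_nhds_xi2_eq_xiE h] with z hz
      rw [hz, smul_eq_mul]
    rw [xiOrder, hset, csInf_singleton]
  · push Not at h
    have hne := xiE_ne_zero_of_Gammaℝ_eq_zero h.1
    have hset : {k : ℕ | ∃ g : ℂ → ℂ, AnalyticAt ℂ g ρ ∧ g ρ ≠ 0 ∧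
        ∀ᶠ z in nhds ρ, xi2 z = (z - ρ) ^ k * g z} = ∅ := by
      rw [eq_empty_iff_forall_notMem]
      rintro k ⟨g, hg, hg0, hev⟩
      have hk : k ≠ 0 := by
        rintro rfl
        have := hev.self_of_nhds
        rw [xi2_eq_zero_of_Gammaℝ_eq_zero h.1 h.2] at this
        simp [hg0.symm] at this
      have h1 : Tendsto xiE (𝓝[≠] ρ) (𝓝 (xiE ρ)) :=
        (differentiable_xiE.continuous.tendsto ρ).mono_left nhdsWithin_le_nhds
      have h2 : Tendsto (fun z => (z - ρ) ^ k * g z) (𝓝[≠] ρ) (𝓝 ((ρ - ρ) ^ k * g ρ)) := by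
        have hc : ContinuousAt (fun z => (z - ρ) ^ k * g z) ρ :=
          ContinuousAt.mul (by fun_prop) hg.continuousAt
        exact hc.tendsto.mono_left nhdsWithin_le_nhds
      have h3 : xiE =ᶠ[𝓝[≠] ρ] fun z => (z - ρ) ^ k * g z := by
        filter_upwards [eventually_xi2_eq_xiE ρ, hev.filter_mono nhdsWithin_le_nhds]
          with z hz hz' using hz.symm.trans hz'
      have := tendsto_nhds_unique (h1.congr' h3) h2
      simp [hk] at this
      exact hne this
    rw [xiOrder, hset, Nat.sInf_empty, analyticOrderNatAt,
      han.analyticOrderAt_eq_zero.mpr hne]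
    rfl

lemma xiOrder_eq_zero_of_xiE_ne_zero {ρ : ℂ} (h : xiE ρ ≠ 0) : xiOrder ρ = 0 := by
  rw [xiOrder_eq, analyticOrderNatAt,
    (differentiable_xiE.analyticAt ρ).analyticOrderAt_eq_zero.mpr h]
  rfl

lemma one_le_xiOrder {ρ : ℂ} (h : xiE ρ = 0) : 1 ≤ xiOrder ρ := by
  rw [xiOrder_eq, Nat.one_le_iff_ne_zero]
  intro h0
  have := Nat.cast_analyticOrderNatAt (analyticOrderAt_xiE_ne_top ρ)
  rw [h0] at this
  exact (differentiable_xiE.analyticAt ρ).analyticOrderAt_eq_zero.mp this.symm h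

lemma xi2_eq_zero_of_xiOrder_ne_zero {ρ : ℂ} (h : xiOrder ρ ≠ 0) : xi2 ρ = 0 := by
  have h' : xiE ρ = 0 := by
    by_contra h0
    exact h (xiOrder_eq_zero_of_xiE_ne_zero h0)
  by_cases hG : Gammaℝ ρ = 0
  · exact absurd h' (xiE_ne_zero_of_Gammaℝ_eq_zero hG)
  · rw [xi2_eq_xiE hG, h']

lemma xiOrder_one_sub (ρ : ℂ) : xiOrder (1 - ρ) = xiOrder ρ := by
  have hd : HasDerivAt (fun s : ℂ => 1 - s) (-1) ρ := (hasDerivAt_id ρ).const_sub 1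
  have h := analyticOrderAt_comp_of_deriv_ne_zero (f := xiE) (g := fun s : ℂ => 1 - s) (z₀ := ρ)
    (by fun_prop) (by rw [hd.deriv]; simp)
  have hc : xiE ∘ (fun s : ℂ => 1 - s) = xiE := funext xiE_one_sub
  rw [hc] at h
  rw [xiOrder_eq, xiOrder_eq, analyticOrderNatAt, analyticOrderNatAt, h]

lemma xiE_conj {s : ℂ} (hs : 0 < s.re) : xiE (starRingEnd ℂ s) = starRingEnd ℂ (xiE s) := by
  rw [← xi2_eq_xiE (Gammaℝ_ne_zero_of_re_pos hs),
    ← xi2_eq_xiE (Gammaℝ_ne_zero_of_re_pos (by simpa using hs)), xi2, xi2]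
  have hiff : (starRingEnd ℂ s = 0 ∨ starRingEnd ℂ s = 1) ↔ (s = 0 ∨ s = 1) := by
    simp [map_eq_one_iff (starRingEnd ℂ) (starRingEnd ℂ).injective]
  by_cases h : s = 0 ∨ s = 1
  · rw [if_pos h, if_pos (hiff.mpr h), map_one]
  · rw [if_neg h, if_neg (fun h' => h (hiff.mp h'))]
    have hpi : (Real.pi : ℂ).arg ≠ Real.pi := by
      rw [arg_ofReal_of_nonneg Real.pi_pos.le]
      exact Real.pi_ne_zero.symm
    have h1 : (Real.pi : ℂ) ^ (-(starRingEnd ℂ s) / 2)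
        = starRingEnd ℂ ((Real.pi : ℂ) ^ (-s / 2)) := by
      have := conj_cpow (Real.pi : ℂ) (-(starRingEnd ℂ s) / 2) hpi
      simpa [map_ofNat] using this
    have h2 : Gamma (starRingEnd ℂ s / 2) = starRingEnd ℂ (Gamma (s / 2)) := by
      rw [← Gamma_conj]
      simp [map_ofNat]
    rw [h1, h2, riemannZeta_conj]
    simp

/-- The integral of `t ^ (σ - 1) ‖f t‖` controls the Mellin transform of `f` on closed strips. -/
lemma exists_norm_mellin_le_of_mem_strip {f : ℝ → ℂ} {a b : ℝ}
    (ha : MellinConvergent f a) (hb : MellinConvergent f b) :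
    ∃ K, 0 ≤ K ∧ ∀ s : ℂ, a ≤ s.re → s.re ≤ b → ‖mellin f s‖ ≤ K := by
  have key : ∀ (s : ℂ) (t : ℝ), 0 < t →
      ‖(t : ℂ) ^ (s - 1) • f t‖ = t ^ (s.re - 1) * ‖f t‖ := fun s t ht => by
    rw [norm_smul, norm_cpow_eq_rpow_re_of_pos ht, sub_re, one_re]
  refine ⟨(∫ t in Ioi (0 : ℝ), ‖(t : ℂ) ^ ((a : ℂ) - 1) • f t‖) +
    ∫ t in Ioi (0 : ℝ), ‖(t : ℂ) ^ ((b : ℂ) - 1) • f t‖,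
    add_nonneg (integral_nonneg fun _ => norm_nonneg _) (integral_nonneg fun _ => norm_nonneg _),
    fun s has hsb => ?_⟩
  rw [← integral_add ha.norm hb.norm, mellin]
  refine norm_integral_le_of_norm_le (ha.norm.add hb.norm) ?_
  filter_upwards [ae_restrict_mem measurableSet_Ioi] with t ht
  have ht' : 0 < t := ht
  simp only [key _ t ht', ofReal_re]
  rw [← add_mul]
  gcongr
  rcases le_total t 1 with h1 | h1
  · have := Real.rpow_le_rpow_of_exponent_ge ht' h1 (sub_le_sub_right has 1)
    have := Real.rpow_nonneg ht'.le (b - 1)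
    linarith
  · have := Real.rpow_le_rpow_of_exponent_le h1 (sub_le_sub_right hsb 1)
    have := Real.rpow_nonneg ht'.le (a - 1)
    linarith

lemma exists_norm_completedRiemannZeta₀_le (a b : ℝ) :
    ∃ K, 0 ≤ K ∧ ∀ s : ℂ, a ≤ s.re → s.re ≤ b → ‖completedRiemannZeta₀ s‖ ≤ K := by
  set P := HurwitzZeta.hurwitzEvenFEPair 0
  have hconv : ∀ s, MellinConvergent P.f_modif s := fun s =>
    (P.isStrongFEPair_toStrongFEPair.hasMellin s).1
  obtain ⟨K, hK0, hK⟩ := exists_norm_mellin_le_of_mem_strip (hconv (a / 2 : ℝ)) (hconv (b / 2 : ℝ))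
  refine ⟨K, hK0, fun s has hsb => ?_⟩
  have h1 : completedRiemannZeta₀ s = mellin P.f_modif (s / 2) / 2 := rfl
  have h2 : (s / 2).re = s.re / 2 := by simp
  have h3 := hK (s / 2) (by rw [h2]; linarith) (by rw [h2]; linarith)
  rw [h1, norm_div, norm_ofNat]
  linarith [norm_nonneg (mellin P.f_modif (s / 2))]

lemma norm_Gamma_le_Gamma_re {s : ℂ} (hs : 0 < s.re) : ‖Gamma s‖ ≤ Real.Gamma s.re := by
  rw [Gamma_eq_integral hs, Real.Gamma_eq_integral hs, GammaIntegral]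
  refine norm_integral_le_of_norm_le (Real.GammaIntegral_convergent hs) ?_
  filter_upwards [ae_restrict_mem measurableSet_Ioi] with t ht
  rw [norm_mul, norm_cpow_eq_rpow_re_of_pos ht, norm_real, Real.norm_eq_abs,
    abs_of_pos (Real.exp_pos _)]
  simp

lemma Gamma_le_rpow_self {x : ℝ} (hx : 2 ≤ x) : Real.Gamma x ≤ (x + 1) ^ (x + 1) := by
  have h1 : x ≤ ⌈x⌉₊ := Nat.le_ceil x
  have h2 : (⌈x⌉₊ : ℝ) < x + 1 := Nat.ceil_lt_add_one (by linarith)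
  have hc1 : (1 : ℝ) ≤ ⌈x⌉₊ := by linarith
  calc Real.Gamma x ≤ Real.Gamma (⌈x⌉₊ + 1) :=
        Real.Gamma_strictMonoOn_Ici.monotoneOn hx (by simp only [mem_Ici]; linarith) (by linarith)
    _ = (⌈x⌉₊.factorial : ℝ) := Real.Gamma_nat_eq_factorial _
    _ ≤ (⌈x⌉₊ : ℝ) ^ (⌈x⌉₊ : ℝ) := by
        rw [Real.rpow_natCast]
        exact_mod_cast Nat.factorial_le_pow _
    _ ≤ (⌈x⌉₊ : ℝ) ^ (x + 1) := Real.rpow_le_rpow_of_exponent_le hc1 h2.le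
    _ ≤ (x + 1) ^ (x + 1) := Real.rpow_le_rpow (by linarith) h2.le (by linarith)

lemma log_le_two_mul_sqrt {x : ℝ} (hx : 1 ≤ x) : Real.log x ≤ 2 * √x := by
  have h := Real.log_le_sub_one_of_pos (Real.sqrt_pos.mpr (by linarith : 0 < x))
  rw [Real.log_sqrt (by linarith)] at h
  linarith

lemma norm_riemannZeta_le_of_two_le_re {s : ℂ} (hs : 2 ≤ s.re) :
    ‖riemannZeta s‖ ≤ ∑' n : ℕ, 1 / ((n : ℝ) + 1) ^ 2 := by
  have hsum : Summable fun n : ℕ => 1 / ((n : ℝ) + 1) ^ 2 := by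
    have := (summable_nat_add_iff 1).mpr (Real.summable_one_div_nat_pow.mpr one_lt_two)
    simpa using this
  rw [zeta_eq_tsum_one_div_nat_add_one_cpow (by linarith)]
  refine tsum_of_norm_bounded hsum.hasSum fun n => ?_
  have hn : (0 : ℝ) < (n : ℝ) + 1 := by positivity
  have : ((n : ℂ) + 1) = (((n : ℝ) + 1 : ℝ) : ℂ) := by push_cast; rfl
  rw [norm_div, norm_one, this, norm_cpow_eq_rpow_re_of_pos hn]
  gcongr
  rw [← Real.rpow_natCast]
  exact Real.rpow_le_rpow_of_exponent_le (by linarith [n.cast_nonneg (α := ℝ)]) (by simpa using hs)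

lemma sq_le_exp_mul_sqrt {x : ℝ} (hx : 1 ≤ x) : x ^ 2 ≤ Real.exp (4 * (x * √x)) := by
  have h1 := log_le_two_mul_sqrt hx
  have h2 : √x ≤ x * √x := le_mul_of_one_le_left (Real.sqrt_nonneg _) hx
  calc x ^ 2 = Real.exp (2 * Real.log x) := by
        rw [mul_comm, Real.exp_mul, Real.exp_log (by linarith)]
        norm_num
    _ ≤ _ := Real.exp_le_exp.mpr (by linarith)

lemma exists_norm_xiE_le_of_re_nonneg :
    ∃ C, 0 < C ∧ ∀ s : ℂ, 0 ≤ s.re →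
      ‖xiE s‖ ≤ Real.exp (C * ((1 + ‖s‖) * √(1 + ‖s‖))) := by
  obtain ⟨K, hK0, hK⟩ := exists_norm_completedRiemannZeta₀_le 0 4
  set Z := ∑' n : ℕ, 1 / ((n : ℝ) + 1) ^ 2
  have hZ0 : 0 ≤ Z := tsum_nonneg fun n => by positivity
  refine ⟨6 + K + Z, by positivity, fun s hs => ?_⟩
  set x := 1 + ‖s‖ with hxdef
  have hx1 : 1 ≤ x := by linarith [norm_nonneg s]
  have hsx : ‖s‖ ≤ x := by linarith
  have hs1x : ‖s - 1‖ ≤ x := (norm_sub_le _ _).trans (by rw [norm_one, hxdef]; linarith)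
  have hprod : ‖s * (s - 1)‖ ≤ x ^ 2 := by
    rw [norm_mul, sq]
    gcongr
  have hsq1 : 1 ≤ √x := Real.one_le_sqrt.mpr hx1
  have hE : x ≤ x * √x := le_mul_of_one_le_right (by linarith) hsq1
  have hE1 : 1 ≤ x * √x := hx1.trans hE
  have hsq := sq_le_exp_mul_sqrt hx1
  rcases le_total s.re 4 with h4 | h4
  · calc ‖xiE s‖ ≤ ‖s * (s - 1)‖ * ‖completedRiemannZeta₀ s‖ + 1 := by
          rw [xiE]
          refine (norm_add_le _ _).trans (by rw [norm_mul, norm_one])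
      _ ≤ x ^ 2 * K + x ^ 2 := by
          gcongr
          · exact hK s hs h4
          · exact one_le_pow₀ hx1
      _ = x ^ 2 * (K + 1) := by ring
      _ ≤ Real.exp (4 * (x * √x)) * Real.exp K := by
          gcongr
          exact Real.add_one_le_exp K
      _ ≤ _ := by
          rw [← Real.exp_add]
          gcongr
          nlinarith
  · have h0 : s ≠ 0 := by
      rintro rfl
      simp at h4
      linarith
    have h1 : s ≠ 1 := by
      rintro rfl
      simp at h4
    have hre2 : (s / 2).re = s.re / 2 := by simp
    have hG : ‖Gamma (s / 2)‖ ≤ Real.exp (2 * (x * √x)) := by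
      have hy : s.re / 2 + 1 ≤ x := by
        have := (le_abs_self _).trans (abs_re_le_norm s)
        linarith
      calc ‖Gamma (s / 2)‖ ≤ Real.Gamma (s.re / 2) := by
            have := norm_Gamma_le_Gamma_re (s := s / 2) (by rw [hre2]; linarith)
            rwa [hre2] at this
        _ ≤ (s.re / 2 + 1) ^ (s.re / 2 + 1) := Gamma_le_rpow_self (by linarith)
        _ ≤ x ^ (s.re / 2 + 1) := Real.rpow_le_rpow (by linarith) hy (by linarith)
        _ ≤ x ^ x := Real.rpow_le_rpow_of_exponent_le hx1 hy
        _ = Real.exp (Real.log x * x) := Real.rpow_def_of_pos (by linarith) _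
        _ ≤ _ := by
            refine Real.exp_le_exp.mpr ?_
            nlinarith [mul_le_mul_of_nonneg_right (log_le_two_mul_sqrt hx1) (by linarith : 0 ≤ x)]
    have hpi : ‖(Real.pi : ℂ) ^ (-s / 2)‖ ≤ 1 := by
      rw [norm_cpow_eq_rpow_re_of_pos Real.pi_pos]
      refine Real.rpow_le_one_of_one_le_of_nonpos (by linarith [Real.two_le_pi]) ?_
      simp
      linarith
    have hGne : Gammaℝ s ≠ 0 := Gammaℝ_ne_zero_of_re_pos (by linarith)
    rw [← xi2_eq_xiE hGne, xi2, if_neg (by tauto)]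
    calc _ = ‖s * (s - 1)‖ * ‖(Real.pi : ℂ) ^ (-s / 2)‖ * ‖Gamma (s / 2)‖ * ‖riemannZeta s‖ := by
          simp only [norm_mul]
      _ ≤ Real.exp (4 * (x * √x)) * 1 * Real.exp (2 * (x * √x)) * Real.exp Z := by
          gcongr
          · exact hprod.trans hsq
          · exact (norm_riemannZeta_le_of_two_le_re (by linarith)).trans
              ((by linarith : Z ≤ Z + 1).trans (Real.add_one_le_exp Z))
      _ ≤ _ := by
          rw [mul_one, ← Real.exp_add, ← Real.exp_add]
          gcongr
          nlinarith

/-- The entire function `xiE` has order at most `3 / 2`. -/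
lemma exists_norm_xiE_le :
    ∃ C, 0 < C ∧ ∀ s : ℂ, ‖xiE s‖ ≤ Real.exp (C * ((2 + ‖s‖) * √(2 + ‖s‖))) := by
  obtain ⟨C, hC, h⟩ := exists_norm_xiE_le_of_re_nonneg
  refine ⟨C, hC, fun s => ?_⟩
  rcases le_total 0 s.re with hs | hs
  · refine (h s hs).trans ?_
    gcongr <;> norm_num
  · rw [← xiE_one_sub]
    refine (h (1 - s) (by simp; linarith)).trans ?_
    have : 1 + ‖1 - s‖ ≤ 2 + ‖s‖ := by
      have := norm_sub_le (1 : ℂ) s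
      rw [norm_one] at this
      linarith
    gcongr

/-- A nonvanishing function on a large disc whose logarithm has a critical point near the centre
has small logarithmic derivative near the centre. -/
lemma norm_deriv_div_le {g : ℂ → ℂ} {r B : ℝ} {c : ℂ} (hr : 16 ≤ r) (hB : 0 < B)
    (hg : DifferentiableOn ℂ g (ball 0 r)) (hne : ∀ s ∈ ball (0 : ℂ) r, g s ≠ 0) (hg0 : g 0 = 1)
    (hbound : ∀ s ∈ ball (0 : ℂ) r, ‖g s‖ ≤ Real.exp B) (hc : ‖c‖ ≤ 1) (hcrit : deriv g c = 0)
    {s : ℂ} (hs : ‖s‖ ≤ 2) : ‖deriv g s / g s‖ ≤ 192 * B / r ^ 2 := by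
  have hr0 : 0 < r := by linarith
  have hL : DifferentiableOn ℂ (fun s => deriv g s / g s) (ball 0 r) :=
    (hg.deriv isOpen_ball).div hg hne
  obtain ⟨l, hl0, hl⟩ := hL.isExactOn_ball.with_val_at 0 0
  have hld : DifferentiableOn ℂ l (ball 0 r) := fun z hz =>
    (hl z hz).differentiableAt.differentiableWithinAt
  have hexp : ∀ z ∈ ball (0 : ℂ) r, g z = exp (l z) := by
    intro z hz
    have hd : ∀ w ∈ ball (0 : ℂ) r, HasDerivAt (fun w => g w * exp (-l w)) 0 w := fun w hw => by
      have h1 := (hg.differentiableAt (isOpen_ball.mem_nhds hw)).hasDerivAt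
      have h2 := h1.mul (hl w hw).neg.cexp
      refine h2.congr_deriv ?_
      have h3 : g w * (deriv g w / g w) = deriv g w := mul_div_cancel₀ _ (hne w hw)
      linear_combination -exp (-l w) * h3
    have hconst := (convex_ball (0 : ℂ) r).is_const_of_fderivWithin_eq_zero (𝕜 := ℂ)
      (f := fun w => g w * exp (-l w))
      (fun w hw => (hd w hw).differentiableAt.differentiableWithinAt)
      (fun w hw => by
        rw [fderivWithin_of_isOpen isOpen_ball hw]
        ext
        simpa using (hd w hw).deriv) hz (mem_ball_self hr0)
    simp only [hg0, hl0, neg_zero, exp_zero, mul_one] at hconst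
    rw [exp_neg] at hconst
    field_simp at hconst
    exact hconst
  have hre : MapsTo l (ball 0 r) {z | z.re ≤ B} := fun z hz => by
    have := hbound z hz
    rw [hexp z hz, norm_exp] at this
    exact Real.exp_le_exp.mp this
  have hl_le : ∀ z : ℂ, ‖z‖ ≤ r / 2 → ‖l z‖ ≤ 2 * B := fun z hz => by
    have h := borelCaratheodory_zero hB hld hre hr0 (z := z) (by simp; linarith) hl0
    refine h.trans ?_
    rw [div_le_iff₀ (by linarith)]
    nlinarith [norm_nonneg z]
  have hsub : ∀ {z : ℂ} {t : ℝ}, ‖z‖ ≤ t → ∀ w ∈ sphere z t, ‖w‖ ≤ 2 * t := by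
    intro z t hz w hw
    have h1 : ‖w - z‖ = t := by simpa [dist_eq_norm] using hw
    have := norm_add_le (w - z) z
    rw [sub_add_cancel] at this
    linarith
  have hdiff : ∀ {z : ℂ} {t : ℝ}, ‖z‖ ≤ t → t ≤ r / 4 → closedBall z t ⊆ ball 0 r := by
    intro z t hz ht w hw
    have h1 : ‖w - z‖ ≤ t := by simpa [dist_eq_norm] using hw
    have := norm_add_le (w - z) z
    rw [sub_add_cancel] at this
    simp
    linarith
  have hl1 : ∀ z : ℂ, ‖z‖ ≤ r / 4 → ‖deriv l z‖ ≤ 8 * B / r := fun z hz => by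
    have := norm_deriv_le_of_forall_mem_sphere_norm_le (c := z) (R := r / 4) (by positivity)
      (hld.diffContOnCl_ball (hdiff hz le_rfl))
      (fun w hw => hl_le w (by linarith [hsub hz w hw]))
    refine this.trans (le_of_eq ?_)
    field_simp
    norm_num
  have hl2 : ∀ z : ℂ, ‖z‖ ≤ r / 8 → ‖deriv (deriv l) z‖ ≤ 64 * B / r ^ 2 := fun z hz => by
    have := norm_deriv_le_of_forall_mem_sphere_norm_le (c := z) (R := r / 8) (by positivity)
      ((hld.deriv isOpen_ball).diffContOnCl_ball (hdiff hz (by linarith)))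
      (fun w hw => hl1 w (by linarith [hsub hz w hw]))
    refine this.trans (le_of_eq ?_)
    field_simp
    norm_num
  have hball : ∀ z ∈ closedBall (0 : ℂ) 2, z ∈ ball (0 : ℂ) r := fun z hz => by
    simp at hz ⊢
    linarith
  have hmv := (convex_closedBall (0 : ℂ) 2).norm_image_sub_le_of_norm_deriv_le (f := deriv l)
    (C := 64 * B / r ^ 2) (x := c) (y := s)
    (fun z hz => (hld.deriv isOpen_ball).differentiableAt (isOpen_ball.mem_nhds (hball z hz)))
    (fun z hz => hl2 z (by simp at hz; linarith)) (by simp; linarith) (by simpa using hs)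
  have hc0 : deriv l c = 0 := by
    rw [(hl c (hball c (by simp; linarith))).deriv, hcrit, zero_div]
  rw [hc0, sub_zero, (hl s (hball s (by simpa using hs))).deriv] at hmv
  refine hmv.trans ?_
  have h3 : ‖s - c‖ ≤ 3 := (norm_sub_le _ _).trans (by linarith)
  calc 64 * B / r ^ 2 * ‖s - c‖ ≤ 64 * B / r ^ 2 * 3 := by gcongr
    _ = _ := by ring

/-- Dividing out the zeros of an entire function at finitely many points. -/
lemma exists_eq_prod_pow_mul {f : ℂ → ℂ} (hf : Differentiable ℂ f)
    (hord : ∀ z, analyticOrderAt f z ≠ ⊤) (F : Finset ℂ) :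
    ∃ g : ℂ → ℂ, Differentiable ℂ g ∧
      (∀ s, f s = (∏ ρ ∈ F, (s - ρ) ^ analyticOrderNatAt f ρ) * g s) ∧ ∀ ρ ∈ F, g ρ ≠ 0 := by
  classical
  induction F using Finset.induction_on with
  | empty => exact ⟨f, hf, by simp, by simp⟩
  | insert a F ha ih =>
    obtain ⟨g, hg, hfg, hgne⟩ := ih
    obtain ⟨q, hq, hqa, hqev⟩ := ((hf.analyticAt a).analyticOrderNatAt_eq_iff (hord a)).mp rfl
    set k := analyticOrderNatAt f a
    set P : ℂ → ℂ := fun s => ∏ ρ ∈ F, (s - ρ) ^ analyticOrderNatAt f ρ with hP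
    have hPd : Differentiable ℂ P := by
      simp only [hP]
      fun_prop
    have hPa : P a ≠ 0 := by
      rw [hP, Finset.prod_ne_zero_iff]
      intro ρ hρ
      exact pow_ne_zero _ (sub_ne_zero.mpr fun h => ha (h ▸ hρ))
    have hPev : ∀ᶠ s in 𝓝 a, P s ≠ 0 := hPd.continuous.continuousAt.eventually_ne hPa
    set h : ℂ → ℂ := fun s => if s = a then q a / P a else g s / (s - a) ^ k with hh
    have hha : h =ᶠ[𝓝 a] fun s => q s / P s := by
      filter_upwards [hqev, hPev] with s hs hPs
      by_cases hsa : s = a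
      · simp [hh, hsa]
      · have hsa' : (s - a) ^ k ≠ 0 := pow_ne_zero _ (sub_ne_zero.mpr hsa)
        rw [hfg s, smul_eq_mul] at hs
        simp only [hh, if_neg hsa]
        rw [div_eq_div_iff hsa' hPs, mul_comm, hP, hs, mul_comm]
    have hhd : Differentiable ℂ h := by
      intro s
      by_cases hsa : s = a
      · rw [hsa]
        exact (hq.differentiableAt.div (hPd a) hPa).congr_of_eventuallyEq hha
      · have : h =ᶠ[𝓝 s] fun s => g s / (s - a) ^ k := by
          filter_upwards [isOpen_ne.mem_nhds hsa] with z hz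
          simp only [hh, if_neg hz]
        refine DifferentiableAt.congr_of_eventuallyEq ?_ this
        exact (hg s).div (by fun_prop) (pow_ne_zero _ (sub_ne_zero.mpr hsa))
    have hgh : ∀ s, g s = (s - a) ^ k * h s := by
      intro s
      by_cases hsa : s = a
      · have h1 := hqev.self_of_nhds
        rw [hfg a, smul_eq_mul] at h1
        have : P a * g a = (a - a) ^ k * q a := h1
        rw [hsa, eq_comm]
        simp only [hh, if_true]
        field_simp
        linear_combination -this
      · simp only [hh, if_neg hsa]
        have hsa' : (s - a) ^ k ≠ 0 := pow_ne_zero _ (sub_ne_zero.mpr hsa)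
        field_simp
    refine ⟨h, hhd, fun s => ?_, fun ρ hρ => ?_⟩
    · rw [hfg s, hgh s, Finset.prod_insert ha]
      ring
    · rcases Finset.mem_insert.mp hρ with rfl | hρ
      · rw [hha.self_of_nhds]
        exact div_ne_zero hqa hPa
      · intro h0
        refine hgne ρ hρ ?_
        rw [hgh, h0, mul_zero]

lemma finite_zeros_inter_of_isCompact {f : ℂ → ℂ} (hf : Differentiable ℂ f)
    (hord : ∀ z, analyticOrderAt f z ≠ ⊤) {K : Set ℂ} (hK : IsCompact K) :
    ({z | f z = 0} ∩ K).Finite := by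
  by_contra hinf
  obtain ⟨x, -, hx⟩ := Set.Infinite.exists_accPt_of_subset_isCompact hinf hK inter_subset_right
  rw [accPt_iff_frequently_nhdsNE] at hx
  rcases (hf.analyticAt x).eventually_eq_zero_or_eventually_ne_zero with h | h
  · exact hord x (analyticOrderAt_eq_top.mpr h)
  · exact hx (h.mono fun z hz hz' => hz hz'.1)

/-- The zeros of `xiE` in the closed disc of radius `R` around `1 / 2`. -/
noncomputable def xiZeros (R : ℝ) : Finset ℂ :=
  (finite_zeros_inter_of_isCompact differentiable_xiE analyticOrderAt_xiE_ne_top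
    (isCompact_closedBall (1 / 2 : ℂ) R)).toFinset

lemma mem_xiZeros {R : ℝ} {ρ : ℂ} : ρ ∈ xiZeros R ↔ xiE ρ = 0 ∧ ‖ρ - 1 / 2‖ ≤ R := by
  simp [xiZeros, dist_eq_norm]

lemma one_sub_mem_xiZeros {R : ℝ} {ρ : ℂ} (h : ρ ∈ xiZeros R) : 1 - ρ ∈ xiZeros R := by
  rw [mem_xiZeros] at h ⊢
  refine ⟨(xiE_one_sub ρ).trans h.1, ?_⟩
  rw [show 1 - ρ - 1 / 2 = -(ρ - 1 / 2) by ring, norm_neg]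
  exact h.2

lemma ne_zero_of_xiE_eq_zero {ρ : ℂ} (h : xiE ρ = 0) : ρ ≠ 0 := fun h0 => by
  simp [h0, xiE_zero] at h

lemma ne_one_of_xiE_eq_zero {ρ : ℂ} (h : xiE ρ = 0) : ρ ≠ 1 := fun h0 => by
  simp [h0, xiE_one] at h

lemma prod_xiZeros_one_sub (R : ℝ) (f : ℂ → ℂ) :
    ∏ ρ ∈ xiZeros R, f (1 - ρ) = ∏ ρ ∈ xiZeros R, f ρ :=
  Finset.prod_nbij' (fun ρ => 1 - ρ) (fun ρ => 1 - ρ) (fun _ => one_sub_mem_xiZeros)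
    (fun _ => one_sub_mem_xiZeros) (by simp) (by simp) (by simp)

lemma sum_xiZeros_one_sub (R : ℝ) (f : ℂ → ℂ) :
    ∑ ρ ∈ xiZeros R, f (1 - ρ) = ∑ ρ ∈ xiZeros R, f ρ :=
  Finset.sum_nbij' (fun ρ => 1 - ρ) (fun ρ => 1 - ρ) (fun _ => one_sub_mem_xiZeros)
    (fun _ => one_sub_mem_xiZeros) (by simp) (by simp) (by simp)

/-- The polynomial with constant term `1` carrying the zeros of `xiE` of modulus at most `R`. -/
noncomputable def xiProd (R : ℝ) (s : ℂ) : ℂ := ∏ ρ ∈ xiZeros R, (1 - s / ρ) ^ xiOrder ρ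

lemma differentiable_xiProd (R : ℝ) : Differentiable ℂ (xiProd R) := by
  unfold xiProd
  fun_prop

lemma xiProd_zero (R : ℝ) : xiProd R 0 = 1 := by simp [xiProd]

lemma xiProd_ne_zero {R : ℝ} {s : ℂ} (hs : s ∉ xiZeros R) : xiProd R s ≠ 0 := by
  refine Finset.prod_ne_zero_iff.mpr fun ρ hρ => pow_ne_zero _ fun h => hs ?_
  have h0 := ne_zero_of_xiE_eq_zero (mem_xiZeros.mp hρ).1
  rwa [(div_eq_one_iff_eq h0).mp (sub_eq_zero.mp h).symm]

lemma xiProd_one_sub (R : ℝ) (s : ℂ) : xiProd R (1 - s) = xiProd R 1 * xiProd R s := by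
  have h := prod_xiZeros_one_sub R fun ρ => (1 - s / ρ) ^ xiOrder ρ
  rw [xiProd, xiProd, xiProd, ← h, ← Finset.prod_mul_distrib]
  refine Finset.prod_congr rfl fun ρ hρ => ?_
  have h0 := ne_zero_of_xiE_eq_zero (mem_xiZeros.mp hρ).1
  have h1 := sub_ne_zero.mpr (ne_one_of_xiE_eq_zero (mem_xiZeros.mp hρ).1).symm
  rw [xiOrder_one_sub, ← mul_pow]
  congr 1
  field_simp
  ring

lemma one_le_norm_xiProd {R : ℝ} {s : ℂ} (hR : 1 ≤ R) (hs : 4 * R ≤ ‖s - 1 / 2‖) :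
    1 ≤ ‖xiProd R s‖ := by
  rw [xiProd, norm_prod]
  refine Finset.one_le_prod fun ρ hρ => ?_
  rw [norm_pow]
  refine one_le_pow₀ ?_
  have h := mem_xiZeros.mp hρ
  have h0 := ne_zero_of_xiE_eq_zero h.1
  rw [show 1 - s / ρ = (ρ - s) / ρ by field_simp, norm_div, one_le_div (norm_pos_iff.mpr h0)]
  have h1 : ‖ρ‖ ≤ ‖ρ - 1 / 2‖ + ‖(1 / 2 : ℂ)‖ := by
    simpa using norm_add_le (ρ - 1 / 2) (1 / 2)
  have h2 : ‖s - 1 / 2‖ ≤ ‖ρ - 1 / 2‖ + ‖ρ - s‖ := by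
    rw [show s - 1 / 2 = (ρ - 1 / 2) - (ρ - s) by ring]
    exact norm_sub_le _ _
  norm_num at h1 h2 h hs
  linarith [h.2]

/-- The cofactor of `xiProd R` in `xiE`. -/
lemma exists_xiE_eq_xiProd_mul (R : ℝ) :
    ∃ g : ℂ → ℂ, Differentiable ℂ g ∧ (∀ s, xiE s = xiProd R s * g s) ∧
      (∀ s, ‖s - 1 / 2‖ ≤ R → g s ≠ 0) := by
  obtain ⟨g, hg, hfac, hne⟩ := exists_eq_prod_pow_mul differentiable_xiE
    analyticOrderAt_xiE_ne_top (xiZeros R)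
  set c : ℂ := ∏ ρ ∈ xiZeros R, (-ρ) ^ xiOrder ρ with hc
  have hc0 : c ≠ 0 := Finset.prod_ne_zero_iff.mpr fun ρ hρ =>
    pow_ne_zero _ (neg_ne_zero.mpr (ne_zero_of_xiE_eq_zero (mem_xiZeros.mp hρ).1))
  have hP : ∀ s, ∏ ρ ∈ xiZeros R, (s - ρ) ^ analyticOrderNatAt xiE ρ = c * xiProd R s := by
    intro s
    rw [hc, xiProd, ← Finset.prod_mul_distrib]
    refine Finset.prod_congr rfl fun ρ hρ => ?_
    have h0 := ne_zero_of_xiE_eq_zero (mem_xiZeros.mp hρ).1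
    rw [← xiOrder_eq, ← mul_pow]
    congr 1
    field_simp
    ring
  refine ⟨fun s => c * g s, by fun_prop, fun s => ?_, fun s hs => mul_ne_zero hc0 fun h => ?_⟩
  · rw [hfac, hP]
    ring
  · have h0 : xiE s = 0 := by rw [hfac, h, mul_zero]
    exact hne s (mem_xiZeros.mpr ⟨h0, hs⟩) h

lemma deriv_cofactor_half_eq_zero {R : ℝ} (hR : 0 ≤ R) {g : ℂ → ℂ} (hg : Differentiable ℂ g)
    (hfac : ∀ s, xiE s = xiProd R s * g s) (hne : ∀ s, ‖s - 1 / 2‖ ≤ R → g s ≠ 0) :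
    deriv g (1 / 2) = 0 := by
  have hsymm : (fun s => xiProd R 1 * g (1 - s)) = g := by
    refine Continuous.ext_on ((xiZeros R).finite_toSet.countable.dense_compl ℂ)
      (by have := hg.continuous; fun_prop) hg.continuous fun s hs => ?_
    have h1 := xiE_one_sub s
    rw [hfac, hfac, xiProd_one_sub] at h1
    refine mul_left_cancel₀ (xiProd_ne_zero (R := R) (s := s) (by simpa using hs)) ?_
    linear_combination h1
  have hval := congrFun hsymm (1 / 2)
  have hhalf : (1 : ℂ) - 1 / 2 = 1 / 2 := by norm_num
  simp only [hhalf] at hval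
  have h1 : xiProd R 1 = 1 :=
    mul_right_cancel₀ (hne (1 / 2) (by simpa using hR)) (hval.trans (one_mul _).symm)
  have hd : HasDerivAt g (-deriv g (1 / 2)) (1 / 2) := by
    have h2 : HasDerivAt g (deriv g (1 / 2)) (1 - 1 / 2) := by
      rw [hhalf]
      exact (hg _).hasDerivAt
    have h3 := h2.comp_const_sub 1 (1 / 2)
    simp only [h1, one_mul] at hsymm
    rwa [hsymm] at h3
  have := hd.deriv
  linear_combination this / 2

lemma norm_cofactor_le {R B : ℝ} (hR : 1 ≤ R) {g : ℂ → ℂ} (hg : Differentiable ℂ g)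
    (hfac : ∀ s, xiE s = xiProd R s * g s) (hB : ∀ s, ‖s‖ ≤ 4 * R + 1 → ‖xiE s‖ ≤ B)
    {s : ℂ} (hs : ‖s - 1 / 2‖ ≤ 4 * R) : ‖g s‖ ≤ B := by
  refine norm_le_of_forall_mem_frontier_norm_le (U := ball (1 / 2 : ℂ) (4 * R)) isBounded_ball
    hg.diffContOnCl (fun z hz => ?_) ?_
  · rw [frontier_ball _ (by positivity)] at hz
    have hz' : ‖z - 1 / 2‖ = 4 * R := by simpa [dist_eq_norm] using hz
    have h1 := one_le_norm_xiProd hR hz'.ge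
    have h2 : ‖z‖ ≤ ‖z - 1 / 2‖ + ‖(1 / 2 : ℂ)‖ := by
      simpa using norm_add_le (z - 1 / 2) (1 / 2)
    have h3 := hB z (by norm_num at h2 hz' ⊢; linarith)
    rw [hfac, norm_mul] at h3
    nlinarith [norm_nonneg (g z)]
  · rw [closure_ball _ (by positivity)]
    simpa [dist_eq_norm] using hs

/-- The logarithmic derivative of the cofactor of `xiProd R` tends to `0` as `R → ∞`. -/
lemma exists_cofactor_forall_norm_le {ε : ℝ} (hε : 0 < ε) :
    ∀ᶠ R : ℝ in atTop, ∃ g : ℂ → ℂ, Differentiable ℂ g ∧ (∀ s, xiE s = xiProd R s * g s) ∧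
      (∀ s, ‖s - 1 / 2‖ ≤ R → g s ≠ 0) ∧ ∀ s, ‖s‖ ≤ 2 → ‖deriv g s / g s‖ ≤ ε := by
  obtain ⟨C, hC, hbound⟩ := exists_norm_xiE_le
  have hlim : ∀ᶠ R : ℝ in atTop,
      192 * (C * ((2 + (4 * R + 1)) * √(2 + (4 * R + 1)))) / (R - 1) ^ 2 ≤ ε := by
    filter_upwards [eventually_ge_atTop (2 : ℝ),
      eventually_ge_atTop ((192 * C * 6 * 3 * 4 / ε) ^ 2)] with R hR hR'
    have h1 : √(2 + (4 * R + 1)) ≤ 3 * √R := by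
      rw [Real.sqrt_le_left (by positivity), mul_pow, Real.sq_sqrt (by linarith)]
      linarith
    have h2 : 192 * C * 6 * 3 * 4 / ε ≤ √R := Real.le_sqrt_of_sq_le hR'
    rw [div_le_iff₀ hε] at h2
    have h3 : √R * √R = R := Real.mul_self_sqrt (by linarith)
    rw [div_le_iff₀ (by nlinarith)]
    calc 192 * (C * ((2 + (4 * R + 1)) * √(2 + (4 * R + 1))))
        ≤ 192 * (C * ((6 * R) * (3 * √R))) := by
          gcongr
          linarith
      _ = (192 * C * 6 * 3 * 4) * √R * R / 4 := by ring
      _ ≤ (√R * ε) * √R * R / 4 := by gcongr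
      _ = ε * (R ^ 2 / 4) := by linear_combination ε * R / 4 * h3
      _ ≤ ε * (R - 1) ^ 2 := by
          gcongr
          nlinarith
  filter_upwards [hlim, eventually_ge_atTop (17 : ℝ)] with R hR hR17
  obtain ⟨g, hg, hfac, hne⟩ := exists_xiE_eq_xiProd_mul R
  have hsub : ∀ s ∈ ball (0 : ℂ) (R - 1), ‖s - 1 / 2‖ ≤ R := fun s hs => by
    have := norm_sub_le s (1 / 2)
    norm_num at this hs ⊢
    linarith
  refine ⟨g, hg, hfac, hne, fun s hs => (norm_deriv_div_le (r := R - 1) (c := 1 / 2) (by linarith)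
    (B := C * ((2 + (4 * R + 1)) * √(2 + (4 * R + 1)))) (by positivity) hg.differentiableOn
    (fun s hs => hne s (hsub s hs)) ?_ (fun s hs => ?_) (by norm_num)
    (deriv_cofactor_half_eq_zero (by linarith) hg hfac hne) hs).trans hR⟩
  · simpa [xiE_zero, xiProd_zero] using (hfac 0).symm
  · refine norm_cofactor_le (by linarith) hg hfac (fun w hw => (hbound w).trans ?_)
      ((hsub s hs).trans (by linarith))
    gcongr

/-- The summand of Li's formula. -/
noncomputable def liTerm (n : ℕ) (ρ : ℂ) : ℂ := 1 - (1 - 1 / ρ) ^ n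

lemma tendsto_one_div_one_sub : Tendsto (fun z : ℂ => 1 / (1 - z)) (𝓝 0) (𝓝 1) := by
  have : ContinuousAt (fun z : ℂ => 1 / (1 - z)) 0 := by fun_prop (disch := simp)
  simpa using this.tendsto

lemma PhiKL_eventuallyEq : PhiKL =ᶠ[𝓝 0] fun z => log (xiE (1 / (1 - z))) := by
  filter_upwards [tendsto_one_div_one_sub.eventually
    (eventually_nhds_xi2_eq_xiE (ρ := 1) (Or.inl (by simp)))] with z hz
  rw [PhiKL, hz]

lemma eventually_xiE_mem_slitPlane : ∀ᶠ z : ℂ in 𝓝 0, xiE (1 / (1 - z)) ∈ slitPlane := by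
  have : Tendsto (fun z : ℂ => xiE (1 / (1 - z))) (𝓝 0) (𝓝 1) := by
    simpa [Function.comp_def, xiE_one] using
      (differentiable_xiE 1).continuousAt.tendsto.comp tendsto_one_div_one_sub
  exact this.eventually (isOpen_slitPlane.mem_nhds one_mem_slitPlane)

lemma eventually_deriv_PhiKL :
    ∀ᶠ z : ℂ in 𝓝 0, deriv PhiKL z = logDeriv xiE (1 / (1 - z)) * (1 / (1 - z) ^ 2) := by
  filter_upwards [PhiKL_eventuallyEq.eventuallyEq_nhds, eventually_xiE_mem_slitPlane,
    isOpen_ne.mem_nhds (zero_ne_one (α := ℂ))] with z hz hslit h1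
  have h1' : 1 - z ≠ 0 := sub_ne_zero.mpr (Ne.symm h1)
  have hinv : HasDerivAt (fun z : ℂ => 1 / (1 - z)) (1 / (1 - z) ^ 2) z := by
    simpa using ((hasDerivAt_id z).const_sub 1).fun_inv h1'
  have h2 : HasDerivAt (fun z : ℂ => xiE (1 / (1 - z)))
      (deriv xiE (1 / (1 - z)) * (1 / (1 - z) ^ 2)) z :=
    HasDerivAt.comp (h₂ := xiE) z (differentiable_xiE (1 / (1 - z))).hasDerivAt hinv
  rw [hz.deriv_eq, logDeriv_apply, (h2.clog hslit).deriv]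
  ring

lemma logDeriv_xiE_eq {R : ℝ} {g : ℂ → ℂ} (hg : Differentiable ℂ g)
    (hfac : ∀ s, xiE s = xiProd R s * g s) {s : ℂ} (hs : xiE s ≠ 0) :
    logDeriv xiE s = (∑ ρ ∈ xiZeros R, xiOrder ρ * (1 / (s - ρ))) + logDeriv g s := by
  have hsne : xiProd R s * g s ≠ 0 := hfac s ▸ hs
  have hne : ∀ ρ ∈ xiZeros R, 1 - s / ρ ≠ 0 ∧ s - ρ ≠ 0 ∧ ρ ≠ 0 := fun ρ hρ => by
    have h0 := ne_zero_of_xiE_eq_zero (mem_xiZeros.mp hρ).1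
    have h1 : s ≠ ρ := fun h => hs (h ▸ (mem_xiZeros.mp hρ).1)
    exact ⟨fun h => h1 ((div_eq_one_iff_eq h0).mp (sub_eq_zero.mp h).symm), sub_ne_zero.mpr h1, h0⟩
  rw [show xiE = fun s => xiProd R s * g s from funext hfac,
    logDeriv_mul s (left_ne_zero_of_mul hsne) (right_ne_zero_of_mul hsne)
      (differentiable_xiProd R s) (hg s)]
  congr 1
  refine (logDeriv_prod (f := fun ρ s => (1 - s / ρ) ^ xiOrder ρ)
    (fun ρ hρ => pow_ne_zero _ (hne ρ hρ).1) (fun ρ _ => by fun_prop)).trans ?_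
  refine Finset.sum_congr rfl fun ρ hρ => ?_
  obtain ⟨h1, h2, h3⟩ := hne ρ hρ
  rw [logDeriv_fun_pow (by fun_prop), logDeriv_apply]
  have hd : deriv (fun s : ℂ => 1 - s / ρ) s = -(1 / ρ) := by simp
  rw [hd]
  congr 1
  rw [div_eq_div_iff h1 h2]
  field_simp
  ring

lemma eventually_one_sub_mul_ne_zero (a : ℂ) : ∀ᶠ z : ℂ in 𝓝 0, 1 - a * z ≠ 0 :=
  ContinuousAt.eventually_ne (by fun_prop) (by simp)

lemma iteratedDeriv_div_one_sub_mul_zero (a : ℂ) (k : ℕ) :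
    iteratedDeriv k (fun z : ℂ => a / (1 - a * z)) 0 = k.factorial * a ^ (k + 1) := by
  have h : iteratedDeriv k (fun z : ℂ => a / (1 - a * z)) =ᶠ[𝓝 0]
      fun z => k.factorial * a ^ (k + 1) * ((1 - a * z) ^ (k + 1))⁻¹ := by
    induction k with
    | zero =>
      refine Eventually.of_forall fun z => ?_
      simp [div_eq_mul_inv]
    | succ k ih =>
      filter_upwards [ih.eventuallyEq_nhds, eventually_one_sub_mul_ne_zero a] with z hz hne
      rw [iteratedDeriv_succ, hz.deriv_eq]
      have h1 : HasDerivAt (fun z : ℂ => 1 - a * z) (-a) z := by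
        simpa using ((hasDerivAt_id z).const_mul a).const_sub 1
      have h2 := ((h1.fun_pow (k + 1)).fun_inv (pow_ne_zero _ hne)).const_mul
        ((k.factorial : ℂ) * a ^ (k + 1))
      rw [h2.deriv, Nat.factorial_succ]
      push_cast
      field_simp
      ring
  simpa using h.self_of_nhds

lemma contDiffAt_div_one_sub_mul (a : ℂ) (k : ℕ) :
    ContDiffAt ℂ k (fun z : ℂ => a / (1 - a * z)) 0 := by
  refine ContDiffAt.div (by fun_prop) (by fun_prop) (by simp)

lemma iteratedDeriv_deriv_PhiKL_eq {R : ℝ} {g : ℂ → ℂ} (hg : Differentiable ℂ g)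
    (hfac : ∀ s, xiE s = xiProd R s * g s) (k : ℕ)
    (hh : ContDiffAt ℂ k (fun z : ℂ => logDeriv g (1 / (1 - z)) * (1 / (1 - z) ^ 2)) 0) :
    iteratedDeriv k (deriv PhiKL) 0 =
      k.factorial * (∑ ρ ∈ xiZeros R, xiOrder ρ * liTerm (k + 1) ρ) +
        iteratedDeriv k (fun z : ℂ => logDeriv g (1 / (1 - z)) * (1 / (1 - z) ^ 2)) 0 := by
  have hgerm : deriv PhiKL =ᶠ[𝓝 0] fun z =>
      (∑ ρ ∈ xiZeros R, xiOrder ρ *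
        (1 / (1 - 1 * z) - (ρ / (ρ - 1)) / (1 - ρ / (ρ - 1) * z))) +
      logDeriv g (1 / (1 - z)) * (1 / (1 - z) ^ 2) := by
    have hall : ∀ᶠ z : ℂ in 𝓝 0, ∀ ρ ∈ xiZeros R, 1 - ρ / (ρ - 1) * z ≠ 0 :=
      (eventually_all_finset _).mpr fun ρ _ => eventually_one_sub_mul_ne_zero _
    filter_upwards [eventually_deriv_PhiKL, eventually_xiE_mem_slitPlane, hall,
      isOpen_ne.mem_nhds (zero_ne_one (α := ℂ))] with z hz hslit hne h1
    rw [hz, logDeriv_xiE_eq hg hfac (slitPlane_ne_zero hslit), add_mul, Finset.sum_mul]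
    congr 1
    refine Finset.sum_congr rfl fun ρ hρ => ?_
    have h1' : 1 - z ≠ 0 := sub_ne_zero.mpr (Ne.symm h1)
    have h2 := sub_ne_zero.mpr (ne_one_of_xiE_eq_zero (mem_xiZeros.mp hρ).1)
    have h3 := hne ρ hρ
    have h4 : ρ - 1 - ρ * z ≠ 0 := by
      intro h
      apply h3
      field_simp
      rw [h, mul_zero]
    have h5 : 1 - (1 - z) * ρ ≠ 0 := by
      intro h
      apply h4
      linear_combination -h
    rw [show 1 / (1 - z) - ρ = (1 - (1 - z) * ρ) / (1 - z) by field_simp,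
      show 1 - ρ / (ρ - 1) * z = -(1 - (1 - z) * ρ) / (ρ - 1) by field_simp; ring, one_mul]
    field_simp
    ring
  rw [hgerm.iteratedDeriv_eq, iteratedDeriv_fun_add ?_ hh, iteratedDeriv_fun_sum ?_,
    Finset.mul_sum]
  · congr 1
    conv_rhs => rw [← Finset.mul_sum, ← sum_xiZeros_one_sub, Finset.mul_sum]
    refine Finset.sum_congr rfl fun ρ hρ => ?_
    have h2 := sub_ne_zero.mpr (ne_one_of_xiE_eq_zero (mem_xiZeros.mp hρ).1)
    have h2' := sub_ne_zero.mpr (ne_one_of_xiE_eq_zero (mem_xiZeros.mp hρ).1).symm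
    rw [iteratedDeriv_const_mul_field, iteratedDeriv_fun_sub (contDiffAt_div_one_sub_mul 1 k)
      (contDiffAt_div_one_sub_mul _ k), iteratedDeriv_div_one_sub_mul_zero,
      iteratedDeriv_div_one_sub_mul_zero, xiOrder_one_sub, liTerm,
      show 1 - 1 / (1 - ρ) = ρ / (ρ - 1) by field_simp; ring, one_pow]
    ring
  · intro ρ _
    exact contDiffAt_const.mul ((contDiffAt_div_one_sub_mul 1 k).sub
      (contDiffAt_div_one_sub_mul _ k))
  · exact ContDiffAt.sum fun ρ _ => contDiffAt_const.mul ((contDiffAt_div_one_sub_mul 1 k).sub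
      (contDiffAt_div_one_sub_mul _ k))

/-- Li's formula with the zeros grouped by their distance to `1 / 2`. -/
lemma tendsto_sum_xiZeros (k : ℕ) :
    Tendsto (fun R : ℝ => ∑ ρ ∈ xiZeros R, xiOrder ρ * liTerm (k + 1) ρ) atTop
      (𝓝 (iteratedDeriv (k + 1) PhiKL 0 / k.factorial)) := by
  rw [Metric.tendsto_nhds]
  intro ε hε
  have hε' : 0 < ε / (4 * 4 ^ k) := by positivity
  filter_upwards [exists_cofactor_forall_norm_le hε', eventually_ge_atTop (3 : ℝ)] with R hR hR3
  obtain ⟨g, hg, hfac, hne, hlog⟩ := hR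
  have hz1 : ∀ z : ℂ, ‖z‖ ≤ 1 / 4 → 3 / 4 ≤ ‖1 - z‖ := fun z hz => by
    have := norm_sub_norm_le 1 z
    rw [norm_one] at this
    linarith
  have hz2 : ∀ z : ℂ, ‖z‖ ≤ 1 / 4 → ‖1 / (1 - z)‖ ≤ 4 / 3 := fun z hz => by
    rw [norm_div, norm_one, div_le_iff₀ (by linarith [hz1 z hz])]
    linarith [hz1 z hz]
  set h : ℂ → ℂ := fun z => logDeriv g (1 / (1 - z)) * (1 / (1 - z) ^ 2) with hdef
  have hdiff : ∀ z : ℂ, ‖z‖ ≤ 1 / 4 → DifferentiableAt ℂ h z := fun z hz => by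
    have h0 : 1 - z ≠ 0 := norm_pos_iff.mp (by linarith [hz1 z hz])
    have hgne : g (1 / (1 - z)) ≠ 0 := hne _ <| (norm_sub_le _ _).trans <| by
      have := hz2 z hz
      norm_num at this ⊢
      linarith
    have hinv : DifferentiableAt ℂ (fun z : ℂ => 1 / (1 - z)) z := by fun_prop (disch := exact h0)
    have hL : DifferentiableAt ℂ (logDeriv g) (1 / (1 - z)) :=
      (hg.deriv _).div (hg _) hgne
    exact (hL.comp z hinv).mul (by fun_prop (disch := exact pow_ne_zero _ h0))
  have hcont : ContDiffAt ℂ k h 0 := by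
    have hon : DifferentiableOn ℂ h (ball 0 (1 / 4)) := fun z hz =>
      (hdiff z (by simpa using (mem_ball_zero_iff.mp hz).le)).differentiableWithinAt
    exact (hon.analyticAt (ball_mem_nhds 0 (by norm_num))).contDiffAt
  have hbound : ∀ z ∈ sphere (0 : ℂ) (1 / 4), ‖h z‖ ≤ ε / (4 * 4 ^ k) * 2 := fun z hz => by
    have hz' : ‖z‖ ≤ 1 / 4 := (mem_sphere_zero_iff_norm.mp hz).le
    rw [hdef, norm_mul]
    refine mul_le_mul (hlog _ (by linarith [hz2 z hz'])) ?_ (norm_nonneg _) hε'.le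
    rw [← one_div_pow, norm_pow]
    nlinarith [hz2 z hz', norm_nonneg (1 / (1 - z))]
  have hC := norm_iteratedDeriv_le_of_forall_mem_sphere_norm_le k (by norm_num)
    (DifferentiableOn.diffContOnCl_ball (U := closedBall 0 (1 / 4))
      (fun z hz => (hdiff z (by simpa using hz)).differentiableWithinAt) subset_rfl) hbound
  have heq := iteratedDeriv_deriv_PhiKL_eq hg hfac k hcont
  rw [← iteratedDeriv_succ'] at heq
  have hk : (k.factorial : ℂ) ≠ 0 := Nat.cast_ne_zero.mpr k.factorial_ne_zero
  have hk' : (0 : ℝ) < k.factorial := Nat.cast_pos.mpr k.factorial_pos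
  rw [dist_comm, dist_eq_norm, heq, add_div, mul_div_cancel_left₀ _ hk, add_sub_cancel_left,
    norm_div, norm_natCast, div_lt_iff₀ hk']
  refine hC.trans_lt ?_
  rw [one_div, inv_pow, div_inv_eq_mul]
  have h4 : (4 : ℝ) ^ k ≠ 0 := by positivity
  calc (k.factorial : ℝ) * (ε / (4 * 4 ^ k) * 2) * 4 ^ k = ε * k.factorial / 2 := by
        field_simp
        ring
    _ < ε * k.factorial := half_lt_self (by positivity)

lemma xiZeros_mono : Monotone xiZeros := fun R R' h ρ hρ => by
  rw [mem_xiZeros] at hρ ⊢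
  exact ⟨hρ.1, hρ.2.trans h⟩

/-- The zeros of `xiE` of height at most `T`. -/
noncomputable def xiZerosHeight (T : ℝ) : Finset ℂ := (xiZeros (T + 1)).filter fun ρ => |ρ.im| ≤ T

lemma mem_xiZerosHeight {T : ℝ} {ρ : ℂ} : ρ ∈ xiZerosHeight T ↔ xiE ρ = 0 ∧ |ρ.im| ≤ T := by
  rw [xiZerosHeight, Finset.mem_filter, mem_xiZeros]
  refine ⟨fun h => ⟨h.1.1, h.2⟩, fun h => ⟨⟨h.1, ?_⟩, h.2⟩⟩
  have h1 := re_pos_of_xiE_eq_zero h.1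
  have h2 := re_lt_one_of_xiE_eq_zero h.1
  have h3 := norm_le_abs_re_add_abs_im (ρ - 1 / 2)
  have h4 : |(ρ - 1 / 2).re| ≤ 1 := by
    rw [abs_le]
    constructor <;> norm_num <;> linarith
  have h5 : (ρ - 1 / 2).im = ρ.im := by simp
  rw [h5] at h3
  linarith [h.2]

lemma xiZerosHeight_mono : Monotone xiZerosHeight := fun T T' h ρ hρ => by
  rw [mem_xiZerosHeight] at hρ ⊢
  exact ⟨hρ.1, hρ.2.trans h⟩

lemma one_sub_mem_xiZerosHeight {T : ℝ} {ρ : ℂ} (h : ρ ∈ xiZerosHeight T) :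
    1 - ρ ∈ xiZerosHeight T := by
  rw [mem_xiZerosHeight] at h ⊢
  exact ⟨(xiE_one_sub ρ).trans h.1, by simpa using h.2⟩

/-- The contribution to Li's formula of a zero together with its reflection. -/
noncomputable def liPair (n : ℕ) (ρ : ℂ) : ℂ := liTerm n ρ + liTerm n (1 - ρ)

lemma two_mul_sum_liTerm {F : Finset ℂ} (hF : ∀ ρ ∈ F, 1 - ρ ∈ F) (n : ℕ) :
    2 * ∑ ρ ∈ F, xiOrder ρ * liTerm n ρ = ∑ ρ ∈ F, xiOrder ρ * liPair n ρ := by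
  have h : ∑ ρ ∈ F, xiOrder ρ * liTerm n (1 - ρ) = ∑ ρ ∈ F, xiOrder ρ * liTerm n ρ :=
    Finset.sum_nbij' (fun ρ => 1 - ρ) (fun ρ => 1 - ρ) hF hF (by simp) (by simp)
      (by simp [xiOrder_one_sub])
  simp only [liPair, mul_add, Finset.sum_add_distrib, h]
  ring

lemma one_div_le_re_liPair_one {ρ : ℂ} (h : xiE ρ = 0) :
    1 / (1 + ρ.im ^ 2) ≤ (liPair 1 ρ).re := by
  have key : ∀ z : ℂ, xiE z = 0 → z.re / (1 + z.im ^ 2) ≤ (1 / z).re := fun z hz => by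
    have h1 := re_pos_of_xiE_eq_zero hz
    have h2 := re_lt_one_of_xiE_eq_zero hz
    rw [one_div, inv_re, normSq_apply]
    refine div_le_div_of_nonneg_left h1.le (by nlinarith) (by nlinarith)
  have h1 := key ρ h
  have h2 := key (1 - ρ) ((xiE_one_sub ρ).trans h)
  have h3 : (liPair 1 ρ).re = (1 / ρ).re + (1 / (1 - ρ)).re := by simp [liPair, liTerm]
  rw [h3]
  refine le_trans (le_of_eq ?_) (add_le_add h1 h2)
  simp
  ring

lemma norm_liTerm_le {n : ℕ} {ρ : ℂ} (h : 1 ≤ ‖ρ‖) : ‖liTerm n ρ‖ ≤ n * 2 ^ n / ‖ρ‖ := by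
  have hw : ‖1 - 1 / ρ‖ ≤ 2 := by
    refine (norm_sub_le _ _).trans ?_
    rw [norm_div, norm_one]
    have := (div_le_one (by linarith)).mpr h
    linarith
  rw [liTerm, ← mul_neg_geom_sum, sub_sub_cancel, norm_mul, norm_div, norm_one, one_div,
    inv_mul_eq_div]
  gcongr
  refine (norm_sum_le_of_le (Finset.range n) (f := fun i => (1 - 1 / ρ) ^ i)
    (n := fun _ => (2 : ℝ) ^ n) fun i hi => ?_).trans (by simp)
  rw [norm_pow]
  exact (pow_le_pow_left₀ (norm_nonneg _) hw i).trans
    (pow_le_pow_right₀ (by norm_num) (Finset.mem_range.mp hi).le)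

lemma liPair_eq_mul (n : ℕ) {ρ : ℂ} (h0 : ρ ≠ 0) (h1 : ρ ≠ 1) :
    liPair n ρ = liTerm n ρ * liTerm n (1 - ρ) := by
  have h1' := sub_ne_zero.mpr h1.symm
  have h : (1 - 1 / ρ) ^ n * (1 - 1 / (1 - ρ)) ^ n = 1 := by
    rw [← mul_pow]
    convert one_pow n
    field_simp
    ring
  rw [liPair, liTerm, liTerm]
  linear_combination -h

lemma norm_liPair_le {n : ℕ} {ρ : ℂ} (h : 1 ≤ |ρ.im|) :
    ‖liPair n ρ‖ ≤ 2 * (n * 2 ^ n) ^ 2 * (1 / (1 + ρ.im ^ 2)) := by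
  have hρ : |ρ.im| ≤ ‖ρ‖ := abs_im_le_norm ρ
  have hρ' : |ρ.im| ≤ ‖1 - ρ‖ := by simpa using abs_im_le_norm (1 - ρ)
  have h0 : ρ ≠ 0 := by
    rintro rfl
    norm_num at h
  have h1 : ρ ≠ 1 := by
    rintro rfl
    norm_num at h
  have hpos : 0 < |ρ.im| := by linarith
  rw [liPair_eq_mul n h0 h1, norm_mul]
  calc ‖liTerm n ρ‖ * ‖liTerm n (1 - ρ)‖
      ≤ (n * 2 ^ n / ‖ρ‖) * (n * 2 ^ n / ‖1 - ρ‖) :=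
        mul_le_mul (norm_liTerm_le (h.trans hρ)) (norm_liTerm_le (h.trans hρ'))
          (norm_nonneg _) (by positivity)
    _ ≤ (n * 2 ^ n / |ρ.im|) * (n * 2 ^ n / |ρ.im|) := by gcongr
    _ = (n * 2 ^ n) ^ 2 * (1 / ρ.im ^ 2) := by
        rw [← sq_abs ρ.im]
        ring
    _ ≤ (n * 2 ^ n) ^ 2 * (2 * (1 / (1 + ρ.im ^ 2))) := by
        have h2 : 1 ≤ ρ.im ^ 2 := by
          rw [← sq_abs]
          nlinarith
        gcongr
        rw [mul_one_div, div_le_div_iff₀ (by linarith) (by linarith)]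
        linarith
    _ = _ := by ring

lemma tendsto_finset_subtype_atTop {F : ℝ → Finset ℂ} (hmono : Monotone F)
    (hF' : ∀ ρ, xiE ρ = 0 → ∃ T, ρ ∈ F T) :
    Tendsto (fun T => (F T).subtype fun ρ => xiE ρ = 0) atTop atTop :=
  tendsto_atTop_finset_of_monotone
    (fun T T' h ρ hρ => by
      rw [Finset.mem_subtype] at hρ ⊢
      exact hmono h hρ)
    fun ρ => by simpa using hF' ρ ρ.2

lemma summable_xiOrder_div :
    Summable fun ρ : {ρ : ℂ // xiE ρ = 0} => (xiOrder ρ : ℝ) * (1 / (1 + (ρ : ℂ).im ^ 2)) := by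
  set L := iteratedDeriv (0 + 1) PhiKL 0 / (Nat.factorial 0 : ℂ)
  have hlim : ∀ᶠ R : ℝ in atTop,
      (2 * ∑ ρ ∈ xiZeros R, xiOrder ρ * liTerm 1 ρ).re < (2 * L).re + 1 :=
    ((continuous_re.tendsto _).comp ((tendsto_sum_xiZeros 0).const_mul 2)).eventually
      (eventually_lt_nhds (lt_add_one _))
  refine summable_of_sum_le (c := (2 * L).re + 1) (fun ρ => by positivity) fun u => ?_
  have hu := (tendsto_finset_subtype_atTop xiZeros_mono
    fun ρ hρ => ⟨_, mem_xiZeros.mpr ⟨hρ, le_rfl⟩⟩).eventually (eventually_ge_atTop u)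
  obtain ⟨R, hR, hRu⟩ := (hlim.and hu).exists
  calc ∑ ρ ∈ u, (xiOrder ρ : ℝ) * (1 / (1 + (ρ : ℂ).im ^ 2))
      ≤ ∑ ρ ∈ (xiZeros R).subtype fun ρ => xiE ρ = 0,
          (xiOrder ρ : ℝ) * (1 / (1 + (ρ : ℂ).im ^ 2)) :=
        Finset.sum_le_sum_of_subset_of_nonneg hRu fun ρ _ _ => by positivity
    _ = ∑ ρ ∈ xiZeros R, (xiOrder ρ : ℝ) * (1 / (1 + ρ.im ^ 2)) :=
        Finset.sum_subtype_of_mem (fun ρ : ℂ => (xiOrder ρ : ℝ) * (1 / (1 + ρ.im ^ 2)))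
          fun ρ hρ => (mem_xiZeros.mp hρ).1
    _ ≤ ∑ ρ ∈ xiZeros R, (xiOrder ρ * liPair 1 ρ).re := by
        refine Finset.sum_le_sum fun ρ hρ => ?_
        rw [← ofReal_natCast, re_ofReal_mul]
        gcongr
        exact one_div_le_re_liPair_one (mem_xiZeros.mp hρ).1
    _ = (2 * ∑ ρ ∈ xiZeros R, xiOrder ρ * liTerm 1 ρ).re := by
        rw [two_mul_sum_liTerm fun ρ => one_sub_mem_xiZeros, re_sum]
    _ ≤ _ := hR.le

lemma summable_liPair (n : ℕ) :
    Summable fun ρ : {ρ : ℂ // xiE ρ = 0} => (xiOrder ρ : ℂ) * liPair n ρ := by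
  refine Summable.of_norm_bounded_eventually
    (summable_xiOrder_div.mul_left (2 * (n * 2 ^ n) ^ 2 : ℝ)) ?_
  have hfin : ((↑) ⁻¹' (xiZerosHeight 1 : Set ℂ) : Set {ρ : ℂ // xiE ρ = 0}).Finite :=
    (xiZerosHeight 1).finite_toSet.preimage Subtype.val_injective.injOn
  filter_upwards [hfin.compl_mem_cofinite] with ρ hρ
  have hρ' : 1 ≤ |(ρ : ℂ).im| := by
    by_contra! h
    exact hρ (mem_xiZerosHeight.mpr ⟨ρ.2, h.le⟩)
  rw [norm_mul, norm_natCast]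
  calc (xiOrder ρ : ℝ) * ‖liPair n ρ‖
      ≤ xiOrder ρ * (2 * (n * 2 ^ n) ^ 2 * (1 / (1 + (ρ : ℂ).im ^ 2))) := by
        gcongr
        exact norm_liPair_le hρ'
    _ = _ := by ring

/-- Any two symmetric exhaustions of the zeros give the same limit in Li's formula. -/
lemma tendsto_sum_liTerm (n : ℕ) {F : ℝ → Finset ℂ} (hmono : Monotone F)
    (hF : ∀ T, ∀ ρ ∈ F T, xiE ρ = 0) (hF' : ∀ ρ, xiE ρ = 0 → ∃ T, ρ ∈ F T)
    (hsymm : ∀ T, ∀ ρ ∈ F T, 1 - ρ ∈ F T) :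
    Tendsto (fun T => ∑ ρ ∈ F T, xiOrder ρ * liTerm n ρ) atTop
      (𝓝 ((∑' ρ : {ρ : ℂ // xiE ρ = 0}, xiOrder ρ * liPair n ρ) / 2)) := by
  have h := ((summable_liPair n).hasSum.comp (tendsto_finset_subtype_atTop hmono hF')).div_const 2
  refine h.congr fun T => ?_
  have h2 := two_mul_sum_liTerm (hsymm T) n
  simp only [Function.comp]
  rw [Finset.sum_subtype_of_mem (fun ρ : ℂ => (xiOrder ρ : ℂ) * liPair n ρ) (hF T), ← h2]
  ring

lemma tendsto_sum_xiZerosHeight (k : ℕ) :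
    Tendsto (fun T : ℝ => ∑ ρ ∈ xiZerosHeight T, xiOrder ρ * liTerm (k + 1) ρ) atTop
      (𝓝 (iteratedDeriv (k + 1) PhiKL 0 / k.factorial)) := by
  rw [tendsto_nhds_unique (tendsto_sum_xiZeros k) (tendsto_sum_liTerm (k + 1) xiZeros_mono
    (fun R ρ hρ => (mem_xiZeros.mp hρ).1) (fun ρ hρ => ⟨_, mem_xiZeros.mpr ⟨hρ, le_rfl⟩⟩)
    fun R ρ => one_sub_mem_xiZeros)]
  exact tendsto_sum_liTerm (k + 1) xiZerosHeight_mono (fun T ρ hρ => (mem_xiZerosHeight.mp hρ).1)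
    (fun ρ hρ => ⟨_, mem_xiZerosHeight.mpr ⟨hρ, le_rfl⟩⟩) fun T ρ => one_sub_mem_xiZerosHeight

lemma tsum_zeros_eq_sum (n : ℕ) (T : ℝ) :
    ∑' ρ : {ρ : ℂ // xi2 ρ = 0 ∧ |ρ.im| ≤ T}, (xiOrder ρ : ℂ) * (1 - (1 - 1 / (ρ : ℂ)) ^ n) =
      ∑ ρ ∈ xiZerosHeight T, xiOrder ρ * liTerm n ρ := by
  refine (tsum_subtype {ρ : ℂ | xi2 ρ = 0 ∧ |ρ.im| ≤ T}
    fun ρ : ℂ => (xiOrder ρ : ℂ) * (1 - (1 - 1 / ρ) ^ n)).trans ?_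
  rw [tsum_eq_sum (s := xiZerosHeight T)]
  · refine Finset.sum_congr rfl fun ρ hρ => indicator_of_mem ?_ _
    rw [mem_xiZerosHeight] at hρ
    exact ⟨xi2_eq_zero_of_xiOrder_ne_zero (Nat.one_le_iff_ne_zero.mp (one_le_xiOrder hρ.1)), hρ.2⟩
  · intro ρ hρ
    refine indicator_apply_eq_zero.mpr fun h => ?_
    have h0 : xiE ρ ≠ 0 := fun h0 => hρ (mem_xiZerosHeight.mpr ⟨h0, h.2⟩)
    rw [xiOrder_eq_zero_of_xiE_ne_zero h0, Nat.cast_zero, zero_mul]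

lemma eventually_PhiKL_conj :
    PhiKL ∘ starRingEnd ℂ =ᶠ[𝓝 0] starRingEnd ℂ ∘ PhiKL := by
  have hconj : Tendsto (starRingEnd ℂ) (𝓝 0) (𝓝 0) := by
    simpa using (continuous_conj.tendsto (0 : ℂ))
  have hre : ∀ᶠ z : ℂ in 𝓝 0, 0 < (1 / (1 - z)).re :=
    tendsto_one_div_one_sub.eventually
      ((isOpen_lt continuous_const continuous_re).mem_nhds (by simp))
  filter_upwards [PhiKL_eventuallyEq, hconj.eventually PhiKL_eventuallyEq, hre,
    eventually_xiE_mem_slitPlane] with z h1 h2 h3 h4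
  have h5 : 1 / (1 - starRingEnd ℂ z) = starRingEnd ℂ (1 / (1 - z)) := by simp
  simp only [Function.comp, h1, h2, h5]
  rw [xiE_conj h3, log_conj _ (mem_slitPlane_iff_arg.mp h4).1]

lemma iteratedDeriv_PhiKL_conj (n : ℕ) :
    starRingEnd ℂ (iteratedDeriv n PhiKL 0) = iteratedDeriv n PhiKL 0 := by
  have h : ∀ f : ℂ → ℂ,
      iteratedDeriv n (starRingEnd ℂ ∘ f ∘ starRingEnd ℂ) =
        starRingEnd ℂ ∘ iteratedDeriv n f ∘ starRingEnd ℂ := fun f => by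
    induction n with
    | zero => simp
    | succ k ih => rw [iteratedDeriv_succ, iteratedDeriv_succ, ih, deriv_conj_conj]
  have hgerm : starRingEnd ℂ ∘ PhiKL ∘ starRingEnd ℂ =ᶠ[𝓝 0] PhiKL :=
    eventually_PhiKL_conj.mono fun z hz => by
      have := congrArg (starRingEnd ℂ) hz
      simpa using this
  have h2 := hgerm.iteratedDeriv_eq n
  rw [h] at h2
  simpa using h2

lemma lambdaL_succ_s15 (k : ℕ) :
    (lambdaL (k + 1) : ℂ) = iteratedDeriv (k + 1) PhiKL 0 / k.factorial := by
  have h1 : starRingEnd ℂ (iteratedDeriv (k + 1) PhiKL 0 / ((k + 1).factorial : ℂ)) =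
      iteratedDeriv (k + 1) PhiKL 0 / ((k + 1).factorial : ℂ) := by
    rw [map_div₀, iteratedDeriv_PhiKL_conj, map_natCast]
  have hk : (k.factorial : ℂ) ≠ 0 := Nat.cast_ne_zero.mpr k.factorial_ne_zero
  have hk' : ((k : ℂ) + 1) ≠ 0 := Nat.cast_add_one_ne_zero k
  rw [lambdaL, lambdaK, ofReal_mul, conj_eq_iff_re.mp h1, Nat.factorial_succ]
  push_cast
  field_simp

end

/-- **Li's sum formula**: for `n ≥ 1`, the symmetrically grouped sums over the
zeros of `2ξ` (with multiplicity) converge to `λ_n^L`: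
`lim_{T→∞} Σ_{|Im ρ| ≤ T} m_ρ (1 - (1 - 1/ρ)^n) = λ_n^L`. -/
theorem li_sum_formula (n : ℕ) (hn : 1 ≤ n) :
    Filter.Tendsto
      (fun T : ℝ =>
        ∑' ρ : {ρ : ℂ // xi2 ρ = 0 ∧ |ρ.im| ≤ T},
          (xiOrder ρ : ℂ) * (1 - (1 - 1 / (ρ : ℂ)) ^ n))
      Filter.atTop (nhds ((lambdaL n : ℂ))) := by
  obtain ⟨k, rfl⟩ := Nat.exists_eq_add_of_le' hn
  rw [lambdaL_succ_s15]
  simp only [tsum_zeros_eq_sum]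
  exact tendsto_sum_xiZerosHeight k
end
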